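/- arXiv:1506.02576 — 3 statements merged into one kernel-verified Lean document; each statement's English description precedes it below -/
import Mathlib

section
/- Let H be a graph on eight vertices x_1, x_2, x_3, x_4, y_1, y_2, y_3, y_4 in which every pair of distinct vertices is adjacent except exactly the eight pairs {x_1, y_1}, {x_1, y_3}, {x_1, y_4}, {x_2, y_2}, {x_2, y_3}, {x_2, y_4}, {x_3, y_3}, {x_4, y_4}. Let L be a list assignment on V(H) such that |L(x_1)| = 2, |L(x_2)| = 2, and |L(w)| = 4 for every vertex w ∈ V(H) \ {x_1, x_2}. Then H admits an L-coloring. -/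
open SimpleGraph

variable {V : Type*}

/-- An `L`-coloring: a proper vertex coloring `c` with `c v ∈ L v` for every vertex. -/
def ListColorable (G : SimpleGraph V) (L : V → Finset ℕ) : Prop :=
  ∃ c : V → ℕ, (∀ v, c v ∈ L v) ∧ ∀ ⦃u w : V⦄, G.Adj u w → c u ≠ c w

/-- `G` is `k`-choosable: `L`-colorable for every list assignment with lists of size `k`. -/
def Choosable (G : SimpleGraph V) (k : ℕ) : Prop :=
  ∀ L : V → Finset ℕ, (∀ v, (L v).card = k) → ListColorable G L

/-- The choice number (list-chromatic number) of `G`. -/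
noncomputable def choiceNumber (G : SimpleGraph V) : ℕ :=
  sInf {k | Choosable G k}

/-- The clique number of `G`. -/
noncomputable def cliqueNumber (G : SimpleGraph V) : ℕ :=
  sSup {n | ∃ s : Finset V, G.IsNClique n s}

/-- `G` has no induced claw (`K_{1,3}`). -/
def IsClawFree (G : SimpleGraph V) : Prop :=
  ∀ a b c d : V, G.Adj a b → G.Adj a c → G.Adj a d →
    ¬G.Adj b c → ¬G.Adj b d → ¬G.Adj c d → b ≠ c → b ≠ d → c ≠ d → False

/-- `G` is perfect: every induced subgraph has chromatic number equal to clique number. -/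
def IsPerfect (G : SimpleGraph V) : Prop :=
  ∀ s : Set V, (G.induce s).chromaticNumber = (cliqueNumber (G.induce s) : ℕ∞)

/-- `S` is complete to `T`: every vertex of `S` is adjacent to every vertex of `T`. -/
def IsCompleteTo (G : SimpleGraph V) (S T : Set V) : Prop :=
  ∀ ⦃s⦄, s ∈ S → ∀ ⦃t⦄, t ∈ T → G.Adj s t

/-- `S` is anticomplete to `T`: no vertex of `S` is adjacent to any vertex of `T`. -/
def IsAnticompleteTo (G : SimpleGraph V) (S T : Set V) : Prop :=
  ∀ ⦃s⦄, s ∈ S → ∀ ⦃t⦄, t ∈ T → ¬G.Adj s t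

/-- `(A, B, Q)` is a peculiar partition of `G` (indices mod 3). -/
structure IsPeculiarPartition (G : SimpleGraph V) (A B Q : Fin 3 → Set V) : Prop where
  cover : ∀ v : V, (∃ i, v ∈ A i) ∨ (∃ i, v ∈ B i) ∨ (∃ i, v ∈ Q i)
  pairwiseDisjoint :
    Pairwise (Function.onFun Disjoint (fun p : Fin 3 × Fin 3 => ![A, B, Q] p.1 p.2))
  nonemptyA : ∀ i, (A i).Nonempty
  nonemptyB : ∀ i, (B i).Nonempty
  nonemptyQ : ∀ i, (Q i).Nonempty
  cliqueA : ∀ i, G.IsClique (A i)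
  cliqueB : ∀ i, G.IsClique (B i)
  cliqueQ : ∀ i, G.IsClique (Q i)
  A_complete : ∀ i, IsCompleteTo G (A i) (B i ∪ A (i + 1) ∪ A (i + 2) ∪ B (i + 2))
  A_not_complete : ∀ i, ¬ IsCompleteTo G (A i) (B (i + 1))
  B_complete : ∀ i, IsCompleteTo G (B i) (A i ∪ B (i + 1) ∪ B (i + 2) ∪ A (i + 1))
  B_not_complete : ∀ i, ¬ IsCompleteTo G (B i) (A (i + 2))
  Q_complete : ∀ i, IsCompleteTo G (Q i) (A (i + 1) ∪ B (i + 1) ∪ A (i + 2) ∪ B (i + 2))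
  Q_anticomplete : ∀ i, IsAnticompleteTo G (Q i) (A i ∪ B i ∪ Q (i + 1) ∪ Q (i + 2))

/-- `G` is peculiar if it admits a peculiar partition. -/
def IsPeculiar (G : SimpleGraph V) : Prop :=
  ∃ A B Q : Fin 3 → Set V, IsPeculiarPartition G A B Q

/-- `G` is cobipartite: its vertex set is covered by at most two cliques. -/
def Cobipartite (G : SimpleGraph V) : Prop :=
  ∃ S T : Set V, S ∪ T = Set.univ ∧ G.IsClique S ∧ G.IsClique T


lemma aux_pairs (s t U W : Finset ℕ) (hs : 2 ≤ s.card) (ht : 2 ≤ t.card) :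
    ∃ a ∈ s, ∃ b ∈ t, a ≠ b ∧ ¬(U = {a} ∧ W = {b}) := by
  obtain ⟨a1, h1, a2, h2, h12⟩ := Finset.one_lt_card.mp hs
  obtain ⟨b1, k1, b2, k2, k12⟩ := Finset.one_lt_card.mp ht
  by_contra! hc
  have e : ∀ a ∈ s, ∀ b ∈ t, a ≠ b → a ∈ U ∧ b ∈ W ∧ (∀ x ∈ U, x = a) ∧ (∀ x ∈ W, x = b) := by
    intro a ha b hb hab
    obtain ⟨h, h'⟩ := hc a ha b hb hab
    subst h h'
    simp
  have e11 := e a1 h1 b1 k1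
  have e12 := e a1 h1 b2 k2
  have e21 := e a2 h2 b1 k1
  have e22 := e a2 h2 b2 k2
  grind

lemma aux_sdiff2 (C : Finset ℕ) (x y : ℕ) (hC : 3 ≤ C.card) : ∃ z ∈ C, z ≠ x ∧ z ≠ y := by
  have h : ({x, y} : Finset ℕ).card < C.card := lt_of_le_of_lt Finset.card_le_two (by omega)
  obtain ⟨z, hz, hz'⟩ := Finset.exists_mem_notMem_of_card_lt_card h
  refine ⟨z, hz, ?_⟩
  simpa using hz'

lemma aux_sdr (A B C D : Finset ℕ) (hA : 1 ≤ A.card) (hB : 1 ≤ B.card)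
    (hC : 3 ≤ C.card) (hD : 3 ≤ D.card) (hAB : 2 ≤ (A ∪ B).card)
    (h4 : 4 ≤ (A ∪ B ∪ C ∪ D).card) :
    ∃ a ∈ A, ∃ b ∈ B, ∃ c ∈ C, ∃ d ∈ D,
      a ≠ b ∧ a ≠ c ∧ a ≠ d ∧ b ≠ c ∧ b ≠ d ∧ c ≠ d := by
  obtain ⟨a, ha, b, hb, hab⟩ : ∃ a ∈ A, ∃ b ∈ B, a ≠ b := by
    obtain ⟨a0, ha0⟩ := Finset.card_pos.mp hA
    obtain ⟨b0, hb0⟩ := Finset.card_pos.mp hB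
    obtain ⟨u, hu, v, hv, huv⟩ := Finset.one_lt_card.mp hAB
    by_contra! hc
    have := hc a0 ha0 b0 hb0
    grind
  by_contra! hc
  obtain ⟨z, hz, hza, hzb⟩ := aux_sdiff2 C a b hC
  have key : ∀ c ∈ C, c ≠ a → c ≠ b → ∀ d ∈ D, d ≠ a → d ≠ b → c = d := by
    intro c hc1 h1 h2 d hd h3 h4
    exact hc a ha b hb c hc1 d hd hab h1.symm h3.symm h2.symm h4.symm
  obtain ⟨z', hz', hza', hzb'⟩ := aux_sdiff2 D a b hD
  have hzz := key z hz hza hzb z' hz' hza' hzb'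
  subst hzz
  have c3 : ({a, b, z} : Finset ℕ).card ≤ 3 := Finset.card_le_three
  have hCs : C ⊆ {a, b, z} := by
    intro c hcc
    have := key c hcc
    have := this
    by_contra hn
    simp only [Finset.mem_insert, Finset.mem_singleton, not_or] at hn
    exact hn.2.2 (key c hcc hn.1 hn.2.1 z hz' hza hzb)
  have hDs : D ⊆ {a, b, z} := by
    intro d hd
    by_contra hn
    simp only [Finset.mem_insert, Finset.mem_singleton, not_or] at hn
    exact hn.2.2 (key z hz hza hzb d hd hn.1 hn.2.1).symm
  have hCe := Finset.eq_of_subset_of_card_le hCs (by omega)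
  have hDe := Finset.eq_of_subset_of_card_le hDs (by omega)
  obtain ⟨w, hw, hw'⟩ := Finset.exists_mem_notMem_of_card_lt_card
    (show ({a, b, z} : Finset ℕ).card < (A ∪ B ∪ C ∪ D).card by omega)
  have hwAB : w ∈ A ∨ w ∈ B := by
    rw [hCe, hDe] at hw
    grind
  simp only [Finset.mem_insert, Finset.mem_singleton, not_or] at hw'
  have haC : a ∈ C := by simp [hCe]
  have hbC : b ∈ C := by simp [hCe]
  rcases hwAB with h | h
  · exact hza (hc w h b hb a haC z hz' hw'.2.1 hw'.1 hw'.2.2 hab.symm hzb.symm).symm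
  · exact hzb (hc a ha w h b hbC z hz' (Ne.symm hw'.1) hab hza.symm hw'.2.1 hw'.2.2).symm

lemma aux_rem3 (Y : Finset ℕ) (b p q : ℕ) (h : Y.card = 4) : 1 ≤ (Y \ {b, p, q}).card := by
  have := Finset.le_card_sdiff ({b, p, q} : Finset ℕ) Y
  have c3 : ({b, p, q} : Finset ℕ).card ≤ 3 := Finset.card_le_three
  omega

lemma aux_eq4 (Y : Finset ℕ) (b p q z : ℕ) (h : Y.card = 4) (hz : Y \ {b, p, q} ⊆ {z}) :
    Y = {b, p, q, z} := by
  apply Finset.eq_of_subset_of_card_le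
  · intro x hx
    by_contra hn
    have : x ∈ Y \ {b, p, q} := by grind
    have := hz this
    grind
  · rw [h]; exact Finset.card_le_four

lemma aux_F1 (Y1 Y2 : Finset ℕ) (a b p q : ℕ) (h1 : Y1.card = 4) (h2 : Y2.card = 4)
    (hab : a ≠ b) (hap : a ≠ p) (haq : a ≠ q) (hbp : b ≠ p) (hbq : b ≠ q)
    (h : ((Y1 \ {b, p, q}) ∪ (Y2 \ {a, p, q})).card ≤ 1) :
    Y2 \ Y1 = {a} ∧ Y1 \ Y2 = {b} := by
  obtain ⟨z, hz⟩ := Finset.card_pos.mp (aux_rem3 Y1 b p q h1)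
  obtain ⟨z', hz'⟩ := Finset.card_pos.mp (aux_rem3 Y2 a p q h2)
  have hu := Finset.card_le_one.mp h
  have e1 := aux_eq4 Y1 b p q z h1 (by
    intro x hx
    have := hu x (by grind) z (by grind)
    simp [this])
  have e2 := aux_eq4 Y2 a p q z h2 (by
    intro x hx
    have := hu x (by grind) z (by grind)
    simp [this])
  have hzz := hu z (by grind) z' (by grind)
  subst hzz
  have z1 : z ≠ b := by grind
  have z2 : z ≠ a := by grind
  clear hu hz hz' h h1 h2
  subst e1 e2
  constructor
  · ext x; simp only [Finset.mem_sdiff, Finset.mem_insert, Finset.mem_singleton]; grind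
  · ext x; simp only [Finset.mem_sdiff, Finset.mem_insert, Finset.mem_singleton]; grind

lemma aux_F2 (S Y3 Y4 : Finset ℕ) (p q : ℕ) (h3 : Y3.card = 4) (h4 : Y4.card = 4)
    (hpq : p ≠ q)
    (h : (S ∪ (Y3 \ {q}) ∪ (Y4 \ {p})).card ≤ 3) :
    Y4 \ Y3 = {p} ∧ Y3 \ Y4 = {q} := by
  have l3 : 3 ≤ (Y3 \ {q}).card := by
    have := Finset.le_card_sdiff ({q} : Finset ℕ) Y3
    simp at this; omega
  have l4 : 3 ≤ (Y4 \ {p}).card := by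
    have := Finset.le_card_sdiff ({p} : Finset ℕ) Y4
    simp at this; omega
  have e3 : Y3 \ {q} = S ∪ (Y3 \ {q}) ∪ (Y4 \ {p}) :=
    Finset.eq_of_subset_of_card_le (by intro x hx; grind) (by omega)
  have e4 : Y4 \ {p} = S ∪ (Y3 \ {q}) ∪ (Y4 \ {p}) :=
    Finset.eq_of_subset_of_card_le (by intro x hx; grind) (by omega)
  have e : Y3 \ {q} = Y4 \ {p} := e3.trans e4.symm
  have hq : q ∈ Y3 := by
    by_contra hq
    rw [← e3, Finset.sdiff_eq_self_of_disjoint (Finset.disjoint_singleton_right.mpr hq)] at h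
    omega
  have hp : p ∈ Y4 := by
    by_contra hp
    rw [← e4, Finset.sdiff_eq_self_of_disjoint (Finset.disjoint_singleton_right.mpr hp)] at h
    omega
  have ee : ∀ x, (x ∈ Y3 ∧ x ≠ q) ↔ (x ∈ Y4 ∧ x ≠ p) := by
    intro x
    have := Finset.ext_iff.mp e x
    simpa using this
  constructor
  · ext x; have := ee x; have := ee p; simp only [Finset.mem_sdiff, Finset.mem_singleton]; grind
  · ext x; have := ee x; have := ee q; simp only [Finset.mem_sdiff, Finset.mem_singleton]; grind

lemma aux_main (X1 X2 X3 X4 Y1 Y2 Y3 Y4 : Finset ℕ) (hX1 : X1.card = 2) (hX2 : X2.card = 2)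
    (hX3 : X3.card = 4) (hX4 : X4.card = 4) (hY1 : Y1.card = 4) (hY2 : Y2.card = 4)
    (hY3 : Y3.card = 4) (hY4 : Y4.card = 4) :
    ∃ a ∈ X1, ∃ b ∈ X2, ∃ p ∈ X3, ∃ q ∈ X4, ∃ r ∈ Y1, ∃ s ∈ Y2, ∃ t ∈ Y3, ∃ u ∈ Y4,
      (a ≠ b ∧ a ≠ p ∧ a ≠ q ∧ b ≠ p ∧ b ≠ q ∧ p ≠ q) ∧
      (r ≠ b ∧ r ≠ p ∧ r ≠ q ∧ s ≠ a ∧ s ≠ p ∧ s ≠ q ∧ t ≠ q ∧ u ≠ p) ∧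
      (r ≠ s ∧ r ≠ t ∧ r ≠ u ∧ s ≠ t ∧ s ≠ u ∧ t ≠ u) := by
  obtain ⟨a, ha, b, hb, hab, hn1⟩ := aux_pairs X1 X2 (Y2 \ Y1) (Y1 \ Y2) hX1.ge hX2.ge
  have l2 : ({a, b} : Finset ℕ).card ≤ 2 := Finset.card_le_two
  have d3 := Finset.le_card_sdiff ({a, b} : Finset ℕ) X3
  have d4 := Finset.le_card_sdiff ({a, b} : Finset ℕ) X4
  obtain ⟨p, hp, q, hq, hpq, hn2⟩ := aux_pairs (X3 \ {a, b}) (X4 \ {a, b}) (Y4 \ Y3) (Y3 \ Y4)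
    (by omega) (by omega)
  simp only [Finset.mem_sdiff, Finset.mem_insert, Finset.mem_singleton, not_or] at hp hq
  obtain ⟨hp, hpa, hpb⟩ := hp
  obtain ⟨hq, hqa, hqb⟩ := hq
  have l3 : 3 ≤ (Y3 \ {q}).card := by
    have := Finset.le_card_sdiff ({q} : Finset ℕ) Y3
    simp at this; omega
  have l4 : 3 ≤ (Y4 \ {p}).card := by
    have := Finset.le_card_sdiff ({p} : Finset ℕ) Y4
    simp at this; omega
  obtain ⟨r, hr, s, hs, t, ht, u, hu, h⟩ := aux_sdr (Y1 \ {b, p, q}) (Y2 \ {a, p, q})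
    (Y3 \ {q}) (Y4 \ {p}) (aux_rem3 _ _ _ _ hY1) (aux_rem3 _ _ _ _ hY2) l3 l4
    (by
      by_contra hlt
      exact hn1 (aux_F1 Y1 Y2 a b p q hY1 hY2 hab (Ne.symm hpa) (Ne.symm hqa) (Ne.symm hpb) (Ne.symm hqb)
        (by omega)))
    (by
      by_contra hlt
      exact hn2 (aux_F2 ((Y1 \ {b, p, q}) ∪ (Y2 \ {a, p, q})) Y3 Y4 p q hY3 hY4 hpq (by omega)))
  simp only [Finset.mem_sdiff, Finset.mem_insert, Finset.mem_singleton, not_or] at hr hs ht hu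
  exact ⟨a, ha, b, hb, p, hp, q, hq, r, hr.1, s, hs.1, t, ht.1, u, hu.1,
    ⟨hab, (Ne.symm hpa), (Ne.symm hqa), (Ne.symm hpb), (Ne.symm hqb), hpq⟩,
    ⟨hr.2.1, hr.2.2.1, hr.2.2.2, hs.2.1, hs.2.2.1, hs.2.2.2, ht.2, hu.2⟩, h⟩

/-- For the complete graph on `{x₁, x₂, x₃, x₄, y₁, y₂, y₃, y₄}`
minus exactly the eight edges `x₁y₁, x₁y₃, x₁y₄, x₂y₂, x₂y₃, x₂y₄, x₃y₃, x₄y₄`, with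
`|L(x₁)| = |L(x₂)| = 2` and all other lists of size 4, `H` is `L`-colorable. -/
theorem list_colorable_c4
    {V : Type*} (H : SimpleGraph V) (x1 x2 x3 x4 y1 y2 y3 y4 : V)
    (hnodup : [x1, x2, x3, x4, y1, y2, y3, y4].Nodup)
    (huniv : ∀ v : V, v = x1 ∨ v = x2 ∨ v = x3 ∨ v = x4 ∨
      v = y1 ∨ v = y2 ∨ v = y3 ∨ v = y4)
    (hadj : ∀ u v : V, H.Adj u v ↔
      u ≠ v ∧ ¬((u, v) ∈ ({(x1, y1), (y1, x1), (x1, y3), (y3, x1), (x1, y4), (y4, x1),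
        (x2, y2), (y2, x2), (x2, y3), (y3, x2), (x2, y4), (y4, x2),
        (x3, y3), (y3, x3), (x4, y4), (y4, x4)} : Set (V × V))))
    (L : V → Finset ℕ)
    (hLx1 : (L x1).card = 2) (hLx2 : (L x2).card = 2)
    (hL : ∀ w : V, w ≠ x1 → w ≠ x2 → (L w).card = 4) :
    ListColorable H L := by
  classical
  simp only [List.nodup_cons, List.mem_cons, List.not_mem_nil, or_false, not_or,
    not_false_eq_true, List.nodup_nil, and_true] at hnodup
  obtain ⟨⟨n12, n13, n14, n15, n16, n17, n18⟩, ⟨n23, n24, n25, n26, n27, n28⟩,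
    ⟨n34, n35, n36, n37, n38⟩, ⟨n45, n46, n47, n48⟩, ⟨n56, n57, n58⟩, ⟨n67, n68⟩, n78⟩ := hnodup
  obtain ⟨a, ha, b, hb, p, hp, q, hq, r, hr, s, hs, t, ht, u, hu, hX, hXY, hY⟩ :=
    aux_main (L x1) (L x2) (L x3) (L x4) (L y1) (L y2) (L y3) (L y4) hLx1 hLx2
      (hL _ (Ne.symm n13) (Ne.symm n23)) (hL _ (Ne.symm n14) (Ne.symm n24))
      (hL _ (Ne.symm n15) (Ne.symm n25)) (hL _ (Ne.symm n16) (Ne.symm n26))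
      (hL _ (Ne.symm n17) (Ne.symm n27)) (hL _ (Ne.symm n18) (Ne.symm n28))
  obtain ⟨c, c1, c2, c3, c4, c5, c6, c7, c8⟩ : ∃ c : V → ℕ, c x1 = a ∧ c x2 = b ∧ c x3 = p ∧
      c x4 = q ∧ c y1 = r ∧ c y2 = s ∧ c y3 = t ∧ c y4 = u := by
    refine ⟨fun v => if v = x1 then a else if v = x2 then b else if v = x3 then p else
      if v = x4 then q else if v = y1 then r else if v = y2 then s else if v = y3 then t else u,
      ?_⟩
    grind
  refine ⟨c, ?_, ?_⟩
  · intro v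
    rcases huniv v with h | h | h | h | h | h | h | h <;> subst h <;> simp only [*]
  · intro v w hvw
    rw [hadj] at hvw
    obtain ⟨hne, hvw⟩ := hvw
    simp only [Set.mem_insert_iff, Set.mem_singleton_iff, Prod.mk.injEq, not_or] at hvw
    obtain ⟨g1, g2, g3, g4, g5, g6⟩ := hX
    obtain ⟨k1, k2, k3, k4, k5, k6, k7, k8⟩ := hXY
    obtain ⟨m1, m2, m3, m4, m5, m6⟩ := hY
    clear hadj hL hLx1 hLx2 ha hb hp hq hr hs ht hu
    rcases huniv v with h | h | h | h | h | h | h | h <;>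
    rcases huniv w with h' | h' | h' | h' | h' | h' | h' | h' <;>
    rw [h, h'] at hvw hne ⊢ <;>
    first
    | exact absurd rfl hne
    | (simp only [c1, c2, c3, c4, c5, c6, c7, c8]; first | assumption | (apply Ne.symm; assumption))
    | (exfalso; simp at hvw)
end

section
/- Let H be a cobipartite graph with clique number ω(H) ≤ 4. Let C be a clique of size 3 in H such that for every w ∈ C, the set N(w) \ C is a clique. Let L be a list assignment on V(H) such that |L(w)| = 3 for all w ∈ C and |L(v)| = 4 for all v ∈ V(H) \ C. Then H admits an L-coloring. -/
open SimpleGraph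

variable {V : Type*}

theorem hall_on {κ α : Type*} [DecidableEq κ] [DecidableEq α] [Inhabited α] (J : Finset κ) (t : κ → Finset α)
    (h : ∀ s ⊆ J, s.card ≤ (s.biUnion t).card) :
    ∃ f : κ → α, Set.InjOn f J ∧ ∀ x ∈ J, f x ∈ t x := by
  classical
  have := (Finset.all_card_le_biUnion_card_iff_exists_injective (fun x : J => t x)).1 (by
    intro s
    have h1 := h (s.map (Function.Embedding.subtype _)) (by
      intro x hx
      simp only [Finset.mem_map, Function.Embedding.coe_subtype] at hx
      obtain ⟨a, _, rfl⟩ := hx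
      exact a.2)
    rw [Finset.card_map] at h1
    refine h1.trans (Finset.card_le_card ?_)
    intro c hc
    simp only [Finset.mem_biUnion, Finset.mem_map, Function.Embedding.coe_subtype] at hc ⊢
    obtain ⟨a, ⟨b, hb, rfl⟩, hc⟩ := hc
    exact ⟨b, hb, hc⟩)
  obtain ⟨f, hf, hm⟩ := this
  refine ⟨fun x => if hx : x ∈ J then f ⟨x, hx⟩ else default, ?_, ?_⟩
  · intro a ha b hb hab
    have ha' : a ∈ J := ha
    have hb' : b ∈ J := hb
    simp only [ha', hb', dif_pos] at hab
    simpa using hf hab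
  · intro x hx
    simpa [hx] using hm ⟨x, hx⟩

theorem hall_easy {κ : Type*} [DecidableEq κ] (J : Finset κ) (t : κ → Finset ℕ)
    (h : ∀ i ∈ J, J.card ≤ (t i).card) :
    ∃ f : κ → ℕ, Set.InjOn f J ∧ ∀ x ∈ J, f x ∈ t x := by
  apply hall_on
  intro s hs
  rcases s.eq_empty_or_nonempty with rfl | ⟨i, hi⟩
  · simp
  · exact (Finset.card_le_card hs).trans ((h i (hs hi)).trans
      (Finset.card_le_card (Finset.subset_biUnion_of_mem t hi)))

theorem sum_split {ι : Type*} [DecidableEq ι] (I : Finset ι) (s : Finset (ι ⊕ ι))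
    (hs : s ⊆ I.disjSum I) :
    s.card ≤ 2 * I.card ∧ ((∃ i ∈ I, Sum.inl i ∈ s ∧ Sum.inr i ∈ s) ∨ s.card ≤ I.card) := by
  have hc := Finset.card_toLeft_add_card_toRight (u := s)
  have hl : s.toLeft ⊆ I := by
    intro i hi
    simpa using hs (Finset.mem_toLeft.1 hi)
  have hr : s.toRight ⊆ I := by
    intro i hi
    simpa using hs (Finset.mem_toRight.1 hi)
  have hl' := Finset.card_le_card hl
  have hr' := Finset.card_le_card hr
  refine ⟨by omega, ?_⟩
  by_cases hd : Disjoint s.toLeft s.toRight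
  · right
    rw [← hc, ← Finset.card_union_of_disjoint hd]
    exact Finset.card_le_card (Finset.union_subset hl hr)
  · left
    obtain ⟨i, h1, h2⟩ := Finset.not_disjoint_iff.1 hd
    exact ⟨i, hl h1, Finset.mem_toLeft.1 h1, Finset.mem_toRight.1 h2⟩

theorem slot_lemma {ι : Type*} [DecidableEq ι] (side : ι → Prop) (n : ℕ) :
    ∀ (I : Finset ι) (Lw Lu : ι → Finset ℕ) (Lx Ly : Finset ℕ), I.card = n →
    (∀ i ∈ I, n ≤ (Lw i).card) → (∀ i ∈ I, n + 1 ≤ (Lu i).card) →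
    n + 1 ≤ Lx.card → n + 1 ≤ Ly.card →
    ∃ (cw cu : ι → ℕ) (cx cy : ℕ), cx ∈ Lx ∧ cy ∈ Ly ∧
      (∀ i ∈ I, cw i ∈ Lw i ∧ cu i ∈ Lu i) ∧
      (∀ i ∈ I, ∀ j ∈ I, i ≠ j → cw i ≠ cw j ∧ cu i ≠ cu j ∧ cw i ≠ cu j) ∧
      (∀ i ∈ I, cx ≠ cu i ∧ cy ≠ cu i ∧ (side i → cx ≠ cw i) ∧ (¬ side i → cy ≠ cw i)) := by
  induction n with
  | zero =>
    intro I Lw Lu Lx Ly hI hw hu hx hy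
    obtain ⟨a, ha⟩ := Finset.card_pos.1 (by omega : 0 < Lx.card)
    obtain ⟨b, hb⟩ := Finset.card_pos.1 (by omega : 0 < Ly.card)
    rw [Finset.card_eq_zero] at hI
    subst hI
    exact ⟨fun _ => 0, fun _ => 0, a, b, ha, hb, by simp, by simp, by simp⟩
  | succ m ih =>
    intro I Lw Lu Lx Ly hI hw hu hx hy
    by_cases hsh : ∃ i ∈ I, ∃ c, c ∈ Lw i ∧ c ∈ Lu i
    · obtain ⟨i, hi, c, hcw, hcu⟩ := hsh
      have er : ∀ (F : Finset ℕ) (k : ℕ), k + 1 ≤ F.card → k ≤ (F.erase c).card := by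
        intro F k hk
        have := Finset.pred_card_le_card_erase (s := F) (a := c)
        omega
      obtain ⟨cw, cu, cx, cy, h1, h2, h3, h4, h5⟩ := ih (I.erase i) (fun j => (Lw j).erase c)
        (fun j => (Lu j).erase c) (Lx.erase c) (Ly.erase c)
        (by rw [Finset.card_erase_of_mem hi]; omega)
        (fun j hj => er _ _ (hw j (Finset.mem_of_mem_erase hj)))
        (fun j hj => er _ _ (hu j (Finset.mem_of_mem_erase hj)))
        (er _ _ hx) (er _ _ hy)
      simp only [Finset.mem_erase] at h1 h2 h3 h4 h5
      refine ⟨fun j => if j = i then c else cw j, fun j => if j = i then c else cu j, cx, cy,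
        h1.2, h2.2, ?_, ?_, ?_⟩
      · intro j hj
        by_cases hji : j = i
        · subst hji; simp [hcw, hcu]
        · simp only [hji, if_false]
          exact ⟨(h3 j ⟨hji, hj⟩).1.2, (h3 j ⟨hji, hj⟩).2.2⟩
      · intro j hj k hk hjk
        by_cases hji : j = i <;> by_cases hki : k = i
        · exact absurd (hji.trans hki.symm) hjk
        · simp only [hji, hki, if_true, if_false]
          have := h3 k ⟨hki, hk⟩
          exact ⟨Ne.symm this.1.1, Ne.symm this.2.1, Ne.symm this.2.1⟩
        · simp only [hji, hki, if_true, if_false]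
          have := h3 j ⟨hji, hj⟩
          exact ⟨this.1.1, this.2.1, this.1.1⟩
        · simp only [hji, hki, if_false]
          exact h4 j ⟨hji, hj⟩ k ⟨hki, hk⟩ hjk
      · intro j hj
        by_cases hji : j = i
        · simp only [hji, if_true]
          exact ⟨h1.1, h2.1, fun _ => h1.1, fun _ => h2.1⟩
        · simp only [hji, if_false]
          exact h5 j ⟨hji, hj⟩
    · push Not at hsh
      have hdisj : ∀ i ∈ I, Disjoint (Lw i) (Lu i) := fun i hi =>
        Finset.disjoint_left.2 (fun c => hsh i hi c)
      have hpair : ∀ i ∈ I, 2 * I.card + 1 ≤ (Lw i ∪ Lu i).card := by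
        intro i hi
        rw [Finset.card_union_of_disjoint (hdisj i hi)]
        have := hw i hi
        have := hu i hi
        omega
      by_cases hxy : Disjoint Lx Ly
      · -- all colours distinct
        let t : (ι ⊕ ι) ⊕ Bool → Finset ℕ :=
          Sum.elim (Sum.elim Lw Lu) (fun b => if b then Lx else Ly)
        obtain ⟨f, hf, hm⟩ := hall_on ((I.disjSum I).disjSum Finset.univ) t (by
          intro s hs
          have hc := Finset.card_toLeft_add_card_toRight (u := s)
          have hl : s.toLeft ⊆ I.disjSum I := by
            intro i hi
            have := hs (Finset.mem_toLeft.1 hi)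
            rwa [Finset.inl_mem_disjSum] at this
          obtain ⟨hb, hp⟩ := sum_split I s.toLeft hl
          have sub : ∀ v ∈ s, t v ⊆ s.biUnion t := fun v hv => Finset.subset_biUnion_of_mem t hv
          have hr2 : s.toRight.card ≤ 2 := (Finset.card_le_univ _).trans (by simp)
          by_cases h2 : s.toRight.card = 2
          · have hu : s.toRight = Finset.univ :=
              Finset.eq_univ_of_card _ (by simpa using h2)
            have ht : Sum.inr true ∈ s := Finset.mem_toRight.1 (by rw [hu]; simp)
            have hff : Sum.inr false ∈ s := Finset.mem_toRight.1 (by rw [hu]; simp)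
            have h3 := Finset.card_le_card (Finset.union_subset (sub _ ht) (sub _ hff))
            simp only [t, Sum.elim_inr, if_true] at h3
            rw [Finset.card_union_of_disjoint (by simpa using hxy)] at h3
            simp only [Bool.false_eq_true, if_false] at h3
            refine le_trans ?_ h3
            omega
          · rcases hp with ⟨i, hi, hil, hir⟩ | hp
            · have h3 := Finset.card_le_card (Finset.union_subset
                (sub _ (Finset.mem_toLeft.1 hil)) (sub _ (Finset.mem_toLeft.1 hir)))
              simp only [t, Sum.elim_inl, Sum.elim_inr] at h3
              have := hpair i hi
              refine le_trans ?_ h3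
              omega
            · rcases s.toRight.eq_empty_or_nonempty with he | ⟨b, hb⟩
              · rcases s.eq_empty_or_nonempty with rfl | ⟨v, hv⟩
                · simp
                · have h3 := Finset.card_le_card (sub v hv)
                  have hv' := hs hv
                  rw [he] at hc
                  simp only [Finset.card_empty] at hc
                  refine le_trans ?_ h3
                  rcases v with (i | i) | b
                  · have := hw i (by simpa using hv')
                    simp only [t, Sum.elim_inl]
                    omega
                  · have := hu i (by simpa using hv')
                    simp only [t, Sum.elim_inl, Sum.elim_inr]
                    omega
                  · cases b <;> simp [t] <;> omega
              · have h3 := Finset.card_le_card (sub _ (Finset.mem_toRight.1 hb))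
                refine le_trans ?_ h3
                cases b <;> simp [t] <;> omega)
        have inj : ∀ a b, a ∈ (I.disjSum I).disjSum (Finset.univ : Finset Bool) →
            b ∈ (I.disjSum I).disjSum (Finset.univ : Finset Bool) → a ≠ b → f a ≠ f b :=
          fun a b ha hb hab h => hab (hf ha hb h)
        refine ⟨fun i => f (.inl (.inl i)), fun i => f (.inl (.inr i)), f (.inr true),
          f (.inr false), ?_, ?_, ?_, ?_, ?_⟩
        · simpa [t] using hm (.inr true) (by simp)
        · simpa [t] using hm (.inr false) (by simp)
        · intro i hi
          exact ⟨by simpa [t] using hm (.inl (.inl i)) (by simpa using hi),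
            by simpa [t] using hm (.inl (.inr i)) (by simpa using hi)⟩
        · intro i hi j hj hij
          refine ⟨?_, ?_, ?_⟩ <;> apply inj <;> simp [hi, hj, hij]
        · intro i hi
          refine ⟨?_, ?_, fun _ => ?_, fun _ => ?_⟩ <;> apply inj <;> simp [hi]
      · obtain ⟨c, hcx, hcy⟩ := Finset.not_disjoint_iff.1 hxy
        have er : ∀ (F : Finset ℕ), F.card ≤ (F.erase c).card + 1 := by
          intro F
          have := Finset.pred_card_le_card_erase (s := F) (a := c)
          omega
        by_cases hW : m + 1 ≤ ((I.biUnion Lw).erase c).card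
        · let t : (ι ⊕ ι) → Finset ℕ :=
            Sum.elim (fun i => (Lw i).erase c) (fun i => (Lu i).erase c)
          obtain ⟨f, hf, hm⟩ := hall_on (I.disjSum I) t (by
            intro s hs
            obtain ⟨hb, hp⟩ := sum_split I s hs
            have sub : ∀ v ∈ s, t v ⊆ s.biUnion t := fun v hv => Finset.subset_biUnion_of_mem t hv
            rcases hp with ⟨i, hi, hil, hir⟩ | hp
            · have h3 := Finset.card_le_card (Finset.union_subset (sub _ hil) (sub _ hir))
              simp only [t, Sum.elim_inl, Sum.elim_inr] at h3
              rw [← Finset.erase_union_distrib] at h3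
              have := hpair i hi
              have := er (Lw i ∪ Lu i)
              refine le_trans ?_ h3
              omega
            · by_cases hr : ∃ i, Sum.inr i ∈ s
              · obtain ⟨i, hi⟩ := hr
                have h3 := Finset.card_le_card (sub _ hi)
                simp only [t, Sum.elim_inr] at h3
                have := hu i (by simpa using hs hi)
                have := er (Lu i)
                refine le_trans ?_ h3
                omega
              · push Not at hr
                by_cases hall : ∀ i ∈ I, Sum.inl i ∈ s
                · have h3 : (I.biUnion Lw).erase c ⊆ s.biUnion t := by
                    intro d hd
                    simp only [Finset.mem_erase, Finset.mem_biUnion] at hd ⊢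
                    obtain ⟨hdc, i, hi, hd⟩ := hd
                    exact ⟨_, hall i hi, by simp [t, hd, hdc]⟩
                  have := Finset.card_le_card h3
                  omega
                · push Not at hall
                  obtain ⟨j, hj, hjs⟩ := hall
                  have hlt : s.card < I.card := by
                    have hsub : s ⊆ (I.erase j).map Function.Embedding.inl := by
                      intro v hv
                      rcases v with i | i
                      · have : i ∈ I := by simpa using hs hv
                        simp only [Finset.mem_map, Finset.mem_erase]
                        refine ⟨i, ⟨?_, this⟩, rfl⟩
                        rintro rfl
                        exact hjs hv
                      · exact absurd hv (hr i)
                    have := Finset.card_le_card hsub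
                    rw [Finset.card_map, Finset.card_erase_of_mem hj] at this
                    omega
                  rcases s.eq_empty_or_nonempty with rfl | ⟨v, hv⟩
                  · simp
                  · rcases v with i | i
                    · have h3 := Finset.card_le_card (sub _ hv)
                      simp only [t, Sum.elim_inl] at h3
                      have := hw i (by simpa using hs hv)
                      have := er (Lw i)
                      refine le_trans ?_ h3
                      omega
                    · exact absurd hv (hr i))
          have inj : ∀ a b, a ∈ I.disjSum I → b ∈ I.disjSum I → a ≠ b → f a ≠ f b :=
            fun a b ha hb hab h => hab (hf ha hb h)
          have hl : ∀ i ∈ I, f (.inl i) ≠ c ∧ f (.inl i) ∈ Lw i := fun i hi => by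
            simpa [t] using hm (.inl i) (by simpa using hi)
          have hr : ∀ i ∈ I, f (.inr i) ≠ c ∧ f (.inr i) ∈ Lu i := fun i hi => by
            simpa [t] using hm (.inr i) (by simpa using hi)
          refine ⟨fun i => f (.inl i), fun i => f (.inr i), c, c, hcx, hcy, ?_, ?_, ?_⟩
          · exact fun i hi => ⟨(hl i hi).2, (hr i hi).2⟩
          · intro i hi j hj hij
            refine ⟨?_, ?_, ?_⟩ <;> apply inj <;> simp [hi, hj, hij]
          · intro i hi
            exact ⟨(hr i hi).1.symm, (hr i hi).1.symm, fun _ => (hl i hi).1.symm,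
              fun _ => (hl i hi).1.symm⟩
        · -- all the lists `Lw i` are equal
          obtain ⟨i0, hi0⟩ := Finset.card_pos.1 (by omega : 0 < I.card)
          set W := I.biUnion Lw with hWdef
          have hWc : W.card ≤ m + 1 := by have := er W; omega
          have hWeq : ∀ i ∈ I, Lw i = W := fun i hi =>
            Finset.eq_of_subset_of_card_le (Finset.subset_biUnion_of_mem Lw hi)
              (hWc.trans (hw i hi))
          have hWm : W.card = m + 1 := by
            have := hw i0 hi0
            rw [hWeq i0 hi0] at this
            omega
          have hcW : c ∈ W := by
            by_contra hc
            rw [Finset.erase_eq_of_notMem hc] at hW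
            omega
          have huW : ∀ i ∈ I, ∀ d ∈ W, d ∉ Lu i := fun i hi d hd =>
            hsh i hi d (by rw [hWeq i hi]; exact hd)
          obtain ⟨g, hg, hgm⟩ := hall_easy (I.erase i0) (fun _ => W.erase c) (by
            intro i hi
            rw [Finset.card_erase_of_mem hi0, Finset.card_erase_of_mem hcW]
            omega)
          have key : ∀ F : Finset ℕ, m + 1 + 1 ≤ F.card → ∃ (cu : ι → ℕ) (z : ℕ), z ∈ F ∧ z ∉ W ∧
              (∀ i ∈ I, cu i ∈ Lu i ∧ cu i ≠ z ∧ cu i ∉ W) ∧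
              (∀ i ∈ I, ∀ j ∈ I, i ≠ j → cu i ≠ cu j) := by
            intro F hF
            obtain ⟨z, hz, hzW⟩ := Finset.exists_mem_notMem_of_card_lt_card
              (by omega : W.card < F.card)
            obtain ⟨h, hh, hhm⟩ := hall_easy I (fun i => (Lu i).erase z) (by
              intro i hi
              have := hu i hi
              have := Finset.pred_card_le_card_erase (s := Lu i) (a := z)
              omega)
            refine ⟨h, z, hz, hzW, ?_, fun i hi j hj hij he => hij (hh hi hj he)⟩
            intro i hi
            have h1 := Finset.mem_erase.1 (hhm i hi)
            exact ⟨h1.2, h1.1, fun hd => huW i hi _ hd h1.2⟩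
          let cw : ι → ℕ := fun i => if i = i0 then c else g i
          have hcw0 : cw i0 = c := by simp [cw]
          have hcwW : ∀ i ∈ I, cw i ∈ W := by
            intro i hi
            by_cases h : i = i0
            · simp [cw, h, hcW]
            · simp only [cw, h, if_false]
              exact Finset.mem_of_mem_erase (hgm i (Finset.mem_erase.2 ⟨h, hi⟩))
          have hcwc : ∀ i ∈ I, i ≠ i0 → cw i ≠ c := by
            intro i hi h
            simp only [cw, h, if_false]
            exact Finset.ne_of_mem_erase (hgm i (Finset.mem_erase.2 ⟨h, hi⟩))
          have hcwinj : ∀ i ∈ I, ∀ j ∈ I, i ≠ j → cw i ≠ cw j := by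
            intro i hi j hj hij
            by_cases h : i = i0
            · subst h
              rw [hcw0]
              exact (hcwc j hj (Ne.symm hij)).symm
            · by_cases h' : j = i0
              · subst h'
                rw [hcw0]
                exact hcwc i hi h
              · simp only [cw, h, h', if_false]
                intro he
                exact hij (hg (by simp [h, hi]) (by simp [h', hj]) he)
          by_cases hs0 : side i0
          · obtain ⟨cu, z, hz, hzW, hcu, hcuinj⟩ := key Lx hx
            refine ⟨cw, cu, z, c, hz, hcy, ?_, ?_, ?_⟩
            · intro i hi
              exact ⟨by rw [hWeq i hi]; exact hcwW i hi, (hcu i hi).1⟩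
            · intro i hi j hj hij
              exact ⟨hcwinj i hi j hj hij, hcuinj i hi j hj hij,
                fun he => (hcu j hj).2.2 (he ▸ hcwW i hi)⟩
            · intro i hi
              refine ⟨(hcu i hi).2.1.symm, fun he => (hcu i hi).2.2 (he ▸ hcW),
                fun _ he => hzW (he ▸ hcwW i hi), fun hns => ?_⟩
              exact (hcwc i hi (fun he => hns (he ▸ hs0))).symm
          · obtain ⟨cu, z, hz, hzW, hcu, hcuinj⟩ := key Ly hy
            refine ⟨cw, cu, c, z, hcx, hz, ?_, ?_, ?_⟩
            · intro i hi
              exact ⟨by rw [hWeq i hi]; exact hcwW i hi, (hcu i hi).1⟩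
            · intro i hi j hj hij
              exact ⟨hcwinj i hi j hj hij, hcuinj i hi j hj hij,
                fun he => (hcu j hj).2.2 (he ▸ hcwW i hi)⟩
            · intro i hi
              refine ⟨fun he => (hcu i hi).2.2 (he ▸ hcW), (hcu i hi).2.1.symm,
                fun hns => ?_, fun _ he => hzW (he ▸ hcwW i hi)⟩
              exact (hcwc i hi (fun he => hs0 (he ▸ hns))).symm

theorem exists_list {V : Type*} (L : V → Finset ℕ) (Q : V → Prop)
    (huniq : ∀ u v, Q u → Q v → u = v) (hc : ∀ v, Q v → (L v).card = 4) :
    ∃ F : Finset ℕ, F.card = 4 ∧ ∀ v, Q v → L v = F := by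
  by_cases h : ∃ v, Q v
  · obtain ⟨v, hv⟩ := h
    exact ⟨L v, hc v hv, fun u hu => by rw [huniq u v hu hv]⟩
  · push Not at h
    exact ⟨Finset.range 4, by simp, fun v hv => absurd hv (h v)⟩

theorem four_coloring {V : Type*} [Fintype V] [DecidableEq V] (H : SimpleGraph V)
    (S : Finset V) (hS : ∀ u ∈ S, ∀ v ∈ S, u ≠ v → H.Adj u v)
    (hT : ∀ u ∉ S, ∀ v ∉ S, u ≠ v → H.Adj u v)
    (hom : ∀ s : Finset V, H.IsClique s → s.card ≤ 4) :
    ∃ (φ : V → V ⊕ ℕ) (P : Finset (V ⊕ ℕ)), P.card = 4 ∧ (∀ v, φ v ∈ P) ∧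
      ∀ u v, H.Adj u v → φ u ≠ φ v := by
  classical
  have hT4 : (Sᶜ).card ≤ 4 := hom _ (by
    intro u hu v hv huv
    exact hT u (by simpa using hu) v (by simpa using hv) huv)
  let t : V → Finset (V ⊕ ℕ) := fun s =>
    ((Sᶜ).filter (fun v => ¬ H.Adj s v)).disjSum (Finset.range (4 - (Sᶜ).card))
  haveI : Inhabited (V ⊕ ℕ) := ⟨.inr 0⟩
  obtain ⟨f, hf, hm⟩ := hall_on S t (by
    intro A hA
    rcases A.eq_empty_or_nonempty with rfl | ⟨a0, ha0⟩
    · simp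
    let N := (Sᶜ).filter (fun v => ∃ a ∈ A, ¬ H.Adj a v)
    let M := (Sᶜ).filter (fun v => ¬ ∃ a ∈ A, ¬ H.Adj a v)
    have hNM : N.card + M.card = (Sᶜ).card := Finset.card_filter_add_card_filter_not _
    have hd : Disjoint A M := by
      rw [Finset.disjoint_left]
      intro v hv hv'
      have := (Finset.mem_filter.1 hv').1
      rw [Finset.mem_compl] at this
      exact this (hA hv)
    have h4 := hom (A ∪ M) (by
      intro u hu v hv huv
      simp only [Finset.coe_union, Set.mem_union, Finset.mem_coe, M, Finset.mem_filter,
        Finset.mem_compl] at hu hv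
      rcases hu with hu | ⟨hu, hu'⟩ <;> rcases hv with hv | ⟨hv, hv'⟩
      · exact hS u (hA hu) v (hA hv) huv
      · by_contra h
        exact hv' ⟨u, hu, h⟩
      · by_contra h
        exact hu' ⟨v, hv, fun h' => h h'.symm⟩
      · exact hT u hu v hv huv)
    rw [Finset.card_union_of_disjoint hd] at h4
    have hsub : N.disjSum (Finset.range (4 - (Sᶜ).card)) ⊆ A.biUnion t := by
      intro v hv
      rcases v with v | k
      · simp only [Finset.inl_mem_disjSum, N, Finset.mem_filter] at hv
        obtain ⟨h1, a, ha, h2⟩ := hv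
        rw [Finset.mem_biUnion]
        refine ⟨a, ha, ?_⟩
        simp only [t, Finset.inl_mem_disjSum, Finset.mem_filter]
        exact ⟨h1, h2⟩
      · rw [Finset.mem_biUnion]
        refine ⟨a0, ha0, ?_⟩
        simp only [t, Finset.inr_mem_disjSum] at hv ⊢
        exact hv
    have := Finset.card_le_card hsub
    rw [Finset.card_disjSum, Finset.card_range] at this
    refine le_trans ?_ this
    omega)
  refine ⟨fun v => if v ∈ S then f v else .inl v,
    (Sᶜ).disjSum (Finset.range (4 - (Sᶜ).card)), ?_, ?_, ?_⟩
  · rw [Finset.card_disjSum, Finset.card_range]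
    omega
  · intro v
    by_cases hv : v ∈ S
    · simp only [hv, if_true]
      have := hm v hv
      exact Finset.disjSum_mono_left _ (Finset.filter_subset _ _) this
    · simp [hv]
  · have cross : ∀ u ∈ S, ∀ v ∉ S, H.Adj u v → f u ≠ .inl v := by
      intro u hu v hv huv he
      have := hm u hu
      rw [he] at this
      simp only [t, Finset.inl_mem_disjSum, Finset.mem_filter] at this
      exact this.2 huv
    intro u v huv
    by_cases hu : u ∈ S <;> by_cases hv : v ∈ S <;> simp only [hu, hv, if_true, if_false]
    · exact fun he => huv.ne (hf hu hv he)
    · exact cross u hu v hv huv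
    · exact (cross v hv u hu huv.symm).symm
    · exact fun he => huv.ne (Sum.inl.inj he)

/-- Let `H` be cobipartite with `ω(H) ≤ 4` and let `C` be a clique of
size 3 such that `N(w) \ C` is a clique for every `w ∈ C`.  If `|L(w)| = 3` on `C` and
`|L(v)| = 4` off `C`, then `H` is `L`-colorable. -/
theorem cobipartite_triangle_list_colorable
    {V : Type*} [Fintype V] (H : SimpleGraph V)
    (hco : Cobipartite H) (homega : cliqueNumber H ≤ 4)
    (C : Set V) (hC : H.IsClique C) (hC3 : C.ncard = 3)
    (hN : ∀ w ∈ C, H.IsClique (H.neighborSet w \ C))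
    (L : V → Finset ℕ)
    (hLC : ∀ w ∈ C, (L w).card = 3) (hLV : ∀ v ∉ C, (L v).card = 4) :
    ListColorable H L := by
  classical
  obtain ⟨S', T', hST, hS', hT'⟩ := hco
  let S : Finset V := S'.toFinset
  have hS : ∀ u ∈ S, ∀ v ∈ S, u ≠ v → H.Adj u v := by
    intro u hu v hv huv
    exact hS' (by simpa [S] using hu) (by simpa [S] using hv) huv
  have hT : ∀ u ∉ S, ∀ v ∉ S, u ≠ v → H.Adj u v := by
    have : ∀ u ∉ S, u ∈ T' := by
      intro u hu
      have h : u ∈ S' ∪ T' := hST ▸ Set.mem_univ u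
      exact h.resolve_left (by simpa [S] using hu)
    intro u hu v hv huv
    exact hT' (this u hu) (this v hv) huv
  have hom : ∀ s : Finset V, H.IsClique s → s.card ≤ 4 := by
    intro s hs
    refine le_trans ?_ homega
    refine le_csSup ⟨Fintype.card V, ?_⟩ ⟨s, hs, rfl⟩
    rintro n ⟨s, hs⟩
    rw [← hs.card_eq]
    exact Finset.card_le_univ s
  obtain ⟨φ, P, hP, hφP, hφ⟩ := four_coloring H S hS hT hom
  let D : Finset V := C.toFinset
  have hD : ∀ v, v ∈ D ↔ v ∈ C := by simp [D]
  have hD3 : D.card = 3 := by rw [← hC3, Set.ncard_eq_toFinset_card']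
  have hφD : Set.InjOn φ D := by
    intro u hu v hv he
    by_contra h
    exact hφ u v (hC ((hD u).1 hu) ((hD v).1 hv) h) he
  have hrest : ∀ u v, φ u ∉ D.image φ → φ v ∉ D.image φ → φ u = φ v := by
    have hc : (P \ D.image φ).card = 1 := by
      rw [Finset.card_sdiff_of_subset, Finset.card_image_of_injOn hφD]
      · omega
      · intro x hx
        obtain ⟨v, _, rfl⟩ := Finset.mem_image.1 hx
        exact hφP v
    intro u v hu hv
    exact Finset.card_le_one.1 hc.le _ (Finset.mem_sdiff.2 ⟨hφP u, hu⟩) _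
      (Finset.mem_sdiff.2 ⟨hφP v, hv⟩)
  have hsame : ∀ u v, φ u = φ v → (u ∈ S ↔ v ∈ S) → u = v := by
    intro u v he hs
    by_contra h
    by_cases hu : u ∈ S
    · exact hφ u v (hS u hu v (hs.1 hu) h) he
    · exact hφ u v (hT u hu v (fun hv => hu (hs.2 hv)) h) he
  have hDimg : ∀ v ∈ D, φ v ∈ D.image φ := fun v hv => Finset.mem_image_of_mem φ hv
  have hLu : ∀ i : V, ∃ F : Finset ℕ, F.card = 4 ∧
      ∀ v, (v ∉ D ∧ i ∈ D ∧ φ v = φ i) → L v = F := by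
    intro i
    apply exists_list
    · rintro u v ⟨hu, hi, hu'⟩ ⟨hv, _, hv'⟩
      have h1 : ¬ (u ∈ S ↔ i ∈ S) := fun h => hu (hsame u i hu' h ▸ hi)
      have h2 : ¬ (v ∈ S ↔ i ∈ S) := fun h => hv (hsame v i hv' h ▸ hi)
      exact hsame u v (hu'.trans hv'.symm) (by tauto)
    · rintro v ⟨hv, _⟩
      exact hLV v (fun h => hv ((hD v).2 h))
  choose Lu hLu4 hLu using hLu
  obtain ⟨Lx, hLx4, hLx⟩ := exists_list L (fun v => φ v ∉ D.image φ ∧ v ∈ S)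
    (fun u v hu hv => hsame u v (hrest u v hu.1 hv.1) (by tauto))
    (fun v hv => hLV v (fun h => hv.1 (hDimg v ((hD v).2 h))))
  obtain ⟨Ly, hLy4, hLy⟩ := exists_list L (fun v => φ v ∉ D.image φ ∧ v ∉ S)
    (fun u v hu hv => hsame u v (hrest u v hu.1 hv.1) (by tauto))
    (fun v hv => hLV v (fun h => hv.1 (hDimg v ((hD v).2 h))))
  obtain ⟨cw, cu, cx, cy, hx, hy, h3, h4, h5⟩ := slot_lemma
    (fun i => ∃ x, φ x ∉ D.image φ ∧ x ∈ S ∧ H.Adj i x) 3 D L Lu Lx Ly hD3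
    (fun i hi => (hLC i ((hD i).1 hi)).ge) (fun i _ => (hLu4 i).ge) hLx4.ge hLy4.ge
  have hpart : ∀ v, ∃ i, φ v ∈ D.image φ → i ∈ D ∧ φ v = φ i := by
    intro v
    by_cases h : φ v ∈ D.image φ
    · obtain ⟨i, hi, he⟩ := Finset.mem_image.1 h
      exact ⟨i, fun _ => ⟨hi, he.symm⟩⟩
    · exact ⟨v, fun h' => absurd h' h⟩
  choose π hπ using hpart
  let c : V → ℕ := fun v => if v ∈ D then cw v else if φ v ∈ D.image φ then cu (π v)
    else if v ∈ S then cx else cy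
  have hcases : ∀ v, (v ∈ D ∧ c v = cw v) ∨
      (v ∉ D ∧ π v ∈ D ∧ φ v = φ (π v) ∧ c v = cu (π v)) ∨
      (φ v ∉ D.image φ ∧ v ∈ S ∧ c v = cx) ∨ (φ v ∉ D.image φ ∧ v ∉ S ∧ c v = cy) := by
    intro v
    by_cases h1 : v ∈ D
    · exact .inl ⟨h1, by simp only [c, h1, if_true]⟩
    · by_cases h2 : φ v ∈ D.image φ
      · exact .inr (.inl ⟨h1, (hπ v h2).1, (hπ v h2).2, by simp only [c, h1, h2, if_true, if_false]⟩)
      · by_cases h3 : v ∈ S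
        · exact .inr (.inr (.inl ⟨h2, h3, by simp only [c, h1, h2, h3, if_true, if_false]⟩))
        · exact .inr (.inr (.inr ⟨h2, h3, by simp only [c, h1, h2, h3, if_false]⟩))
  have hwy : ∀ w ∈ D, ∀ y, φ y ∉ D.image φ → y ∉ S → H.Adj w y →
      ¬ ∃ x, φ x ∉ D.image φ ∧ x ∈ S ∧ H.Adj w x := by
    rintro w hw y hy1 hy2 hwy ⟨x, hx1, hx2, hwx⟩
    have hne : x ≠ y := fun h => hy2 (h ▸ hx2)
    have := hN w ((hD w).1 hw) (x := x) ⟨hwx, fun h => hx1 (hDimg x ((hD x).2 h))⟩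
      (y := y) ⟨hwy, fun h => hy1 (hDimg y ((hD y).2 h))⟩ hne
    exact hφ x y this (hrest x y hx1 hy1)
  refine ⟨c, ?_, ?_⟩
  · intro v
    rcases hcases v with ⟨h, e⟩ | ⟨h, hi, hv, e⟩ | ⟨h, hs, e⟩ | ⟨h, hs, e⟩ <;> rw [e]
    · exact (h3 v h).1
    · rw [hLu (π v) v ⟨h, hi, hv⟩]
      exact (h3 _ hi).2
    · rw [hLx v ⟨h, hs⟩]; exact hx
    · rw [hLy v ⟨h, hs⟩]; exact hy
  · have wu : ∀ u w, H.Adj u w → u ∈ D → π w ∈ D → φ w = φ (π w) → cw u ≠ cu (π w) := by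
      intro u w huw hu hw hp
      refine (h4 u hu _ hw ?_).2.2
      intro he
      exact hφ u w huw (by rw [hp, ← he])
    have wx : ∀ u w, H.Adj u w → u ∈ D → φ w ∉ D.image φ → w ∈ S → cx ≠ cw u :=
      fun u w huw hu hw hs => (h5 u hu).2.2.1 ⟨w, hw, hs, huw⟩
    have wy : ∀ u w, H.Adj u w → u ∈ D → φ w ∉ D.image φ → w ∉ S → cy ≠ cw u :=
      fun u w huw hu hw hs => (h5 u hu).2.2.2 (hwy u hu w hw hs huw)
    intro u w huw
    rcases hcases u with ⟨h, e⟩ | ⟨h, hi, hv, e⟩ | ⟨h, hs, e⟩ | ⟨h, hs, e⟩ <;>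
    rcases hcases w with ⟨h', e'⟩ | ⟨h', hi', hv', e'⟩ | ⟨h', hs', e'⟩ | ⟨h', hs', e'⟩ <;>
    rw [e, e']
    · exact (h4 u h w h' huw.ne).1
    · exact wu u w huw h hi' hv'
    · exact (wx u w huw h h' hs').symm
    · exact (wy u w huw h h' hs').symm
    · exact (wu w u huw.symm h' hi hv).symm
    · refine (h4 _ hi _ hi' ?_).2.1
      intro he
      exact hφ u w huw (by rw [hv, hv', he])
    · exact (h5 _ hi).1.symm
    · exact (h5 _ hi).2.1.symm
    · exact wx w u huw.symm h' h hs
    · exact (h5 _ hi').1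
    · exact absurd (hrest u w h h') (hφ u w huw)
    · exact absurd (hrest u w h h') (hφ u w huw)
    · exact wy w u huw.symm h' h hs
    · exact (h5 _ hi').2.1
    · exact absurd (hrest u w h h') (hφ u w huw)
    · exact absurd (hrest u w h h') (hφ u w huw)
end

section
/- Let G be an elementary graph with clique number ω(G) ≤ 4. Then the choice number of G equals its chromatic number: ch(G) = χ(G). -/
open SimpleGraph

variable {V : Type*}

/-- `G` is elementary: its edges can be 2-colored so that the two edges of every induced
two-edge path get different colors. -/
def IsElementary {V : Type*} (G : SimpleGraph V) : Prop :=
  ∃ c : Sym2 V → Bool, ∀ u v w : V, G.Adj u v → G.Adj v w → u ≠ w → ¬G.Adj u w →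
    c s(u, v) ≠ c s(v, w)


theorem konig_reg {α : Type*} {n : ℕ} : ∀ (k : ℕ) (P : Finset α) (f g : α → Fin n),
    (∀ i, (P.filter (f · = i)).card = k) → (∀ i, (P.filter (g · = i)).card = k) →
    ∃ κ : α → ℕ, (∀ v ∈ P, κ v < k) ∧
      ∀ u ∈ P, ∀ v ∈ P, u ≠ v → (f u = f v ∨ g u = g v) → κ u ≠ κ v := by
  classical
  intro k
  induction k with
  | zero =>
    intro P f g hf hg
    have : ∀ v, v ∉ P := by
      intro v hv
      have := hf (f v)
      rw [Finset.card_eq_zero] at this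
      have h2 : v ∈ P.filter (f · = f v) := by simp [hv]
      rw [this] at h2; simp at h2
    exact ⟨fun _ => 0, fun v hv => absurd hv (this v), fun v hv => absurd hv (this v)⟩
  | succ k ih =>
    intro P f g hf hg
    have hall : ∀ S : Finset (Fin n), S.card ≤ (S.biUnion (fun i => (P.filter (f · = i)).image g)).card := by
      intro S
      set T := S.biUnion (fun i => (P.filter (f · = i)).image g) with hT
      have h1 : (P.filter (fun v => f v ∈ S)).card = S.card * (k+1) := by
        rw [Finset.card_eq_sum_card_fiberwise (f := f) (t := S)]
        · rw [Finset.sum_const_nat]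
          intro i hi
          rw [← hf i]
          congr 1
          ext v; simp only [Finset.mem_filter]; constructor
          · rintro ⟨⟨a, b⟩, c⟩; exact ⟨a, c⟩
          · rintro ⟨a, c⟩; exact ⟨⟨a, c ▸ hi⟩, c⟩
        · intro v hv; simp at hv; simpa using hv.2
      have h2 : (P.filter (fun v => g v ∈ T)).card = T.card * (k+1) := by
        rw [Finset.card_eq_sum_card_fiberwise (f := g) (t := T)]
        · rw [Finset.sum_const_nat]
          intro i hi
          rw [← hg i]
          congr 1
          ext v; simp only [Finset.mem_filter]; constructor
          · rintro ⟨⟨a, b⟩, c⟩; exact ⟨a, c⟩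
          · rintro ⟨a, c⟩; exact ⟨⟨a, c ▸ hi⟩, c⟩
        · intro v hv; simp at hv; simpa using hv.2
      have h3 : P.filter (fun v => f v ∈ S) ⊆ P.filter (fun v => g v ∈ T) := by
        intro v hv
        simp only [Finset.mem_filter] at hv ⊢
        refine ⟨hv.1, ?_⟩
        rw [hT, Finset.mem_biUnion]
        exact ⟨f v, hv.2, Finset.mem_image.2 ⟨v, by simp [hv.1], rfl⟩⟩
      have h4 := Finset.card_le_card h3
      rw [h1, h2] at h4
      exact Nat.le_of_mul_le_mul_right h4 (Nat.succ_pos k)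
    obtain ⟨h, hinj, hmem⟩ := (Finset.all_card_le_biUnion_card_iff_exists_injective _).1 hall
    have hsurj : Function.Surjective h := Finite.injective_iff_surjective.1 hinj
    have hex : ∀ i, ∃ e, e ∈ P ∧ f e = i ∧ g e = h i := by
      intro i
      have := hmem i
      simp only [Finset.mem_image, Finset.mem_filter] at this
      obtain ⟨e, ⟨a, b⟩, c⟩ := this
      exact ⟨e, a, b, c⟩
    choose e heP hef heg using hex
    set P' := P.filter (fun v => ∀ i, v ≠ e i) with hP'
    obtain ⟨κ, hκ1, hκ2⟩ := ih P' f g (by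
      intro i
      have : P'.filter (f · = i) = (P.filter (f · = i)).erase (e i) := by
        ext v; simp only [hP', Finset.mem_filter, Finset.mem_erase]
        constructor
        · rintro ⟨⟨a, b⟩, c⟩; exact ⟨b i, a, c⟩
        · rintro ⟨a, b, c⟩
          refine ⟨⟨b, ?_⟩, c⟩
          intro j hj
          apply a
          rw [hj]; rw [hj, hef] at c; rw [c]
      rw [this, Finset.card_erase_of_mem (by simp [heP, hef]), hf]; rfl) (by
      intro j
      obtain ⟨i, rfl⟩ := hsurj j
      have : P'.filter (g · = h i) = (P.filter (g · = h i)).erase (e i) := by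
        ext v; simp only [hP', Finset.mem_filter, Finset.mem_erase]
        constructor
        · rintro ⟨⟨a, b⟩, c⟩; exact ⟨b i, a, c⟩
        · rintro ⟨a, b, c⟩
          refine ⟨⟨b, ?_⟩, c⟩
          intro j hj
          apply a
          rw [hj]; rw [hj, heg] at c; rw [hinj c]
      rw [this, Finset.card_erase_of_mem (by simp [heP, heg]), hg]; rfl)
    refine ⟨fun v => if v ∈ P' then κ v else k, ?_, ?_⟩
    · intro v hv
      dsimp only
      split_ifs with h1
      · exact (hκ1 v h1).trans (Nat.lt_succ_self k)
      · exact Nat.lt_succ_self k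
    · intro u hu v hv huv hfg
      dsimp only
      split_ifs with h1 h2 h2
      · exact hκ2 u h1 v h2 huv hfg
      · exact (hκ1 u h1).ne
      · exact (hκ1 v h2).ne'
      · exfalso
        simp only [hP', Finset.mem_filter, not_and, not_forall, not_not] at h1 h2
        obtain ⟨i, rfl⟩ := h1 hu
        obtain ⟨j, rfl⟩ := h2 hv
        apply huv
        rw [hef, hef, heg, heg] at hfg
        rcases hfg with h | h
        · rw [h]
        · rw [hinj h]

theorem konig_key {V S' : Type*} [Fintype V] (k : ℕ) (f : V → S') (n : ℕ) (i : S' ↪ Fin n)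
      (hf : ∀ s, Nat.card {v // f v = s} ≤ k) :
      ∃ φ : V → Fin n × Fin k, Function.Injective φ ∧ ∀ v, (φ v).1 = i (f v) := by
    classical
    have : ∀ s, Nonempty ({v // f v = s} ↪ Fin k) := by
      intro s
      apply Function.Embedding.nonempty_of_card_le
      rw [Fintype.card_fin, ← Nat.card_eq_fintype_card]
      exact hf s
    have a := fun s => (this s).some
    refine ⟨fun v => (i (f v), a (f v) ⟨v, rfl⟩), ?_, fun v => rfl⟩
    intro u v huv
    simp only [Prod.mk.injEq] at huv
    obtain ⟨h1, h2⟩ := huv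
    have h3 := i.injective h1
    have : ∀ s (hs : f u = s) (hs' : f v = s), a (f u) ⟨u, rfl⟩ = a s ⟨u, hs⟩ ∧ a (f v) ⟨v, rfl⟩ = a s ⟨v, hs'⟩ := by
      intro s hs hs'
      constructor
      · subst hs; rfl
      · subst hs'; rfl
    obtain ⟨h4, h5⟩ := this (f v) h3 rfl
    rw [h4] at h2
    have := (a (f v)).injective h2
    simpa using this

theorem konig {V S T : Type*} [Fintype V] [Fintype S] [Fintype T] (k : ℕ) (f : V → S) (g : V → T)
    (hf : ∀ s, Nat.card {v // f v = s} ≤ k) (hg : ∀ s, Nat.card {v // g v = s} ≤ k) :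
    ∃ κ : V → ℕ, (∀ v, κ v < k) ∧
      ∀ u v, u ≠ v → (f u = f v ∨ g u = g v) → κ u ≠ κ v := by
  classical
  set n := Fintype.card S + Fintype.card T
  have i1 : Nonempty (S ↪ Fin n) := Function.Embedding.nonempty_of_card_le (by simp [n])
  have i2 : Nonempty (T ↪ Fin n) := Function.Embedding.nonempty_of_card_le (by simp [n])
  obtain ⟨i1⟩ := i1
  obtain ⟨i2⟩ := i2
  obtain ⟨φ, hφ, hφ1⟩ := konig_key k f n i1 hf
  obtain ⟨ψ, hψ, hψ1⟩ := konig_key k g n i2 hg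
  let e : {x // x ∈ Set.range φ} ≃ {x // x ∈ Set.range ψ} :=
    (Equiv.ofInjective φ hφ).symm.trans (Equiv.ofInjective ψ hψ)
  let π : Equiv.Perm (Fin n × Fin k) := e.extendSubtype
  have hπ : ∀ v, π (φ v) = ψ v := by
    intro v
    have := Equiv.extendSubtype_apply_of_mem e (φ v) ⟨v, rfl⟩
    rw [show π (φ v) = _ from this]
    simp only [e, Equiv.trans_apply]
    rw [show (⟨φ v, ⟨v, rfl⟩⟩ : {x // x ∈ Set.range φ}) = Equiv.ofInjective φ hφ v from rfl]
    rw [Equiv.symm_apply_apply]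
    rfl
  have hc : ∀ i : Fin n, (Finset.univ.filter (fun x : Fin n × Fin k => x.1 = i)).card = k := by
    intro i
    have : Finset.univ.filter (fun x : Fin n × Fin k => x.1 = i) = Finset.univ.image (fun j => (i, j)) := by
      ext ⟨x, y⟩; simp [eq_comm]
    rw [this, Finset.card_image_of_injective _ (by intro a b h; simpa using h)]
    simp
  obtain ⟨κ, h1, h2⟩ := konig_reg k Finset.univ (fun x : Fin n × Fin k => x.1) (fun x => (π x).1) hc (by
    intro i
    refine Eq.trans ?_ (hc i)
    apply Finset.card_bij (fun x _ => π x)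
    · intro a; simp
    · intro a _ b _ h; exact π.injective h
    · intro b hb; exact ⟨π.symm b, by simpa using hb, by simp⟩)
  refine ⟨fun v => κ (φ v), fun v => h1 _ (Finset.mem_univ _), ?_⟩
  intro u v huv h
  apply h2 _ (Finset.mem_univ _) _ (Finset.mem_univ _) (fun h => huv (hφ h))
  rw [hφ1, hφ1, hπ, hπ, hψ1, hψ1]
  rcases h with h | h
  · left; rw [h]
  · right; rw [h]

/-- kernel existence -/
theorem kernel_exists {V S T : Type*} (f : V → S) (g : V → T) (κ : V → ℕ)
    (hκ : ∀ u v, u ≠ v → (f u = f v ∨ g u = g v) → κ u ≠ κ v) :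
    ∀ (n : ℕ) (W : Finset V), W.card = n → ∃ K ⊆ W,
      (∀ u ∈ K, ∀ v ∈ K, u ≠ v → ¬ (f u = f v ∨ g u = g v)) ∧
      ∀ w ∈ W, w ∉ K → ∃ z ∈ K, (f z = f w ∧ κ z < κ w) ∨ (g z = g w ∧ κ w < κ z) := by
  classical
  intro n
  induction n with
  | zero =>
    intro W hW
    rw [Finset.card_eq_zero] at hW
    subst hW
    exact ⟨∅, by simp, by simp, by simp⟩
  | succ n ih =>
    intro W hW
    set M := W.filter (fun v => ∀ w ∈ W, f w = f v → κ v ≤ κ w) with hM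
    have hMdom : ∀ w ∈ W, ∃ z ∈ M, f z = f w ∧ κ z ≤ κ w := by
      intro w hw
      obtain ⟨z, hz, hz2⟩ := Finset.exists_min_image (W.filter (fun v => f v = f w)) κ ⟨w, by simp [hw]⟩
      simp only [Finset.mem_filter] at hz hz2
      refine ⟨z, ?_, hz.2, hz2 w ⟨hw, rfl⟩⟩
      rw [hM, Finset.mem_filter]
      exact ⟨hz.1, fun v hv hfv => hz2 v ⟨hv, hfv.trans hz.2⟩⟩
    by_cases hg : ∀ u ∈ M, ∀ v ∈ M, u ≠ v → g u ≠ g v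
    · refine ⟨M, Finset.filter_subset _ _, ?_, ?_⟩
      · rintro u hu v hv huv (h | h)
        · rw [hM, Finset.mem_filter] at hu hv
          exact hκ u v huv (Or.inl h) (le_antisymm (hu.2 v hv.1 h.symm) (hv.2 u hu.1 h))
        · exact hg u hu v hv huv h
      · intro w hw hwM
        obtain ⟨z, hz, h1, h2⟩ := hMdom w hw
        refine ⟨z, hz, Or.inl ⟨h1, lt_of_le_of_ne h2 ?_⟩⟩
        apply hκ z w _ (Or.inl h1)
        rintro rfl; exact hwM hz
    · push Not at hg
      obtain ⟨a, ha, b, hb, hab, hgab⟩ := hg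
      have : ∃ m1 ∈ M, ∃ m2 ∈ M, g m1 = g m2 ∧ κ m2 < κ m1 := by
        rcases lt_trichotomy (κ a) (κ b) with h | h | h
        · exact ⟨b, hb, a, ha, hgab.symm, h⟩
        · exact absurd h (hκ a b hab (Or.inr hgab))
        · exact ⟨a, ha, b, hb, hgab, h⟩
      obtain ⟨m1, hm1, m2, hm2, hg12, hlt⟩ := this
      rw [hM, Finset.mem_filter] at hm1 hm2
      obtain ⟨K, hKW, hK1, hK2⟩ := ih (W.erase m2) (by rw [Finset.card_erase_of_mem hm2.1, hW]; rfl)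
      refine ⟨K, hKW.trans (Finset.erase_subset _ _), hK1, ?_⟩
      intro w hw hwK
      by_cases hwm : w = m2
      · subst hwm
        by_cases h1 : m1 ∈ K
        · exact ⟨m1, h1, Or.inr ⟨hg12, hlt⟩⟩
        · have hne : m1 ≠ w := by rintro rfl; exact lt_irrefl _ hlt
          obtain ⟨z, hz, h | h⟩ := hK2 m1 (by simp [hne, hm1.1]) h1
          · have := hm1.2 z (Finset.mem_of_mem_erase (hKW hz)) h.1
            omega
          · exact ⟨z, hz, Or.inr ⟨h.1.trans hg12, hlt.trans h.2⟩⟩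
      · exact hK2 w (by simp [hwm, hw]) hwK

theorem galvin_aux {V S T : Type*} (f : V → S) (g : V → T) (κ : V → ℕ)
    (hκ : ∀ u v, u ≠ v → (f u = f v ∨ g u = g v) → κ u ≠ κ v)
    (out : V → V → Prop) (hout : ∀ w z, out w z ↔ ((f z = f w ∧ κ z < κ w) ∨ (g z = g w ∧ κ w < κ z)))
    [∀ w, DecidablePred (out w)] :
    ∀ (n : ℕ) (U : Finset V) (L : V → Finset ℕ), U.card = n →
      (∀ v ∈ U, (U.filter (out v)).card < (L v).card) →
      ∃ c : V → ℕ, (∀ v ∈ U, c v ∈ L v) ∧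
        ∀ u ∈ U, ∀ v ∈ U, u ≠ v → (f u = f v ∨ g u = g v) → c u ≠ c v := by
  classical
  intro n
  induction n using Nat.strong_induction_on with
  | _ n ih =>
  intro U L hU hL
  rcases U.eq_empty_or_nonempty with rfl | ⟨v0, hv0⟩
  · exact ⟨fun _ => 0, by simp, by simp⟩
  have : (L v0).Nonempty := Finset.card_pos.1 (lt_of_le_of_lt (Nat.zero_le _) (hL v0 hv0))
  obtain ⟨a, ha⟩ := this
  obtain ⟨K, hKW, hK1, hK2⟩ := kernel_exists f g κ hκ _ (U.filter (fun v => a ∈ L v)) rfl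
  have hKne : K.Nonempty := by
    by_contra h
    rw [Finset.not_nonempty_iff_eq_empty] at h
    obtain ⟨z, hz, _⟩ := hK2 v0 (by simp [hv0, ha]) (by simp [h])
    simp [h] at hz
  have hKU : K ⊆ U := hKW.trans (Finset.filter_subset _ _)
  obtain ⟨c, hc1, hc2⟩ := ih (U \ K).card (by
      rw [← hU]; apply Finset.card_lt_card
      refine ⟨Finset.sdiff_subset, ?_⟩
      intro h
      obtain ⟨z, hz⟩ := hKne
      have := h (hKU hz)
      simp [hz] at this) (U \ K) (fun v => (L v).erase a) rfl (by
    intro v hv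
    rw [Finset.mem_sdiff] at hv
    by_cases hav : a ∈ L v
    · rw [Finset.card_erase_of_mem hav]
      obtain ⟨z, hz, h⟩ := hK2 v (by simp [hv.1, hav]) hv.2
      have h1 : ((U \ K).filter (out v)).card < (U.filter (out v)).card := by
        apply Finset.card_lt_card
        refine ⟨Finset.filter_subset_filter _ Finset.sdiff_subset, ?_⟩
        intro hs
        have := hs (Finset.mem_filter.2 ⟨hKU hz, (hout v z).2 h⟩)
        simp [hz] at this
      have := hL v hv.1
      omega
    · rw [Finset.erase_eq_of_notMem hav]
      exact lt_of_le_of_lt (Finset.card_le_card (Finset.filter_subset_filter _ Finset.sdiff_subset)) (hL v hv.1))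
  refine ⟨fun v => if v ∈ K then a else c v, ?_, ?_⟩
  · intro v hv
    dsimp only
    split_ifs with h
    · exact (Finset.mem_filter.1 (hKW h)).2
    · exact Finset.mem_of_mem_erase (hc1 v (by simp [hv, h]))
  · intro u hu v hv huv h
    dsimp only
    split_ifs with h1 h2 h2
    · exact absurd h (hK1 u h1 v h2 huv)
    · exact (Finset.ne_of_mem_erase (hc1 v (by simp [hv, h2]))).symm
    · exact (Finset.ne_of_mem_erase (hc1 u (by simp [hu, h1])))
    · exact hc2 u (by simp [hu, h1]) v (by simp [hv, h2]) huv h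

theorem galvin {V S T : Type*} [Fintype V] [Fintype S] [Fintype T] (k : ℕ) (f : V → S) (g : V → T)
    (hf : ∀ s, Nat.card {v // f v = s} ≤ k) (hg : ∀ s, Nat.card {v // g v = s} ≤ k)
    (L : V → Finset ℕ) (hL : ∀ v, (L v).card = k) :
    ∃ c : V → ℕ, (∀ v, c v ∈ L v) ∧
      ∀ u v, u ≠ v → (f u = f v ∨ g u = g v) → c u ≠ c v := by
  classical
  obtain ⟨κ, hκ1, hκ⟩ := konig k f g hf hg
  obtain ⟨c, h1, h2⟩ := galvin_aux f g κ hκ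
    (fun w z => (f z = f w ∧ κ z < κ w) ∨ (g z = g w ∧ κ w < κ z)) (fun _ _ => Iff.rfl) _ Finset.univ L rfl (by
    intro v _
    rw [hL v]
    have : (Finset.univ.filter (fun z => (f z = f v ∧ κ z < κ v) ∨ (g z = g v ∧ κ v < κ z))).card
        ≤ ((Finset.range k).erase (κ v)).card := by
      apply Finset.card_le_card_of_injOn κ
      · intro z hz
        simp only [Finset.coe_filter, Finset.mem_univ, true_and, Set.mem_ofPred_eq] at hz
        simp only [Finset.coe_erase, Set.mem_sdiff, Finset.mem_coe, Finset.mem_range, Set.mem_singleton_iff]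
        exact ⟨hκ1 z, by omega⟩
      · intro z hz z' hz' hzz
        simp only [Finset.coe_filter, Finset.mem_univ, true_and, Set.mem_ofPred_eq] at hz hz'
        by_contra hne
        rcases hz with hz | hz <;> rcases hz' with hz' | hz'
        · exact hκ z z' hne (Or.inl (hz.1.trans hz'.1.symm)) hzz
        · omega
        · omega
        · exact hκ z z' hne (Or.inr (hz.1.trans hz'.1.symm)) hzz
    rw [Finset.card_erase_of_mem (by simp [hκ1 v]), Finset.card_range] at this
    have := hκ1 v
    omega)
  exact ⟨c, fun v => h1 v (Finset.mem_univ _), fun u v => h2 u (Finset.mem_univ _) v (Finset.mem_univ _)⟩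

theorem hall_on_s13 {V : Type*} (W : Finset V) (L : V → Finset ℕ)
    (h : ∀ S ⊆ W, S.Nonempty → S.card ≤ (S.biUnion L).card) :
    ∃ c : V → ℕ, (∀ v ∈ W, c v ∈ L v) ∧ ∀ u ∈ W, ∀ v ∈ W, c u = c v → u = v := by
  classical
  obtain ⟨f, hf1, hf2⟩ := (Finset.all_card_le_biUnion_card_iff_exists_injective
    (fun v : {v // v ∈ W} => L v.1)).1 (by
      intro S
      rcases S.eq_empty_or_nonempty with rfl | hS
      · simp
      have h1 := h (S.image Subtype.val) (by
        intro v hv; rw [Finset.mem_image] at hv; obtain ⟨w, _, rfl⟩ := hv; exact w.2) (hS.image _)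
      rw [Finset.card_image_of_injective _ Subtype.val_injective, Finset.image_biUnion] at h1
      exact h1)
  refine ⟨fun v => if hv : v ∈ W then f ⟨v, hv⟩ else 0, ?_, ?_⟩
  · intro v hv; simp only [hv, dif_pos]; exact hf2 ⟨v, hv⟩
  · intro u hu v hv huv
    simp only [hu, hv, dif_pos] at huv
    simpa using hf1 huv

theorem card_le_bi {V : Type*} (S : Finset V) (L : V → Finset ℕ) (n : ℕ) (v : V) (hv : v ∈ S)
    (h : n ≤ (L v).card) : n ≤ (S.biUnion L).card :=
  h.trans (Finset.card_le_card (Finset.subset_biUnion_of_mem L hv))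

theorem e_lemma {V : Type*} [DecidableEq V] (σ : V → V) (hσ : ∀ v, σ (σ v) = v) :
    ∀ (n : ℕ) (X Y : Finset V) (L : V → Finset ℕ), X.card = n → Disjoint X Y →
      (∀ x ∈ X, σ x ∈ Y) → (∀ x ∈ X, X.card ≤ (L x).card) → (∀ y ∈ Y, Y.card ≤ (L y).card) →
      ∃ c : V → ℕ, (∀ v ∈ X ∪ Y, c v ∈ L v) ∧
        ∀ u ∈ X ∪ Y, ∀ v ∈ X ∪ Y, c u = c v → u = v ∨ σ u = v := by
  intro n
  induction n with
  | zero =>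
    intro X Y L hX _ _ hLX hLY
    rw [Finset.card_eq_zero] at hX
    subst hX
    obtain ⟨c, h1, h2⟩ := hall_on_s13 Y L (by
      rintro S hS ⟨v, hv⟩
      exact card_le_bi S L _ v hv ((Finset.card_le_card hS).trans (hLY v (hS hv))))
    refine ⟨c, by simpa using h1, ?_⟩
    intro u hu v hv h
    left; exact h2 u (by simpa using hu) v (by simpa using hv) h
  | succ n ih =>
    intro X Y L hX hXY hσX hLX hLY
    have hdis : ∀ v, v ∈ X → v ∈ Y → False := fun v h1 h2 => Finset.disjoint_left.1 hXY h1 h2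
    by_cases hc : ∃ x ∈ X, ∃ a, a ∈ L x ∧ a ∈ L (σ x)
    · obtain ⟨x, hx, a, ha1, ha2⟩ := hc
      have hy := hσX x hx
      obtain ⟨c, h1, h2⟩ := ih (X.erase x) (Y.erase (σ x)) (fun v => (L v).erase a)
        (by rw [Finset.card_erase_of_mem hx, hX]; rfl)
        (hXY.mono (Finset.erase_subset _ _) (Finset.erase_subset _ _))
        (by
          intro z hz
          rw [Finset.mem_erase] at hz ⊢
          refine ⟨fun h => hz.1 ?_, hσX z hz.2⟩
          rw [← hσ z, h, hσ])
        (by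
          intro z hz
          rw [Finset.card_erase_of_mem hx]
          have := hLX z (Finset.mem_of_mem_erase hz)
          have := Finset.pred_card_le_card_erase (s := L z) (a := a)
          omega)
        (by
          intro z hz
          rw [Finset.card_erase_of_mem hy]
          have := hLY z (Finset.mem_of_mem_erase hz)
          have := Finset.pred_card_le_card_erase (s := L z) (a := a)
          omega)
      have hmem : ∀ v ∈ X ∪ Y, v ≠ x → v ≠ σ x → v ∈ X.erase x ∪ Y.erase (σ x) := by
        intro v hv h1 h2
        simp only [Finset.mem_union, Finset.mem_erase] at hv ⊢
        tauto
      refine ⟨fun v => if v = x ∨ v = σ x then a else c v, ?_, ?_⟩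
      · intro v hv
        dsimp only
        split_ifs with h
        · rcases h with rfl | rfl <;> assumption
        · push Not at h
          exact Finset.mem_of_mem_erase (h1 v (hmem v hv h.1 h.2))
      · intro u hu v hv
        dsimp only
        split_ifs with h h' h'
        · intro _
          rcases h with rfl | rfl <;> rcases h' with rfl | rfl <;> simp [hσ]
        · intro hh
          push Not at h'
          exact absurd hh.symm (Finset.ne_of_mem_erase (h1 v (hmem v hv h'.1 h'.2)))
        · intro hh
          push Not at h
          exact absurd hh (Finset.ne_of_mem_erase (h1 u (hmem u hu h.1 h.2)))
        · push Not at h h'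
          exact h2 u (hmem u hu h.1 h.2) v (hmem v hv h'.1 h'.2)
    · push Not at hc
      obtain ⟨c, h1, h2⟩ := hall_on_s13 (X ∪ Y) L (by
        rintro S hS hne
        by_cases hp : ∃ x ∈ X, x ∈ S ∧ σ x ∈ S
        · obtain ⟨x, hx, hxS, hsS⟩ := hp
          have hd : Disjoint (L x) (L (σ x)) := Finset.disjoint_left.2 (fun a h1 => hc x hx a h1)
          calc S.card ≤ (X ∪ Y).card := Finset.card_le_card hS
            _ ≤ X.card + Y.card := Finset.card_union_le _ _
            _ ≤ (L x).card + (L (σ x)).card := Nat.add_le_add (hLX x hx) (hLY _ (hσX x hx))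
            _ = (L x ∪ L (σ x)).card := (Finset.card_union_of_disjoint hd).symm
            _ ≤ _ := Finset.card_le_card (Finset.union_subset (Finset.subset_biUnion_of_mem L hxS)
              (Finset.subset_biUnion_of_mem L hsS))
        · push Not at hp
          by_cases hy : ∃ y ∈ S, y ∈ Y
          · obtain ⟨y, hyS, hyY⟩ := hy
            refine card_le_bi S L _ y hyS (le_trans ?_ (hLY y hyY))
            apply Finset.card_le_card_of_injOn (fun u => if u ∈ X then σ u else u)
            · intro u hu
              dsimp only
              split_ifs with h
              · exact hσX u h
              · have := hS hu
                rw [Finset.mem_union] at this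
                exact this.resolve_left h
            · intro u hu v hv
              dsimp only
              split_ifs with h h' h'
              · intro hh; rw [← hσ u, hh, hσ]
              · intro hh; exact absurd (hh ▸ hv) (hp u h hu)
              · intro hh; exact absurd (hh ▸ hu) (hp v h' hv)
              · exact id
          · push Not at hy
            have hSX : S ⊆ X := by
              intro v hv
              have := hS hv
              rw [Finset.mem_union] at this
              exact this.resolve_right (hy v hv)
            obtain ⟨v, hv⟩ := hne
            exact card_le_bi S L _ v hv ((Finset.card_le_card hSX).trans (hLX v (hSX hv))))
      exact ⟨c, h1, fun u hu v hv h => Or.inl (h2 u hu v hv h)⟩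

/-- key lemma, one pair -/
theorem key_one {V : Type*} (Y : Finset V) (L : V → Finset ℕ) (A B S : Finset ℕ)
    (hY : Y.Nonempty) (hLY : ∀ y ∈ Y, Y.card + 1 ≤ (L y).card)
    (hA : 2 ≤ A.card) (hB : Y.card + 1 ≤ B.card) (hS : 2 ≤ S.card)
    (hUA : Y.card + 2 ≤ (A ∪ (S ∪ Y.biUnion L)).card)
    (hUB : Y.card + 2 ≤ (B ∪ (S ∪ Y.biUnion L)).card) :
    ∃ a ∈ A, ∃ b ∈ B, ∃ s ∈ S, ∃ c : V → ℕ, (∀ y ∈ Y, c y ∈ L y) ∧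
      (∀ u ∈ Y, ∀ v ∈ Y, c u = c v → u = v) ∧ a ≠ s ∧ b ≠ s ∧
      ∀ y ∈ Y, c y ≠ a ∧ c y ≠ b ∧ c y ≠ s := by
  classical
  -- Hall on `Option V`, with none for the single vertex
  have H0 : ∀ (S' : Finset ℕ) (L' : V → Finset ℕ), 1 ≤ S'.card → (∀ y ∈ Y, Y.card ≤ (L' y).card) →
      Y.card + 1 ≤ (S' ∪ Y.biUnion L').card →
      ∃ s ∈ S', ∃ c : V → ℕ, (∀ y ∈ Y, c y ∈ L' y) ∧
      (∀ u ∈ Y, ∀ v ∈ Y, c u = c v → u = v) ∧ ∀ y ∈ Y, c y ≠ s := by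
    intro S' L' h1 h2 h3
    obtain ⟨c, hc1, hc2⟩ := hall_on_s13 (Finset.insertNone Y) (fun o => o.elim S' L') (by
      intro T hT hne
      by_cases hTe : T = Finset.insertNone Y
      · subst hTe
        rw [Finset.card_insertNone]
        refine h3.trans (Finset.card_le_card ?_)
        intro n hn
        rw [Finset.mem_union, Finset.mem_biUnion] at hn
        rw [Finset.mem_biUnion]
        rcases hn with hn | ⟨y, hy, hn⟩
        · exact ⟨none, by simp, hn⟩
        · exact ⟨some y, by simpa using hy, hn⟩
      · have hlt : T.card < Y.card + 1 := by
          rw [← Finset.card_insertNone]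
          exact Finset.card_lt_card (lt_of_le_of_ne hT hTe)
        by_cases hy : ∃ y, some y ∈ T
        · obtain ⟨y, hy⟩ := hy
          exact card_le_bi T _ _ _ hy (le_trans (by omega) (h2 y (by simpa using hT hy)))
        · push Not at hy
          have hTn : T ⊆ {none} := by
            intro o ho
            cases o with
            | none => simp
            | some y => exact absurd ho (hy y)
          obtain ⟨o, ho⟩ := hne
          have : o = none := by simpa using hTn ho
          subst this
          exact card_le_bi T _ _ _ ho (le_trans (Finset.card_le_card hTn) (by simpa using h1)))
    refine ⟨c none, hc1 none (by simp), fun v => c (some v), fun y hy => hc1 (some y) (by simpa using hy), ?_, ?_⟩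
    · intro u hu v hv h
      simpa using hc2 (some u) (by simpa using hu) (some v) (by simpa using hv) h
    · intro y hy h
      simpa using hc2 (some y) (by simpa using hy) none (by simp) h
  obtain ⟨y0, hy0⟩ := hY
  by_cases h1 : ∃ a, a ∈ A ∧ a ∈ B ∧ Y.card + 1 ≤ ((S ∪ Y.biUnion L).erase a).card
  · obtain ⟨a, haA, haB, ha⟩ := h1
    obtain ⟨s, hs, c, hc1, hc2, hc3⟩ := H0 (S.erase a) (fun y => (L y).erase a)
      (by have := Finset.pred_card_le_card_erase (s := S) (a := a); omega)
      (by intro y hy; have := Finset.pred_card_le_card_erase (s := L y) (a := a)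
          have := hLY y hy; omega)
      (by
        refine ha.trans (Finset.card_le_card ?_)
        intro n hn
        simp only [Finset.mem_erase, Finset.mem_union, Finset.mem_biUnion] at hn ⊢
        obtain ⟨hn, h | ⟨y, hy, h⟩⟩ := hn
        · exact Or.inl ⟨hn, h⟩
        · exact Or.inr ⟨y, hy, hn, h⟩)
    refine ⟨a, haA, a, haB, s, Finset.mem_of_mem_erase hs, c,
      fun y hy => Finset.mem_of_mem_erase (hc1 y hy), hc2, (Finset.ne_of_mem_erase hs).symm,
      (Finset.ne_of_mem_erase hs).symm, fun y hy => ?_⟩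
    have := Finset.ne_of_mem_erase (hc1 y hy)
    exact ⟨this, this, hc3 y hy⟩
  push Not at h1
  set U := S ∪ Y.biUnion L with hU
  have hUy : L y0 ⊆ U := (Finset.subset_biUnion_of_mem L hy0).trans Finset.subset_union_right
  have hUcard : Y.card + 1 ≤ U.card := (hLY y0 hy0).trans (Finset.card_le_card hUy)
  by_cases h2 : Disjoint A B
  · obtain ⟨c, hc1, hc2⟩ := hall_on_s13 (Finset.insertNone (Finset.insertNone (Finset.insertNone Y)))
      (fun o => o.elim A (fun o => o.elim B (fun o => o.elim S L))) (by
      intro T hT hne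
      have hTc := Finset.card_le_card hT
      simp only [Finset.card_insertNone] at hTc
      by_cases hnA : none ∈ T
      · by_cases hnB : some none ∈ T
        · calc T.card ≤ A.card + B.card := by omega
            _ = (A ∪ B).card := (Finset.card_union_of_disjoint h2).symm
            _ ≤ _ := Finset.card_le_card (Finset.union_subset
              (Finset.subset_biUnion_of_mem (fun o : Option (Option (Option V)) => o.elim A (fun o => o.elim B (fun o => o.elim S L))) hnA)
              (Finset.subset_biUnion_of_mem (fun o : Option (Option (Option V)) => o.elim A (fun o => o.elim B (fun o => o.elim S L))) hnB))
        · set T0 := (Finset.insertNone (Finset.insertNone (Finset.insertNone Y))).erase (some none) with hT0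
          have hT0c : T0.card = Y.card + 2 := by
            rw [hT0, Finset.card_erase_of_mem (by simp)]; simp
          have hTT0 : T ⊆ T0 := by
            intro o ho
            rw [hT0, Finset.mem_erase]
            exact ⟨fun h => hnB (h ▸ ho), hT ho⟩
          by_cases hTe : T = T0
          · rw [hTe, hT0c]
            refine hUA.trans (Finset.card_le_card ?_)
            intro n hn
            simp only [hU, Finset.mem_union, Finset.mem_biUnion] at hn
            rw [Finset.mem_biUnion]
            rcases hn with hn | hn | ⟨y, hy, hn⟩
            · exact ⟨none, by simp [hT0], hn⟩
            · exact ⟨some (some none), by simp [hT0], hn⟩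
            · exact ⟨some (some (some y)), by simpa [hT0] using hy, hn⟩
          · have hlt := Finset.card_lt_card (lt_of_le_of_ne hTT0 hTe)
            by_cases hy : ∃ y, some (some (some y)) ∈ T
            · obtain ⟨y, hy⟩ := hy
              exact card_le_bi T _ _ _ hy (le_trans (by omega) (hLY y (by simpa using hT hy)))
            · push Not at hy
              have hTn : T ⊆ {none, some (some none)} := by
                intro o ho
                rcases o with _ | _ | _ | y
                · simp
                · exact absurd ho hnB
                · simp
                · exact absurd ho (hy y)
              exact card_le_bi T _ _ _ hnA (le_trans (Finset.card_le_card hTn) (le_trans Finset.card_le_two hA))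
      · by_cases hnB : some none ∈ T
        · set T0 := (Finset.insertNone (Finset.insertNone (Finset.insertNone Y))).erase none with hT0
          have hT0c : T0.card = Y.card + 2 := by
            rw [hT0, Finset.card_erase_of_mem (by simp)]; simp
          have hTT0 : T ⊆ T0 := by
            intro o ho
            rw [hT0, Finset.mem_erase]
            exact ⟨fun h => hnA (h ▸ ho), hT ho⟩
          by_cases hTe : T = T0
          · rw [hTe, hT0c]
            refine hUB.trans (Finset.card_le_card ?_)
            intro n hn
            simp only [hU, Finset.mem_union, Finset.mem_biUnion] at hn
            rw [Finset.mem_biUnion]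
            rcases hn with hn | hn | ⟨y, hy, hn⟩
            · exact ⟨some none, by simp [hT0], hn⟩
            · exact ⟨some (some none), by simp [hT0], hn⟩
            · exact ⟨some (some (some y)), by simpa [hT0] using hy, hn⟩
          · have hlt := Finset.card_lt_card (lt_of_le_of_ne hTT0 hTe)
            exact card_le_bi T _ _ _ hnB (le_trans (by omega) hB)
        · have hTT0 : T ⊆ ((Finset.insertNone (Finset.insertNone (Finset.insertNone Y))).erase none).erase (some none) := by
            intro o ho
            simp only [Finset.mem_erase]
            exact ⟨fun h => hnB (h ▸ ho), fun h => hnA (h ▸ ho), hT ho⟩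
          have hlt := Finset.card_le_card hTT0
          rw [Finset.card_erase_of_mem (by simp), Finset.card_erase_of_mem (by simp)] at hlt
          simp only [Finset.card_insertNone] at hlt
          by_cases hy : ∃ y, some (some (some y)) ∈ T
          · obtain ⟨y, hy⟩ := hy
            exact card_le_bi T _ _ _ hy (le_trans (by omega) (hLY y (by simpa using hT hy)))
          · push Not at hy
            have hTn : T ⊆ {some (some none)} := by
              intro o ho
              rcases o with _ | _ | _ | y
              · exact absurd ho hnA
              · exact absurd ho hnB
              · simp
              · exact absurd ho (hy y)
            obtain ⟨o, ho⟩ := hne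
            have : o = some (some none) := by simpa using hTn ho
            subst this
            have h3 := Finset.card_le_card hTn
            rw [Finset.card_singleton] at h3
            exact card_le_bi T _ _ _ ho (le_trans (by omega) hS))
    refine ⟨c none, hc1 none (by simp), c (some none), hc1 (some none) (by simp),
      c (some (some none)), hc1 (some (some none)) (by simp), fun y => c (some (some (some y))),
      fun y hy => hc1 (some (some (some y))) (by simpa using hy), ?_, ?_, ?_, ?_⟩
    · intro u hu v hv h
      simpa using hc2 _ (by simpa using hu) _ (by simpa using hv) h
    · intro h; simpa using hc2 _ (by simp) _ (by simp) h
    · intro h; simpa using hc2 _ (by simp) _ (by simp) h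
    · intro y hy
      refine ⟨?_, ?_, ?_⟩ <;> intro h <;> simpa using hc2 _ (by simpa using hy) _ (by simp) h
  · rw [Finset.not_disjoint_iff] at h2
    obtain ⟨a, haA, haB⟩ := h2
    have hUle : U.card = Y.card + 1 := by
      have := h1 a haA haB
      have := Finset.pred_card_le_card_erase (s := U) (a := a)
      omega
    have hcom : ∀ a, a ∈ A → a ∈ B → a ∈ U := by
      intro a h h'
      by_contra hn
      have := h1 a h h'
      rw [Finset.erase_eq_of_notMem hn] at this
      omega
    have hf : ∀ A' : Finset ℕ, Y.card + 2 ≤ (A' ∪ U).card → ∃ f ∈ A', f ∉ U := by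
      intro A' h
      by_contra hn
      push Not at hn
      have : A' ∪ U = U := Finset.union_eq_right.2 hn
      rw [this] at h; omega
    obtain ⟨f, hfA, hfU⟩ := hf A hUA
    obtain ⟨g, hgB, hgU⟩ := hf B hUB
    obtain ⟨s, hs, c, hc1, hc2, hc3⟩ := H0 S L (by omega)
      (by intro y hy; have := hLY y hy; omega) hUcard
    have hsU : s ∈ U := Finset.mem_union_left _ hs
    have hcU : ∀ y ∈ Y, c y ∈ U := fun y hy =>
      Finset.mem_union_right _ (Finset.mem_biUnion.2 ⟨y, hy, hc1 y hy⟩)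
    refine ⟨f, hfA, g, hgB, s, hs, c, hc1, hc2, ?_, ?_, ?_⟩
    · rintro rfl; exact hfU hsU
    · rintro rfl; exact hgU hsU
    · intro y hy
      refine ⟨?_, ?_, hc3 y hy⟩
      · intro h; exact hfU (h ▸ hcU y hy)
      · intro h; exact hgU (h ▸ hcU y hy)

theorem fin6_cases : ∀ S : Finset (Fin 6), (0 ∈ S ∧ 1 ∈ S) ∨ (2 ∈ S ∧ 3 ∈ S) ∨ S.card ≤ 3 ∨
    S = {0,2,4,5} ∨ S = {0,3,4,5} ∨ S = {1,2,4,5} ∨ S = {1,3,4,5} := by decide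

theorem key_two_aux (A1 B1 A2 B2 S T : Finset ℕ) (c : ℕ)
    (hA1 : 3 ≤ A1.card) (hB1 : 3 ≤ B1.card) (hA2 : 3 ≤ A2.card) (hB2 : 3 ≤ B2.card)
    (hS : 3 ≤ S.card) (hT : 3 ≤ T.card)
    (h1 : 4 ≤ (A1 ∪ A2 ∪ S ∪ T).card)
    (h3 : 4 ≤ (B1 ∪ A2 ∪ S ∪ T).card)
    (hbad : ((A2 ∪ S ∪ T).erase c).card < 3) :
    ∃ a1 ∈ A1, ∃ b1 ∈ B1, ∃ a2 ∈ A2, ∃ b2 ∈ B2, ∃ s ∈ S, ∃ t ∈ T,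
      s ≠ t ∧ a1 ≠ a2 ∧ a1 ≠ b2 ∧ b1 ≠ a2 ∧ b1 ≠ b2 ∧ a1 ≠ s ∧ b1 ≠ s ∧ a2 ≠ s ∧ b2 ≠ s ∧
      a1 ≠ t ∧ b1 ≠ t ∧ a2 ≠ t ∧ b2 ≠ t := by
  have hU : (A2 ∪ S ∪ T).card ≤ 3 := by
    have := Finset.pred_card_le_card_erase (s := A2 ∪ S ∪ T) (a := c)
    omega
  have e1 : A2 = A2 ∪ S ∪ T := Finset.eq_of_subset_of_card_le
    (Finset.subset_union_left.trans Finset.subset_union_left) (by omega)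
  have e2 : S = A2 ∪ S ∪ T := Finset.eq_of_subset_of_card_le
    (Finset.subset_union_right.trans Finset.subset_union_left) (by omega)
  have e3 : T = A2 ∪ S ∪ T := Finset.eq_of_subset_of_card_le
    (Finset.subset_union_right) (by omega)
  have e4 : S = A2 := e2.trans e1.symm
  have e5 : T = A2 := e3.trans e1.symm
  clear e1 e2 e3
  subst e4; subst e5
  simp only [Finset.union_assoc, Finset.union_self] at h1 h3 hU
  have hf : ∀ A' : Finset ℕ, 4 ≤ (A' ∪ T).card → ∃ f ∈ A', f ∉ T := by
    intro A' h
    by_contra hn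
    push Not at hn
    have : A' ∪ T = T := Finset.union_eq_right.2 hn
    rw [this] at h; omega
  obtain ⟨f, hfA, hfU⟩ := hf A1 h1
  obtain ⟨g, hgB, hgU⟩ := hf B1 h3
  by_cases hsh : ∃ c' ∈ T, c' ∈ B2
  · obtain ⟨c', h4, h5⟩ := hsh
    have : 1 < (T.erase c').card := by rw [Finset.card_erase_of_mem h4]; omega
    obtain ⟨s, hs, t, ht, hst⟩ := Finset.one_lt_card.1 this
    rw [Finset.mem_erase] at hs ht
    have hne : ∀ x ∈ T, f ≠ x ∧ g ≠ x := fun x hx =>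
      ⟨fun h => hfU (h ▸ hx), fun h => hgU (h ▸ hx)⟩
    exact ⟨f, hfA, g, hgB, c', h4, c', h5, s, hs.2, t, ht.2, hst, (hne _ h4).1, (hne _ h4).1,
      (hne _ h4).2, (hne _ h4).2, (hne _ hs.2).1, (hne _ hs.2).2, hs.1.symm, hs.1.symm,
      (hne _ ht.2).1, (hne _ ht.2).2, ht.1.symm, ht.1.symm⟩
  · push Not at hsh
    have : ∃ b ∈ B2, b ∉ ({f, g} : Finset ℕ) := by
      by_contra hn
      push Not at hn
      have := Finset.card_le_card (show B2 ⊆ {f, g} from hn)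
      have := Finset.card_le_two (a := f) (b := g)
      omega
    obtain ⟨b, hb, hbfg⟩ := this
    simp only [Finset.mem_insert, Finset.mem_singleton, not_or] at hbfg
    obtain ⟨x, y, z, hx, hy, hz, hxy, hxz, hyz⟩ := Finset.two_lt_card_iff.1 (show 2 < T.card by omega)
    have hne : ∀ x ∈ T, f ≠ x ∧ g ≠ x ∧ b ≠ x := fun x hx =>
      ⟨fun h => hfU (h ▸ hx), fun h => hgU (h ▸ hx), fun h => hsh b (h ▸ hx) hb⟩
    exact ⟨f, hfA, g, hgB, x, hx, b, hb, y, hy, z, hz, hyz, (hne _ hx).1, fun h => hbfg.1 h.symm,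
      (hne _ hx).2.1, fun h => hbfg.2 h.symm, (hne _ hy).1, (hne _ hy).2.1, hxy, (hne _ hy).2.2,
      (hne _ hz).1, (hne _ hz).2.1, hxz, (hne _ hz).2.2⟩

theorem key_two_aux2 (A1 B1 A2 B2 S T : Finset ℕ) (c : ℕ) (hcA : c ∈ A1) (hcB : c ∈ B1)
    (hA1 : 3 ≤ A1.card) (hB1 : 3 ≤ B1.card) (hA2 : 3 ≤ A2.card) (hB2 : 3 ≤ B2.card)
    (hS : 3 ≤ S.card) (hT : 3 ≤ T.card)
    (h1 : 4 ≤ (A1 ∪ A2 ∪ S ∪ T).card) (h2 : 4 ≤ (A1 ∪ B2 ∪ S ∪ T).card)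
    (h3 : 4 ≤ (B1 ∪ A2 ∪ S ∪ T).card) (h4 : 4 ≤ (B1 ∪ B2 ∪ S ∪ T).card) :
    ∃ a1 ∈ A1, ∃ b1 ∈ B1, ∃ a2 ∈ A2, ∃ b2 ∈ B2, ∃ s ∈ S, ∃ t ∈ T,
      s ≠ t ∧ a1 ≠ a2 ∧ a1 ≠ b2 ∧ b1 ≠ a2 ∧ b1 ≠ b2 ∧ a1 ≠ s ∧ b1 ≠ s ∧ a2 ≠ s ∧ b2 ≠ s ∧
      a1 ≠ t ∧ b1 ≠ t ∧ a2 ≠ t ∧ b2 ≠ t := by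
  by_cases b1 : ((A2 ∪ S ∪ T).erase c).card < 3
  · exact key_two_aux A1 B1 A2 B2 S T c hA1 hB1 hA2 hB2 hS hT h1 h3 b1
  by_cases b2 : ((B2 ∪ S ∪ T).erase c).card < 3
  · obtain ⟨a1, ha1, b1, hb1, a2, ha2, b2, hb2, s, hs, t, ht, h⟩ :=
      key_two_aux A1 B1 B2 A2 S T c hA1 hB1 hB2 hA2 hS hT h2 h4 b2
    exact ⟨a1, ha1, b1, hb1, b2, hb2, a2, ha2, s, hs, t, ht, by tauto⟩
  have hp : ∀ Z : Finset ℕ, 3 ≤ Z.card → 2 ≤ (Z.erase c).card := by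
    intro Z hZ
    have := Finset.pred_card_le_card_erase (s := Z) (a := c)
    omega
  obtain ⟨a, ha, b, hb, s, hs, f, hf1, -, h5, h6, h7⟩ := key_one (V := Unit) {()} (fun _ => T.erase c)
    (A2.erase c) (B2.erase c) (S.erase c) (by simp) (by simpa using hp T hT) (hp _ hA2)
    (by simpa using hp _ hB2) (hp _ hS)
    (by
      rw [Finset.card_singleton, Finset.singleton_biUnion, ← Finset.erase_union_distrib,
        ← Finset.erase_union_distrib, ← Finset.union_assoc]; omega)
    (by
      rw [Finset.card_singleton, Finset.singleton_biUnion, ← Finset.erase_union_distrib,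
        ← Finset.erase_union_distrib, ← Finset.union_assoc]; omega)
  have hf := hf1 () (by simp)
  have h8 := h7 () (by simp)
  rw [Finset.mem_erase] at ha hb hs hf
  exact ⟨c, hcA, c, hcB, a, ha.2, b, hb.2, s, hs.2, f (), hf.2, h8.2.2.symm, ha.1.symm, hb.1.symm,
    ha.1.symm, hb.1.symm, hs.1.symm, hs.1.symm, h5, h6, hf.1.symm, hf.1.symm, h8.1.symm, h8.2.1.symm⟩

theorem key_two (A1 B1 A2 B2 S T : Finset ℕ)
    (hA1 : 3 ≤ A1.card) (hB1 : 3 ≤ B1.card) (hA2 : 3 ≤ A2.card) (hB2 : 3 ≤ B2.card)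
    (hS : 3 ≤ S.card) (hT : 3 ≤ T.card)
    (h1 : 4 ≤ (A1 ∪ A2 ∪ S ∪ T).card) (h2 : 4 ≤ (A1 ∪ B2 ∪ S ∪ T).card)
    (h3 : 4 ≤ (B1 ∪ A2 ∪ S ∪ T).card) (h4 : 4 ≤ (B1 ∪ B2 ∪ S ∪ T).card) :
    ∃ a1 ∈ A1, ∃ b1 ∈ B1, ∃ a2 ∈ A2, ∃ b2 ∈ B2, ∃ s ∈ S, ∃ t ∈ T,
      s ≠ t ∧ a1 ≠ a2 ∧ a1 ≠ b2 ∧ b1 ≠ a2 ∧ b1 ≠ b2 ∧ a1 ≠ s ∧ b1 ≠ s ∧ a2 ≠ s ∧ b2 ≠ s ∧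
      a1 ≠ t ∧ b1 ≠ t ∧ a2 ≠ t ∧ b2 ≠ t := by
  by_cases d1 : Disjoint A1 B1
  · by_cases d2 : Disjoint A2 B2
    · obtain ⟨c, hc1, hc2⟩ := hall_on_s13 (Finset.univ : Finset (Fin 6)) ![A1, B1, A2, B2, S, T] (by
        intro W _ hne
        have hW6 : W.card ≤ 6 := by simpa using Finset.card_le_univ W
        have h3' : ∀ i, 3 ≤ (![A1, B1, A2, B2, S, T] i).card := by
          intro i; fin_cases i <;> assumption
        have h6 : ∀ i j, i ∈ W → j ∈ W →
            Disjoint (![A1, B1, A2, B2, S, T] i) (![A1, B1, A2, B2, S, T] j) →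
            W.card ≤ (W.biUnion ![A1, B1, A2, B2, S, T]).card := by
          intro i j hi hj hd
          have := h3' i
          have := h3' j
          refine le_trans (show W.card ≤ (![A1, B1, A2, B2, S, T] i).card + (![A1, B1, A2, B2, S, T] j).card by omega) ?_
          rw [← Finset.card_union_of_disjoint hd]
          exact Finset.card_le_card (Finset.union_subset (Finset.subset_biUnion_of_mem _ hi)
            (Finset.subset_biUnion_of_mem _ hj))
        rcases fin6_cases W with h | h | h | h | h | h | h
        · exact h6 0 1 h.1 h.2 d1
        · exact h6 2 3 h.1 h.2 d2
        · obtain ⟨i, hi⟩ := hne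
          exact card_le_bi W _ _ i hi (h.trans (h3' i))
        all_goals
          subst h
          simp only [Finset.biUnion_insert, Finset.singleton_biUnion, ← Finset.union_assoc]
          assumption)
      have hne : ∀ i j : Fin 6, i ≠ j → c i ≠ c j := fun i j hij h =>
        hij (hc2 i (Finset.mem_univ _) j (Finset.mem_univ _) h)
      refine ⟨c 0, hc1 0 (Finset.mem_univ _), c 1, hc1 1 (Finset.mem_univ _), c 2, hc1 2 (Finset.mem_univ _),
        c 3, hc1 3 (Finset.mem_univ _), c 4, hc1 4 (Finset.mem_univ _), c 5, hc1 5 (Finset.mem_univ _),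
        ?_⟩
      refine ⟨?_, ?_, ?_, ?_, ?_, ?_, ?_, ?_, ?_, ?_, ?_, ?_, ?_⟩ <;> exact hne _ _ (by decide)
    · rw [Finset.not_disjoint_iff] at d2
      obtain ⟨c, h, h'⟩ := d2
      obtain ⟨a1, ha1, b1, hb1, a2, ha2, b2, hb2, s, hs, t, ht, h⟩ :=
        key_two_aux2 A2 B2 A1 B1 S T c h h' hA2 hB2 hA1 hB1 hS hT (by rwa [Finset.union_comm A2])
          (by rwa [Finset.union_comm A2]) (by rwa [Finset.union_comm B2]) (by rwa [Finset.union_comm B2])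
      refine ⟨a2, ha2, b2, hb2, a1, ha1, b1, hb1, s, hs, t, ht, ?_⟩
      simp only [ne_comm, ne_eq] at h ⊢
      tauto
  · rw [Finset.not_disjoint_iff] at d1
    obtain ⟨c, h, h'⟩ := d1
    exact key_two_aux2 A1 B1 A2 B2 S T c h h' hA1 hB1 hA2 hB2 hS hT h1 h2 h3 h4

universe u

def ValidC {V : Type*} (G : SimpleGraph V) (c : Sym2 V → Bool) : Prop :=
  ∀ u v w : V, G.Adj u v → G.Adj v w → u ≠ w → ¬G.Adj u w → c s(u, v) ≠ c s(v, w)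

structure PieceC {V : Type*} (G : SimpleGraph V) (c : Sym2 V → Bool) (X Y : Finset V) : Prop where
  disj : ∀ v, v ∈ X → v ∈ Y → False
  cX : ∀ u ∈ X, ∀ v ∈ X, u ≠ v → G.Adj u v
  cY : ∀ u ∈ Y, ∀ v ∈ Y, u ≠ v → G.Adj u v
  non : ∃ x ∈ X, ∃ y ∈ Y, ¬ G.Adj x y
  redX : ∀ x ∈ X, ∀ z, z ∉ X → z ∉ Y → G.Adj x z → c s(x, z) = true ∧ ∀ x' ∈ X, G.Adj x' z
  redY : ∀ x ∈ Y, ∀ z, z ∉ X → z ∉ Y → G.Adj x z → c s(x, z) = true ∧ ∀ x' ∈ Y, G.Adj x' z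

theorem PieceC.symm {V : Type*} {G : SimpleGraph V} {c : Sym2 V → Bool} {X Y : Finset V}
    (h : PieceC G c X Y) : PieceC G c Y X where
  disj v h1 h2 := h.disj v h2 h1
  cX := h.cY
  cY := h.cX
  non := by obtain ⟨x, hx, y, hy, h⟩ := h.non; exact ⟨y, hy, x, hx, fun h' => h h'.symm⟩
  redX x hx z h1 h2 := h.redY x hx z h2 h1
  redY x hx z h1 h2 := h.redX x hx z h2 h1

structure MatchC {V : Type*} (G : SimpleGraph V) (X Y : Finset V) (σ : V → V) : Prop where
  inv : ∀ v, σ (σ v) = v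
  mX : ∀ x ∈ X, σ x ≠ x → σ x ∈ Y ∧ ¬ G.Adj x (σ x)
  mY : ∀ x ∈ Y, σ x ≠ x → σ x ∈ X ∧ ¬ G.Adj x (σ x)

theorem MatchC.symm {V : Type*} {G : SimpleGraph V} {X Y : Finset V} {σ : V → V}
    (h : MatchC G X Y σ) : MatchC G Y X σ := ⟨h.inv, h.mY, h.mX⟩

/-- augmented graph -/
def Gp {V : Type*} (G : SimpleGraph V) (X Y : Finset V) (σ : V → V) : SimpleGraph V where
  Adj u v := u ≠ v ∧ (((u ∈ X ∨ u ∈ Y) ∧ (v ∈ X ∨ v ∈ Y) ∧ σ u ≠ v ∧ σ v ≠ u) ∨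
    (¬ ((u ∈ X ∨ u ∈ Y) ∧ (v ∈ X ∨ v ∈ Y)) ∧ G.Adj u v))
  symm := ⟨by
    rintro u v ⟨h1, h2⟩
    refine ⟨h1.symm, ?_⟩
    rcases h2 with h2 | h2
    · left; tauto
    · right; exact ⟨by tauto, h2.2.symm⟩⟩
  loopless := ⟨fun v h => h.1 rfl⟩

theorem Gp_symm {V : Type*} (G : SimpleGraph V) (X Y : Finset V) (σ : V → V) :
    Gp G Y X σ = Gp G X Y σ := by
  ext u v
  simp only [Gp]
  tauto

section
variable {V : Type*} {G : SimpleGraph V} {c : Sym2 V → Bool} {X Y : Finset V} {σ : V → V}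

theorem PieceC.noAB (hv : ValidC G c) (hP : PieceC G c X Y) {x y z : V} (hx : x ∈ X) (hy : y ∈ Y)
    (hzX : z ∉ X) (hzY : z ∉ Y) (h1 : G.Adj x z) (h2 : G.Adj y z) : False := by
  obtain ⟨a, ha, b, hb, hab⟩ := hP.non
  have h3 := (hP.redX x hx z hzX hzY h1).2 a ha
  have h4 := (hP.redY y hy z hzX hzY h2).2 b hb
  have h5 := (hP.redX a ha z hzX hzY h3).1
  have h6 := (hP.redY b hb z hzX hzY h4).1
  have := hv a z b h3 h4.symm (fun h => hP.disj a ha (h ▸ hb)) hab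
  rw [h5, Sym2.eq_swap, h6] at this
  exact this rfl

theorem PieceC.cliqueA (hv : ValidC G c) (hP : PieceC G c X Y) {x z z' : V} (hx : x ∈ X)
    (hzX : z ∉ X) (hzY : z ∉ Y) (h1 : G.Adj x z)
    (hzX' : z' ∉ X) (hzY' : z' ∉ Y) (h1' : G.Adj x z') (hne : z ≠ z') : G.Adj z z' := by
  by_contra hn
  have := hv z x z' h1.symm h1' hne hn
  rw [Sym2.eq_swap, (hP.redX x hx z hzX hzY h1).1, (hP.redX x hx z' hzX' hzY' h1').1] at this
  exact this rfl

theorem Gp_ge (hM : MatchC G X Y σ) : G ≤ Gp G X Y σ := by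
  intro u v h
  refine ⟨h.ne, ?_⟩
  by_cases hw : (u ∈ X ∨ u ∈ Y) ∧ (v ∈ X ∨ v ∈ Y)
  · left
    have key : ∀ u v, G.Adj u v → (u ∈ X ∨ u ∈ Y) → σ u ≠ v := by
      rintro u v h hu rfl
      rcases hu with hu | hu
      · exact (hM.mX u hu h.ne').2 h
      · exact (hM.mY u hu h.ne').2 h
    exact ⟨hw.1, hw.2, key u v h hw.1, key v u h.symm hw.2⟩
  · right; exact ⟨hw, h⟩

theorem Gp_out {u v : V} (h : (Gp G X Y σ).Adj u v) (hu : u ∉ X) (hu' : u ∉ Y) : G.Adj u v := by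
  rcases h.2 with h | h
  · tauto
  · exact h.2

theorem Gp_X (hP : PieceC G c X Y) (hM : MatchC G X Y σ) {u v : V} (hu : u ∈ X) (hv : v ∈ X) (h : u ≠ v) :
    (Gp G X Y σ).Adj u v := Gp_ge hM (hP.cX u hu v hv h)

open Classical in
noncomputable def cp {V : Type*} (c : Sym2 V → Bool) (X Y : Finset V) : Sym2 V → Bool := fun e =>
  if (∃ x ∈ X, ∃ y ∈ Y, e = s(x, y)) then false else
  if (∃ x ∈ X, ∃ y ∈ X, e = s(x, y)) ∨ (∃ x ∈ Y, ∃ y ∈ Y, e = s(x, y)) then true else c e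

theorem cp_symm : cp c Y X = cp c X Y := by
  funext e
  have h : (∃ x ∈ X, ∃ y ∈ Y, e = s(x, y)) ↔ (∃ x ∈ Y, ∃ y ∈ X, e = s(x, y)) := by
    constructor <;> (rintro ⟨x, hx, y, hy, rfl⟩; exact ⟨y, hy, x, hx, Sym2.eq_swap⟩)
  classical
  exact if_congr h.symm rfl (if_congr or_comm rfl rfl)

theorem cp_XY {x y : V} (hx : x ∈ X) (hy : y ∈ Y) : cp c X Y s(x, y) = false := by
  unfold cp; rw [if_pos ⟨x, hx, y, hy, rfl⟩]

theorem cp_XX (hP : PieceC G c X Y) {x y : V} (hx : x ∈ X) (hy : y ∈ X) : cp c X Y s(x, y) = true := by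
  unfold cp; rw [if_neg, if_pos]
  · exact Or.inl ⟨x, hx, y, hy, rfl⟩
  · rintro ⟨a, ha, b, hb, h⟩
    rw [Sym2.eq_iff] at h
    rcases h with ⟨rfl, rfl⟩ | ⟨rfl, rfl⟩
    · exact hP.disj _ hy hb
    · exact hP.disj _ hx hb

theorem cp_out {x z : V} (hz : z ∉ X) (hz' : z ∉ Y) : cp c X Y s(x, z) = c s(x, z) := by
  have key : ∀ A B : Finset V, z ∉ A → z ∉ B → ¬ (∃ a ∈ A, ∃ b ∈ B, s(x, z) = s(a, b)) := by
    rintro A B h1 h2 ⟨a, ha, b, hb, h⟩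
    rw [Sym2.eq_iff] at h
    rcases h with ⟨rfl, rfl⟩ | ⟨rfl, rfl⟩
    · exact h2 hb
    · exact h1 ha
  unfold cp
  rw [if_neg (key X Y hz hz'), if_neg]
  rintro (h | h)
  · exact key X X hz hz h
  · exact key Y Y hz' hz' h

theorem Gp_valid_aux (hv : ValidC G c) (hP : PieceC G c X Y) (hM : MatchC G X Y σ)
    {u v w : V} (hvX : v ∈ X) (h1 : (Gp G X Y σ).Adj u v) (h2 : (Gp G X Y σ).Adj v w)
    (hne : u ≠ w) (hn : ¬ (Gp G X Y σ).Adj u w) (huY : u ∉ Y) (hwY : w ∉ Y) : False := by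
  by_cases huX : u ∈ X
  · by_cases hwX : w ∈ X
    · exact hn (Gp_X hP hM huX hwX hne)
    · have := Gp_out h2.symm hwX hwY
      exact hn (Gp_ge hM ((hP.redX v hvX w hwX hwY this.symm).2 u huX))
  · have h3 := Gp_out h1 huX huY
    by_cases hwX : w ∈ X
    · exact hn (Gp_ge hM ((hP.redX v hvX u huX huY h3.symm).2 w hwX).symm)
    · have h4 := Gp_out h2.symm hwX hwY
      exact hn (Gp_ge hM (hP.cliqueA hv hvX huX huY h3.symm hwX hwY h4.symm hne))

theorem Gp_valid_aux2 (hv : ValidC G c) (hP : PieceC G c X Y) (hM : MatchC G X Y σ)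
    {u v w : V} (hvX : v ∈ X) (h1 : (Gp G X Y σ).Adj u v) (h2 : (Gp G X Y σ).Adj v w)
    (hne : u ≠ w) (hn : ¬ (Gp G X Y σ).Adj u w) : cp c X Y s(u, v) ≠ cp c X Y s(v, w) := by
  have key : ∀ u, (Gp G X Y σ).Adj u v → u ∉ Y → cp c X Y s(v, u) = true := by
    intro u h huY
    by_cases huX : u ∈ X
    · exact cp_XX hP hvX huX
    · rw [cp_out huX huY]
      exact (hP.redX v hvX u huX huY (Gp_out h huX huY).symm).1
  rw [Sym2.eq_swap]
  by_cases huY : u ∈ Y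
  · by_cases hwY : w ∈ Y
    · exact absurd (by rw [← Gp_symm]; exact Gp_X hP.symm hM.symm huY hwY hne) hn
    · rw [cp_XY hvX huY, key w h2.symm hwY]; simp
  · by_cases hwY : w ∈ Y
    · rw [cp_XY hvX hwY, key u h1 huY]; simp
    · exact (Gp_valid_aux hv hP hM hvX h1 h2 hne hn huY hwY).elim

theorem Gp_valid (hv : ValidC G c) (hP : PieceC G c X Y) (hM : MatchC G X Y σ) :
    ValidC (Gp G X Y σ) (cp c X Y) := by
  intro u v w h1 h2 hne hn
  by_cases hvX : v ∈ X
  · exact Gp_valid_aux2 hv hP hM hvX h1 h2 hne hn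
  by_cases hvY : v ∈ Y
  · rw [← cp_symm]
    rw [← Gp_symm] at h1 h2 hn
    exact Gp_valid_aux2 hv hP.symm hM.symm hvY h1 h2 hne hn
  rw [cp_out hvX hvY, Sym2.eq_swap (a := v), cp_out hvX hvY, Sym2.eq_swap (a := w)]
  exact hv u v w (Gp_out h1.symm hvX hvY).symm (Gp_out h2 hvX hvY) hne (fun h => hn (Gp_ge hM h))

theorem match_card [DecidableEq V] (hM : MatchC G X Y σ) :
    (Y.filter (fun y => σ y ≠ y)).card = (X.filter (fun y => σ y ≠ y)).card := by
  apply Finset.card_bij (fun v _ => σ v)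
  · intro v hv
    rw [Finset.mem_filter] at hv ⊢
    exact ⟨(hM.mY v hv.1 hv.2).1, fun h => hv.2 (by rw [hM.inv] at h; exact h.symm)⟩
  · intro a _ b _ h; rw [← hM.inv a, h, hM.inv]
  · intro b hb
    rw [Finset.mem_filter] at hb
    refine ⟨σ b, ?_, hM.inv b⟩
    rw [Finset.mem_filter]
    exact ⟨(hM.mX b hb.1 hb.2).1, fun h => hb.2 (by rw [hM.inv] at h; exact h.symm)⟩

theorem Gp_clique [DecidableEq V] {k : ℕ} (hv : ValidC G c) (hP : PieceC G c X Y) (hM : MatchC G X Y σ)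
    (hcl : ∀ s : Finset V, (∀ u ∈ s, ∀ v ∈ s, u ≠ v → G.Adj u v) → s.card ≤ k)
    (hk : X.card + Y.card ≤ k + (X.filter (fun x => σ x ≠ x)).card)
    (s : Finset V) (hs : ∀ u ∈ s, ∀ v ∈ s, u ≠ v → (Gp G X Y σ).Adj u v) : s.card ≤ k := by
  by_cases hz : ∃ z ∈ s, z ∉ X ∧ z ∉ Y
  · obtain ⟨z, hzs, hzX, hzY⟩ := hz
    apply hcl
    intro u hu v hv' huv
    have key : ∀ u ∈ s, u ∈ X ∨ u ∈ Y → G.Adj u z := fun u hu hh =>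
      (Gp_out (hs z hzs u hu (by rintro rfl; tauto)) hzX hzY).symm
    rcases (hs u hu v hv' huv).2 with h | h
    · obtain ⟨h1, h2, -⟩ := h
      have h3 := key u hu h1
      have h4 := key v hv' h2
      rcases h1 with h1 | h1 <;> rcases h2 with h2 | h2
      · exact hP.cX u h1 v h2 huv
      · exact (hP.noAB hv h1 h2 hzX hzY h3 h4).elim
      · exact (hP.noAB hv h2 h1 hzX hzY h4 h3).elim
      · exact hP.cY u h1 v h2 huv
    · exact h.2
  · push Not at hz
    have hsW : ∀ v ∈ s, v ∈ X ∨ v ∈ Y := by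
      intro v hv; by_contra h; push Not at h; exact h.2 (hz v hv h.1)
    have h1 : s.card ≤ ((X.filter (fun x => σ x = x)) ∪ Y).card := by
      apply Finset.card_le_card_of_injOn (fun v => if v ∈ X then σ v else v)
      · intro v hv
        dsimp only
        simp only [Finset.coe_union, Set.mem_union, Finset.mem_coe, Finset.mem_filter]
        split_ifs with h
        · by_cases h' : σ v = v
          · left; rw [h']; exact ⟨h, h'⟩
          · right; exact (hM.mX v h h').1
        · right; exact (hsW v hv).resolve_left h
      · intro u hu v hv
        have hh : ∀ u ∈ s, ∀ v ∈ s, σ u = v → u = v := by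
          intro u hu v hv h
          by_contra hne
          rcases (hs u hu v hv hne).2 with h' | h'
          · exact h'.2.2.1 h
          · exact h'.1 ⟨hsW u hu, hsW v hv⟩
        dsimp only
        split_ifs with h h' h'
        · intro hh; rw [← hM.inv u, hh, hM.inv]
        · exact hh u hu v hv
        · intro h; exact (hh v hv u hu h.symm).symm
        · exact id
    have h2 := Finset.card_union_le (X.filter (fun x => σ x = x)) Y
    have h3 := Finset.card_filter_add_card_filter_not (s := X) (fun x => σ x = x)
    simp only [ne_eq] at hk
    omega
end


theorem lists_eq (k q : ℕ) (L1 L2 C U : Finset ℕ) (h1 : L1.card = k) (h2 : L2.card = k)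
    (hC : C.card + q ≤ k) (hU1 : L1 \ C ⊆ U) (hU2 : L2 \ C ⊆ U) (hU : U.card ≤ q) : L1 = L2 := by
  have key : ∀ L : Finset ℕ, L.card = k → L \ C ⊆ U → L = U ∪ C := by
    intro L hL hLU
    apply Finset.eq_of_subset_of_card_le
    · intro x hx
      by_cases h : x ∈ C
      · exact Finset.mem_union_right _ h
      · exact Finset.mem_union_left _ (hLU (Finset.mem_sdiff.2 ⟨hx, h⟩))
    · have := Finset.card_union_le U C
      omega
  rw [key L1 h1 hU1, key L2 h2 hU2]

section
variable {V : Type*} [Fintype V] [DecidableEq V] {G : SimpleGraph V} {c : Sym2 V → Bool} {X Y : Finset V} {σ : V → V}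

open Classical in
noncomputable def CC (G : SimpleGraph V) (X Y : Finset V) (col : V → ℕ) : Finset ℕ :=
  (Finset.univ.filter (fun z => z ∉ X ∧ z ∉ Y ∧ ∃ x ∈ X, G.Adj x z)).image col

theorem CC_card {k : ℕ} (hv : ValidC G c) (hP : PieceC G c X Y)
    (hcl : ∀ s : Finset V, (∀ u ∈ s, ∀ v ∈ s, u ≠ v → G.Adj u v) → s.card ≤ k) (col : V → ℕ) :
    (CC G X Y col).card + X.card ≤ k := by
  classical
  unfold CC
  set A := Finset.univ.filter (fun z => z ∉ X ∧ z ∉ Y ∧ ∃ x ∈ X, G.Adj x z) with hA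
  have hd : Disjoint A X := by
    rw [Finset.disjoint_left]; intro v hv; simp only [hA, Finset.mem_filter] at hv; exact hv.2.1
  have h1 : (A ∪ X).card ≤ k := by
    apply hcl
    intro u hu v hv' huv
    simp only [hA, Finset.mem_union, Finset.mem_filter, Finset.mem_univ, true_and] at hu hv'
    rcases hu with ⟨h1, h2, x, hx, h3⟩ | hu
    · rcases hv' with ⟨h1', h2', x', hx', h3'⟩ | hv'
      · have := (hP.redX x' hx' v h1' h2' h3').2 x hx
        exact hP.cliqueA hv hx h1 h2 h3 h1' h2' this huv
      · exact ((hP.redX x hx u h1 h2 h3).2 v hv').symm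
    · rcases hv' with ⟨h1', h2', x', hx', h3'⟩ | hv'
      · exact (hP.redX x' hx' v h1' h2' h3').2 u hu
      · exact hP.cX u hu v hv' huv
  rw [Finset.card_union_of_disjoint hd] at h1
  have : (A.image col).card ≤ A.card := Finset.card_image_le
  omega

theorem mem_CC {col : V → ℕ} {x z : V} (hx : x ∈ X) (hz : z ∉ X) (hz' : z ∉ Y) (h : G.Adj x z) :
    col z ∈ CC G X Y col := by
  classical
  unfold CC
  apply Finset.mem_image_of_mem
  simp only [Finset.mem_filter, Finset.mem_univ, true_and]
  exact ⟨hz, hz', x, hx, h⟩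

theorem notMem_CC {col : V → ℕ} {w x : V} (hP : PieceC G c X Y) (hw : w ∈ X ∨ w ∈ Y) (hM : MatchC G X Y σ) (hx : x ∈ X) (hxw : x ≠ w)
    (hcol : ∀ u v, u ≠ w → v ≠ w → (Gp G X Y σ).Adj u v → col u ≠ col v) : col x ∉ CC G X Y col := by
  classical
  unfold CC
  intro h
  simp only [Finset.mem_image, Finset.mem_filter, Finset.mem_univ, true_and] at h
  obtain ⟨z, ⟨h1, h2, x', hx', h3⟩, h4⟩ := h
  refine hcol z x ?_ hxw (Gp_ge hM ((hP.redX x' hx' z h1 h2 h3).2 x hx).symm) h4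
  rintro rfl; tauto

theorem extend {L : V → Finset ℕ} {w : V} (hP : PieceC G c X Y) (hw : w ∈ X ∨ w ∈ Y) (hM : MatchC G X Y σ) (col d : V → ℕ)
    (hcL : ∀ v, v ≠ w → col v ∈ L v)
    (hcol : ∀ u v, u ≠ w → v ≠ w → (Gp G X Y σ).Adj u v → col u ≠ col v)
    (hdX : ∀ x ∈ X, d x ∈ L x \ CC G X Y col) (hdY : ∀ x ∈ Y, d x ∈ L x \ CC G Y X col)
    (hd : ∀ u ∈ X ∪ Y, ∀ v ∈ X ∪ Y, d u = d v → u = v ∨ σ u = v) : ListColorable G L := by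
  refine ⟨fun v => if v ∈ X ∪ Y then d v else col v, ?_, ?_⟩
  · intro v
    dsimp only
    split_ifs with h
    · rcases Finset.mem_union.1 h with h | h
      · exact (Finset.mem_sdiff.1 (hdX v h)).1
      · exact (Finset.mem_sdiff.1 (hdY v h)).1
    · apply hcL
      rintro rfl
      rw [Finset.mem_union] at h; tauto
  · have key : ∀ u ∈ X ∪ Y, ∀ v ∉ X ∪ Y, G.Adj u v → d u ≠ col v := by
      intro u hu v hv h heq
      rw [Finset.mem_union, not_or] at hv
      rcases Finset.mem_union.1 hu with hu | hu
      · apply (Finset.mem_sdiff.1 (hdX u hu)).2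
        rw [heq]
        exact mem_CC hu hv.1 hv.2 h
      · apply (Finset.mem_sdiff.1 (hdY u hu)).2
        rw [heq]
        exact mem_CC hu hv.2 hv.1 h
    intro u v huv
    dsimp only
    split_ifs with h1 h2 h2
    · intro h
      have h3 := Gp_ge hM huv
      rcases hd u h1 v h2 h with h | h
      · exact huv.ne h
      · rcases h3.2 with h4 | h4
        · exact h4.2.2.1 h
        · simp only [Finset.mem_union] at h1 h2; exact h4.1 ⟨h1, h2⟩
    · exact key u h1 v h2 huv
    · exact (key v h2 u h1 huv.symm).symm
    · apply hcol _ _ _ _ (Gp_ge hM huv)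
      · rintro rfl; rw [Finset.mem_union] at h1; tauto
      · rintro rfl; rw [Finset.mem_union] at h2; tauto

/-- all of X matched -/
theorem color_s0 {k : ℕ} {L : V → Finset ℕ} (hv : ValidC G c) (hP : PieceC G c X Y) (hM : MatchC G X Y σ)
    (hcl : ∀ s : Finset V, (∀ u ∈ s, ∀ v ∈ s, u ≠ v → G.Adj u v) → s.card ≤ k)
    (hL : ∀ v, (L v).card = k)
    (IH : ∀ w, ∃ col : V → ℕ, (∀ v, v ≠ w → col v ∈ L v) ∧
      ∀ u v, u ≠ w → v ≠ w → (Gp G X Y σ).Adj u v → col u ≠ col v)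
    (hs : ∀ x ∈ X, σ x ≠ x) : ListColorable G L := by
  obtain ⟨w, hw, -⟩ := hP.non
  obtain ⟨col, hcL, hcol⟩ := IH w
  have hX := CC_card hv hP hcl col
  have hY := CC_card hv hP.symm hcl col
  obtain ⟨d, hd1, hd2⟩ := e_lemma σ hM.inv X.card X Y
    (fun v => if v ∈ X then L v \ CC G X Y col else L v \ CC G Y X col) rfl
    (Finset.disjoint_left.2 (fun v h1 h2 => hP.disj v h1 h2)) (fun x hx => (hM.mX x hx (hs x hx)).1)
    (by
      intro x hx
      simp only [hx, if_true]
      have := Finset.le_card_sdiff (CC G X Y col) (L x)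
      rw [hL] at this; omega)
    (by
      intro x hx
      have hx' : x ∉ X := fun h => hP.disj x h hx
      simp only [hx', if_false]
      have := Finset.le_card_sdiff (CC G Y X col) (L x)
      rw [hL] at this; omega)
  refine extend hP (Or.inl hw) hM col d hcL hcol ?_ ?_ hd2
  · intro x hx
    have := hd1 x (Finset.mem_union_left _ hx)
    simpa [hx] using this
  · intro x hx
    have hx' : x ∉ X := fun h => hP.disj x h hx
    have := hd1 x (Finset.mem_union_right _ hx)
    simpa [hx'] using this

/-- choice of the removed vertex -/
theorem choose_w {k : ℕ} {L : V → Finset ℕ} (hv : ValidC G c) (hP : PieceC G c X Y) (hM : MatchC G X Y σ)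
    (hcl : ∀ s : Finset V, (∀ u ∈ s, ∀ v ∈ s, u ≠ v → G.Adj u v) → s.card ≤ k)
    (hL : ∀ v, (L v).card = k)
    (IH : ∀ w, ∃ col : V → ℕ, (∀ v, v ≠ w → col v ∈ L v) ∧
      ∀ u v, u ≠ w → v ≠ w → (Gp G X Y σ).Adj u v → col u ≠ col v)
    (x1 y1 ys : V) (hx1 : x1 ∈ X) (hy1 : y1 ∈ Y) (hys : ys ∈ Y) (hsy : σ ys = ys) (hs1 : σ x1 = y1) :
    ∃ w, (w ∈ X ∨ w ∈ Y) ∧ ∃ col : V → ℕ, (∀ v, v ≠ w → col v ∈ L v) ∧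
      (∀ u v, u ≠ w → v ≠ w → (Gp G X Y σ).Adj u v → col u ≠ col v) ∧
      ∀ (LL : V → Finset ℕ), (∀ x ∈ X, LL x = L x \ CC G X Y col) → (∀ y ∈ Y, LL y = L y \ CC G Y X col) →
      ∀ Q : Finset V, x1 ∉ Q → y1 ∉ Q → ys ∈ Q → (∀ v ∈ Q, v ∈ X ∨ v ∈ Y) → Q.card = Y.card →
      (∀ u ∈ Q, ∀ v ∈ Q, σ u = v → u = v) →
      Q.card + 1 ≤ (LL x1 ∪ Q.biUnion LL).card ∧ Q.card + 1 ≤ (LL y1 ∪ Q.biUnion LL).card := by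
  -- generic transversal bound
  have hs2 : σ y1 = x1 := by rw [← hs1, hM.inv]
  have trans : ∀ w, (w ∈ X ∨ w ∈ Y) → ∀ col : V → ℕ, (∀ v, v ≠ w → col v ∈ L v) →
      (∀ u v, u ≠ w → v ≠ w → (Gp G X Y σ).Adj u v → col u ≠ col v) →
      ∀ (LL : V → Finset ℕ), (∀ x ∈ X, LL x = L x \ CC G X Y col) → (∀ y ∈ Y, LL y = L y \ CC G Y X col) →
      ∀ Q : Finset V, w ∉ Q → (∀ v ∈ Q, v ∈ X ∨ v ∈ Y) → (∀ u ∈ Q, ∀ v ∈ Q, σ u = v → u = v) →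
      Q.card ≤ (Q.biUnion LL).card := by
    intro w hw col h1 h2 LL hLX hLY Q hwQ hQ hQσ
    apply Finset.card_le_card_of_injOn col
    · intro v hvQ
      rw [Finset.mem_coe, Finset.mem_biUnion]
      refine ⟨v, hvQ, ?_⟩
      have hvw : v ≠ w := by rintro rfl; exact hwQ hvQ
      rcases hQ v hvQ with h | h
      · rw [hLX v h, Finset.mem_sdiff]
        exact ⟨h1 v hvw, notMem_CC hP hw hM h hvw h2⟩
      · rw [hLY v h, Finset.mem_sdiff]
        refine ⟨h1 v hvw, notMem_CC hP.symm hw.symm hM.symm h hvw ?_⟩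
        rw [Gp_symm]; exact h2
    · intro u hu v hv' huv
      by_contra hne
      refine h2 u v (by rintro rfl; exact hwQ hu) (by rintro rfl; exact hwQ hv') ⟨hne, Or.inl ⟨hQ u hu, hQ v hv', ?_, ?_⟩⟩ huv
      · intro h; exact hne (hQσ u hu v hv' h)
      · intro h; exact hne (hQσ v hv' u hu h).symm
  have ins : ∀ z ∈ ({x1, y1} : Finset V), ∀ Q : Finset V, x1 ∉ Q → y1 ∉ Q →
      (∀ u ∈ Q, ∀ v ∈ Q, σ u = v → u = v) → ∀ u ∈ insert z Q, ∀ v ∈ insert z Q, σ u = v → u = v := by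
    intro z hz Q hx hy hQ u hu v hv' huv
    rw [Finset.mem_insert] at hu hv'
    have hzσ : σ z ∉ Q := by
      simp only [Finset.mem_insert, Finset.mem_singleton] at hz
      rcases hz with rfl | rfl
      · rwa [hs1]
      · rwa [hs2]
    rcases hu with rfl | hu <;> rcases hv' with rfl | hv'
    · rfl
    · exact absurd (huv ▸ hv') hzσ
    · exact absurd (by rw [← huv, hM.inv]; exact hu) hzσ
    · exact hQ u hu v hv' huv
  have hne1 : x1 ≠ y1 := fun h => hP.disj x1 hx1 (h ▸ hy1)
  by_cases hLL : L y1 = L ys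
  · obtain ⟨col, h1, h2⟩ := IH x1
    refine ⟨x1, Or.inl hx1, col, h1, h2, ?_⟩
    intro LL hLX hLY Q hx hy hysQ hQW hQc hQσ
    have h3 := trans x1 (Or.inl hx1) col h1 h2 LL hLX hLY (insert y1 Q) (by simp [hx, hne1])
      (by intro v hv'; rw [Finset.mem_insert] at hv'; rcases hv' with rfl | hv'; exact Or.inr hy1; exact hQW v hv')
      (ins y1 (by simp) Q hx hy hQσ)
    rw [Finset.card_insert_of_notMem hy, Finset.biUnion_insert] at h3
    refine ⟨?_, h3⟩
    have h4 : LL y1 ⊆ Q.biUnion LL := by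
      rw [hLY y1 hy1, hLL, ← hLY ys hys]
      exact Finset.subset_biUnion_of_mem LL hysQ
    rw [Finset.union_eq_right.2 h4] at h3
    exact h3.trans (Finset.card_le_card Finset.subset_union_right)
  · obtain ⟨col, h1, h2⟩ := IH y1
    refine ⟨y1, Or.inr hy1, col, h1, h2, ?_⟩
    intro LL hLX hLY Q hx hy hysQ hQW hQc hQσ
    have h3 := trans y1 (Or.inr hy1) col h1 h2 LL hLX hLY (insert x1 Q) (by simp [hy, hne1.symm])
      (by intro v hv'; rw [Finset.mem_insert] at hv'; rcases hv' with rfl | hv'; exact Or.inl hx1; exact hQW v hv')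
      (ins x1 (by simp) Q hx hy hQσ)
    rw [Finset.card_insert_of_notMem hx, Finset.biUnion_insert] at h3
    refine ⟨h3, ?_⟩
    by_contra hbad
    apply hLL
    have hCY := CC_card hv hP.symm hcl col
    refine lists_eq k Y.card (L y1) (L ys) (CC G Y X col) (LL y1 ∪ Q.biUnion LL) (hL _) (hL _) hCY ?_ ?_ (by omega)
    · rw [← hLY y1 hy1]; exact Finset.subset_union_left
    · rw [← hLY ys hys]; exact (Finset.subset_biUnion_of_mem LL hysQ).trans Finset.subset_union_right
end


section
variable {V : Type*} [Fintype V] [DecidableEq V] {G : SimpleGraph V} {c : Sym2 V → Bool} {X Y : Finset V} {σ : V → V}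

theorem LL_card {k : ℕ} {L : V → Finset ℕ} (hv : ValidC G c) (hP : PieceC G c X Y)
    (hcl : ∀ s : Finset V, (∀ u ∈ s, ∀ v ∈ s, u ≠ v → G.Adj u v) → s.card ≤ k)
    (hL : ∀ v, (L v).card = k) (col : V → ℕ) (x : V) : X.card ≤ (L x \ CC G X Y col).card := by
  have hX := CC_card hv hP hcl col
  have := Finset.le_card_sdiff (CC G X Y col) (L x)
  rw [hL] at this; omega

theorem color_m1 {k : ℕ} {L : V → Finset ℕ} (hv : ValidC G c) (hP : PieceC G c X Y) (hM : MatchC G X Y σ)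
    (hcl : ∀ s : Finset V, (∀ u ∈ s, ∀ v ∈ s, u ≠ v → G.Adj u v) → s.card ≤ k)
    (hL : ∀ v, (L v).card = k)
    (IH : ∀ w, ∃ col : V → ℕ, (∀ v, v ≠ w → col v ∈ L v) ∧
      ∀ u v, u ≠ w → v ≠ w → (Gp G X Y σ).Adj u v → col u ≠ col v)
    (x1 xs y1 : V) (Y0 : Finset V) (hX : X = {x1, xs}) (hY : Y = insert y1 Y0) (hx : x1 ≠ xs)
    (hy : y1 ∉ Y0) (hne : Y0.Nonempty) (hs1 : σ x1 = y1) (hss : σ xs = xs) (hsY : ∀ y ∈ Y0, σ y = y) :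
    ListColorable G L := by
  have hx1 : x1 ∈ X := by simp [hX]
  have hxs : xs ∈ X := by simp [hX]
  have hy1 : y1 ∈ Y := by simp [hY]
  have hY0 : ∀ y ∈ Y0, y ∈ Y := fun y h => by simp [hY, h]
  have hs2 : σ y1 = x1 := by rw [← hs1, hM.inv]
  have hXc : X.card = 2 := by rw [hX, Finset.card_pair hx]
  have hYc : Y.card = Y0.card + 1 := by rw [hY, Finset.card_insert_of_notMem hy]
  have dj : ∀ x ∈ X, ∀ y ∈ Y, x ≠ y := fun x hx y hy h => hP.disj x hx (h ▸ hy)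
  obtain ⟨ys, hys⟩ := hne
  obtain ⟨w, hw, col, h1, h2, h3⟩ := choose_w hv hP hM hcl hL IH x1 y1 ys hx1 hy1 (hY0 ys hys) (hsY ys hys) hs1
  set LL : V → Finset ℕ := fun v => if v ∈ X then L v \ CC G X Y col else L v \ CC G Y X col with hLL
  have hLX : ∀ x ∈ X, LL x = L x \ CC G X Y col := fun x hx => by simp [hLL, hx]
  have hLY : ∀ x ∈ Y, LL x = L x \ CC G Y X col := fun x hx => by
    have : x ∉ X := fun h => hP.disj x h hx
    simp [hLL, this]
  have hLXc : ∀ x ∈ X, 2 ≤ (LL x).card := fun x hx => by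
    rw [hLX x hx, ← hXc]; exact LL_card hv hP hcl hL col x
  have hLYc : ∀ x ∈ Y, Y0.card + 1 ≤ (LL x).card := fun x hx => by
    rw [hLY x hx, ← hYc]; exact LL_card hv hP.symm hcl hL col x
  have hxsY0 : xs ∉ Y0 := fun h => hP.disj xs hxs (hY0 xs h)
  have hx1Y0 : x1 ∉ Y0 := fun h => hP.disj x1 hx1 (hY0 x1 h)
  have hfix : ∀ v ∈ insert xs Y0, σ v = v := by
    intro v hv'
    rw [Finset.mem_insert] at hv'
    rcases hv' with rfl | hv'
    · exact hss
    · exact hsY v hv'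
  have hQ := h3 LL hLX hLY (insert xs Y0) (by simp [hx, hx1Y0]) (by simp [hy, (dj xs hxs y1 hy1).symm])
    (by simp [hys]) (by
      intro v hv'
      rw [Finset.mem_insert] at hv'
      rcases hv' with rfl | hv'
      · exact Or.inl hxs
      · exact Or.inr (hY0 v hv')) (by rw [Finset.card_insert_of_notMem hxsY0, hYc]) (by
      intro u hu v _ h
      rw [← h, hfix u hu])
  rw [Finset.card_insert_of_notMem hxsY0, Finset.biUnion_insert] at hQ
  obtain ⟨a, ha, b, hb, s, hs, f, hf1, hf2, has, hbs, hf3⟩ := key_one Y0 LL (LL x1) (LL y1) (LL xs) ⟨ys, hys⟩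
    (fun y hy => hLYc y (hY0 y hy)) (hLXc x1 hx1) (hLYc y1 hy1) (hLXc xs hxs) hQ.1 hQ.2
  set d : V → ℕ := fun v => if v = x1 then a else if v = y1 then b else if v = xs then s else f v with hd
  have d1 : d x1 = a := by simp [hd]
  have d2 : d y1 = b := by simp [hd, (dj x1 hx1 y1 hy1).symm]
  have d3 : d xs = s := by simp [hd, hx.symm, dj xs hxs y1 hy1]
  have d4 : ∀ y ∈ Y0, d y = f y := by
    intro y hy0
    have e1 : y ≠ x1 := by rintro rfl; exact hx1Y0 hy0
    have e2 : y ≠ xs := by rintro rfl; exact hxsY0 hy0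
    have e3 : y ≠ y1 := by rintro rfl; exact hy hy0
    simp [hd, e1, e2, e3]
  refine extend hP hw hM col d h1 h2 ?_ ?_ ?_
  · intro x hx'
    rw [← hLX x hx']
    simp only [hX, Finset.mem_insert, Finset.mem_singleton] at hx'
    rcases hx' with rfl | rfl
    · rwa [d1]
    · rwa [d3]
  · intro x hx'
    rw [← hLY x hx']
    simp only [hY, Finset.mem_insert] at hx'
    rcases hx' with rfl | hx'
    · rwa [d2]
    · rw [d4 x hx']; exact hf1 x hx'
  · intro u hu v hv' h
    have hW : ∀ v ∈ X ∪ Y, v = x1 ∨ v = xs ∨ v = y1 ∨ v ∈ Y0 := by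
      intro v hv'
      simp only [hX, hY, Finset.mem_union, Finset.mem_insert, Finset.mem_singleton] at hv'
      tauto
    rcases hW u hu with rfl | rfl | rfl | hu <;> rcases hW v hv' with rfl | rfl | rfl | hv'
    · left; rfl
    · rw [d1, d3] at h; exact absurd h has
    · right; exact hs1
    · rw [d1, d4 v hv'] at h; exact absurd h.symm (hf3 v hv').1
    · rw [d1, d3] at h; exact absurd h.symm has
    · left; rfl
    · rw [d2, d3] at h; exact absurd h.symm hbs
    · rw [d3, d4 v hv'] at h; exact absurd h.symm (hf3 v hv').2.2
    · right; exact hs2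
    · rw [d2, d3] at h; exact absurd h hbs
    · left; rfl
    · rw [d2, d4 v hv'] at h; exact absurd h.symm (hf3 v hv').2.1
    · rw [d1, d4 u hu] at h; exact absurd h (hf3 u hu).1
    · rw [d3, d4 u hu] at h; exact absurd h (hf3 u hu).2.2
    · rw [d2, d4 u hu] at h; exact absurd h (hf3 u hu).2.1
    · rw [d4 u hu, d4 v hv'] at h; left; exact hf2 u hu v hv' h

theorem six_aux {V : Type*} (d : V → ℕ) (σ : V → V) (x1 x2 xs y1 y2 ys : V) (a1 b1 a2 b2 s t : ℕ)
    (d1 : d x1 = a1) (d2 : d y1 = b1) (d3 : d x2 = a2) (d4 : d y2 = b2) (d5 : d xs = s) (d6 : d ys = t)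
    (hs1 : σ x1 = y1) (hs2 : σ x2 = y2) (hs1' : σ y1 = x1) (hs2' : σ y2 = x2)
    (n1 : s ≠ t) (n2 : a1 ≠ a2) (n3 : a1 ≠ b2) (n4 : b1 ≠ a2) (n5 : b1 ≠ b2) (n6 : a1 ≠ s) (n7 : b1 ≠ s)
    (n8 : a2 ≠ s) (n9 : b2 ≠ s) (n10 : a1 ≠ t) (n11 : b1 ≠ t) (n12 : a2 ≠ t) (n13 : b2 ≠ t)
    (u v : V) (hu : u = x1 ∨ u = x2 ∨ u = xs ∨ u = y1 ∨ u = y2 ∨ u = ys)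
    (hv : v = x1 ∨ v = x2 ∨ v = xs ∨ v = y1 ∨ v = y2 ∨ v = ys) (h : d u = d v) : u = v ∨ σ u = v := by
  subst d1 d2 d3 d4 d5 d6
  rcases hu with hu | hu | hu | hu | hu | hu <;> rw [hu] at h ⊢ <;> clear hu <;>
    rcases hv with hv | hv | hv | hv | hv | hv <;> rw [hv] at h ⊢ <;> clear hv <;>
    first
    | exact Or.inl rfl
    | exact Or.inr (by assumption)
    | exact absurd h (by assumption)
    | exact absurd h.symm (by assumption)

theorem color_m2 {k : ℕ} {L : V → Finset ℕ} (hv : ValidC G c) (hP : PieceC G c X Y) (hM : MatchC G X Y σ)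
    (hcl : ∀ s : Finset V, (∀ u ∈ s, ∀ v ∈ s, u ≠ v → G.Adj u v) → s.card ≤ k)
    (hL : ∀ v, (L v).card = k)
    (IH : ∀ w, ∃ col : V → ℕ, (∀ v, v ≠ w → col v ∈ L v) ∧
      ∀ u v, u ≠ w → v ≠ w → (Gp G X Y σ).Adj u v → col u ≠ col v)
    (x1 x2 xs y1 y2 ys : V) (hX : X = {x1, x2, xs}) (hY : Y = {y1, y2, ys})
    (hx12 : x1 ≠ x2) (hx1s : x1 ≠ xs) (hx2s : x2 ≠ xs) (hy12 : y1 ≠ y2) (hy1s : y1 ≠ ys) (hy2s : y2 ≠ ys)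
    (hs1 : σ x1 = y1) (hs2 : σ x2 = y2) (hsx : σ xs = xs) (hsy : σ ys = ys) :
    ListColorable G L := by
  have hx1 : x1 ∈ X := by simp [hX]
  have hx2 : x2 ∈ X := by simp [hX]
  have hxs : xs ∈ X := by simp [hX]
  have hy1 : y1 ∈ Y := by simp [hY]
  have hy2 : y2 ∈ Y := by simp [hY]
  have hys : ys ∈ Y := by simp [hY]
  have hs1' : σ y1 = x1 := by rw [← hs1, hM.inv]
  have hs2' : σ y2 = x2 := by rw [← hs2, hM.inv]
  have hXc : X.card = 3 := by rw [hX]; exact Finset.card_eq_three.2 ⟨_, _, _, hx12, hx1s, hx2s, rfl⟩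
  have hYc : Y.card = 3 := by rw [hY]; exact Finset.card_eq_three.2 ⟨_, _, _, hy12, hy1s, hy2s, rfl⟩
  have dj : ∀ x ∈ X, ∀ y ∈ Y, x ≠ y := fun x hx y hy h => hP.disj x hx (h ▸ hy)
  have e11 := dj x1 hx1 y1 hy1
  have e12 := dj x1 hx1 y2 hy2
  have e1s := dj x1 hx1 ys hys
  have e21 := dj x2 hx2 y1 hy1
  have e22 := dj x2 hx2 y2 hy2
  have e2s := dj x2 hx2 ys hys
  have es1 := dj xs hxs y1 hy1
  have es2 := dj xs hxs y2 hy2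
  have ess := dj xs hxs ys hys
  obtain ⟨w, hw, col, h1, h2, h3⟩ := choose_w hv hP hM hcl hL IH x1 y1 ys hx1 hy1 hys hsy hs1
  set LL : V → Finset ℕ := fun v => if v ∈ X then L v \ CC G X Y col else L v \ CC G Y X col with hLL
  have hLX : ∀ x ∈ X, LL x = L x \ CC G X Y col := fun x hx => by simp [hLL, hx]
  have hLY : ∀ x ∈ Y, LL x = L x \ CC G Y X col := fun x hx => by
    have : x ∉ X := fun h => hP.disj x h hx
    simp [hLL, this]
  have hLXc : ∀ x ∈ X, 3 ≤ (LL x).card := fun x hx => by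
    rw [hLX x hx, ← hXc]; exact LL_card hv hP hcl hL col x
  have hLYc : ∀ x ∈ Y, 3 ≤ (LL x).card := fun x hx => by
    rw [hLY x hx, ← hYc]; exact LL_card hv hP.symm hcl hL col x
  have hQ1 := h3 LL hLX hLY {x2, xs, ys} (by simp [hx12, hx1s, e1s]) (by simp [e21.symm, es1.symm, hy1s])
    (by simp) (by
      intro v hv'
      simp only [Finset.mem_insert, Finset.mem_singleton] at hv'
      rcases hv' with rfl | rfl | rfl <;> first | exact Or.inl (by assumption) | exact Or.inr (by assumption)) (by rw [hYc]; exact Finset.card_eq_three.2 ⟨_, _, _, hx2s, e2s, ess, rfl⟩) (by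
      intro u hu v hv' h
      simp only [Finset.mem_insert, Finset.mem_singleton] at hu hv'
      rcases hu with rfl | rfl | rfl
      · rw [hs2] at h; subst h; exfalso; rcases hv' with h | h | h
        · exact e22 h.symm
        · exact es2 h.symm
        · exact hy2s h
      · rw [← h, hsx]
      · rw [← h, hsy])
  have hQ2 := h3 LL hLX hLY {y2, xs, ys} (by simp [e12, hx1s, e1s]) (by simp [hy12, es1.symm, hy1s])
    (by simp) (by
      intro v hv'
      simp only [Finset.mem_insert, Finset.mem_singleton] at hv'
      rcases hv' with rfl | rfl | rfl <;> first | exact Or.inl (by assumption) | exact Or.inr (by assumption)) (by rw [hYc]; exact Finset.card_eq_three.2 ⟨_, _, _, es2.symm, hy2s, ess, rfl⟩) (by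
      intro u hu v hv' h
      simp only [Finset.mem_insert, Finset.mem_singleton] at hu hv'
      rcases hu with rfl | rfl | rfl
      · rw [hs2'] at h; subst h; exfalso; rcases hv' with h | h | h
        · exact e22 h
        · exact hx2s h
        · exact e2s h
      · rw [← h, hsx]
      · rw [← h, hsy])
  rw [Finset.card_eq_three.2 ⟨_, _, _, hx2s, e2s, ess, rfl⟩] at hQ1
  rw [Finset.card_eq_three.2 ⟨_, _, _, es2.symm, hy2s, ess, rfl⟩] at hQ2
  simp only [Finset.biUnion_insert, Finset.singleton_biUnion, ← Finset.union_assoc] at hQ1 hQ2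
  obtain ⟨a1, ha1, b1, hb1, a2, ha2, b2, hb2, s, hs, t, ht, H⟩ := key_two (LL x1) (LL y1) (LL x2) (LL y2) (LL xs) (LL ys)
    (hLXc _ hx1) (hLYc _ hy1) (hLXc _ hx2) (hLYc _ hy2) (hLXc _ hxs) (hLYc _ hys) hQ1.1 hQ2.1 hQ1.2 hQ2.2
  obtain ⟨n1, n2, n3, n4, n5, n6, n7, n8, n9, n10, n11, n12, n13⟩ := H
  set d : V → ℕ := fun v => if v = x1 then a1 else if v = y1 then b1 else if v = x2 then a2 else if v = y2 then b2
    else if v = xs then s else t with hd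
  have d1 : d x1 = a1 := by simp [hd]
  have d2 : d y1 = b1 := by simp [hd, e11.symm]
  have d3 : d x2 = a2 := by simp [hd, hx12.symm, e21]
  have d4 : d y2 = b2 := by simp [hd, e12.symm, hy12.symm, e22.symm]
  have d5 : d xs = s := by simp [hd, hx1s.symm, es1, hx2s.symm, es2]
  have d6 : d ys = t := by simp [hd, e1s.symm, hy1s.symm, e2s.symm, hy2s.symm, ess.symm]
  clear_value d
  refine extend hP hw hM col d h1 h2 ?_ ?_ ?_
  · intro x hx'
    rw [← hLX x hx']
    simp only [hX, Finset.mem_insert, Finset.mem_singleton] at hx'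
    rcases hx' with rfl | rfl | rfl
    · rwa [d1]
    · rwa [d3]
    · rwa [d5]
  · intro x hx'
    rw [← hLY x hx']
    simp only [hY, Finset.mem_insert, Finset.mem_singleton] at hx'
    rcases hx' with rfl | rfl | rfl
    · rwa [d2]
    · rwa [d4]
    · rwa [d6]
  · intro u hu v hv' h
    have hW : ∀ v ∈ X ∪ Y, v = x1 ∨ v = x2 ∨ v = xs ∨ v = y1 ∨ v = y2 ∨ v = ys := by
      intro v hv'
      simp only [hX, hY, Finset.mem_union, Finset.mem_insert, Finset.mem_singleton, or_assoc] at hv'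
      exact hv'
    have hu := hW u hu
    have hv' := hW v hv'
    exact six_aux d σ x1 x2 xs y1 y2 ys a1 b1 a2 b2 s t d1 d2 d3 d4 d5 d6 hs1 hs2 hs1' hs2' n1 n2 n3 n4 n5
      n6 n7 n8 n9 n10 n11 n12 n13 u v hu hv' h

theorem color_s1 {k : ℕ} {L : V → Finset ℕ} (hk4 : k ≤ 4) (hv : ValidC G c) (hP : PieceC G c X Y) (hM : MatchC G X Y σ)
    (hcl : ∀ s : Finset V, (∀ u ∈ s, ∀ v ∈ s, u ≠ v → G.Adj u v) → s.card ≤ k)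
    (hL : ∀ v, (L v).card = k)
    (hk : X.card + Y.card ≤ k + (X.filter (fun x => σ x ≠ x)).card)
    (hm : 1 ≤ (X.filter (fun x => σ x ≠ x)).card)
    (IH : ∀ w, ∃ col : V → ℕ, (∀ v, v ≠ w → col v ∈ L v) ∧
      ∀ u v, u ≠ w → v ≠ w → (Gp G X Y σ).Adj u v → col u ≠ col v)
    (hs : (X.filter (fun x => σ x = x)).card = 1) (ht : 1 ≤ (Y.filter (fun x => σ x = x)).card) :
    ListColorable G L := by
  have hmc := match_card hM
  have h3 := Finset.card_filter_add_card_filter_not (s := X) (fun x => σ x = x)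
  have h4 := Finset.card_filter_add_card_filter_not (s := Y) (fun x => σ x = x)
  simp only [ne_eq] at hk hm hmc
  obtain ⟨xs, hxs⟩ := Finset.card_eq_one.1 hs
  have hxs' : xs ∈ X ∧ σ xs = xs := by
    have : xs ∈ X.filter (fun x => σ x = x) := by rw [hxs]; simp
    simpa using this
  have hm2 : (X.filter (fun x => ¬ σ x = x)).card = 1 ∨
    ((X.filter (fun x => ¬ σ x = x)).card = 2 ∧ (Y.filter (fun x => σ x = x)).card = 1) := by omega
  rcases hm2 with hm1 | ⟨hm2, ht1⟩
  · obtain ⟨x1, hx1⟩ := Finset.card_eq_one.1 hm1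
    rw [hm1] at hmc
    obtain ⟨y1, hy1⟩ := Finset.card_eq_one.1 hmc
    have hx1' : x1 ∈ X ∧ ¬ σ x1 = x1 := by
      have : x1 ∈ X.filter (fun x => ¬ σ x = x) := by rw [hx1]; simp
      simpa using this
    have hmap := hM.mX x1 hx1'.1 hx1'.2
    have hs1 : σ x1 = y1 := by
      have : σ x1 ∈ Y.filter (fun x => ¬ σ x = x) := by
        rw [Finset.mem_filter]
        exact ⟨hmap.1, fun h => hx1'.2 (by rw [hM.inv] at h; exact h.symm)⟩
      rw [hy1] at this; simpa using this
    refine color_m1 hv hP hM hcl hL IH x1 xs y1 (Y.filter (fun x => σ x = x)) ?_ ?_ ?_ ?_ ?_ hs1 hxs'.2 ?_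
    · rw [← Finset.filter_union_filter_not_eq (fun x => σ x = x) X, hxs, hx1]
      ext v; simp [or_comm]
    · conv_lhs => rw [← Finset.filter_union_filter_not_eq (fun x => σ x = x) Y, hy1]
      ext v; simp [or_comm]
    · rintro rfl; exact hx1'.2 hxs'.2
    · rw [Finset.mem_filter]
      rintro ⟨_, h⟩
      rw [← hs1, hM.inv] at h
      exact hx1'.2 h.symm
    · exact Finset.card_pos.1 (by omega)
    · intro y hy; exact (Finset.mem_filter.1 hy).2
  · obtain ⟨x1, x2, hx12, hx⟩ := Finset.card_eq_two.1 hm2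
    obtain ⟨ys, hys⟩ := Finset.card_eq_one.1 ht1
    have hys' : ys ∈ Y ∧ σ ys = ys := by
      have : ys ∈ Y.filter (fun x => σ x = x) := by rw [hys]; simp
      simpa using this
    have hx1' : x1 ∈ X ∧ ¬ σ x1 = x1 := by
      have : x1 ∈ X.filter (fun x => ¬ σ x = x) := by rw [hx]; simp
      simpa using this
    have hx2' : x2 ∈ X ∧ ¬ σ x2 = x2 := by
      have : x2 ∈ X.filter (fun x => ¬ σ x = x) := by rw [hx]; simp
      simpa using this
    have hmap1 := hM.mX x1 hx1'.1 hx1'.2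
    have hmap2 := hM.mX x2 hx2'.1 hx2'.2
    have e1 : ¬ σ (σ x1) = σ x1 := fun h => hx1'.2 (by rw [hM.inv] at h; exact h.symm)
    have e2 : ¬ σ (σ x2) = σ x2 := fun h => hx2'.2 (by rw [hM.inv] at h; exact h.symm)
    have hne : σ x1 ≠ σ x2 := fun h => hx12 (by rw [← hM.inv x1, h, hM.inv])
    have hYf : {σ x1, σ x2} = Y.filter (fun x => ¬ σ x = x) := by
      apply Finset.eq_of_subset_of_card_le
      · intro v hv'
        simp only [Finset.mem_insert, Finset.mem_singleton] at hv'
        rw [Finset.mem_filter]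
        rcases hv' with rfl | rfl
        · exact ⟨hmap1.1, e1⟩
        · exact ⟨hmap2.1, e2⟩
      · rw [Finset.card_pair hne]; omega
    refine color_m2 hv hP hM hcl hL IH x1 x2 xs (σ x1) (σ x2) ys ?_ ?_ hx12 ?_ ?_ hne ?_ ?_ rfl rfl hxs'.2 hys'.2
    · rw [← Finset.filter_union_filter_not_eq (fun x => σ x = x) X, hxs, hx]
      ext v; simp; tauto
    · rw [← Finset.filter_union_filter_not_eq (fun x => σ x = x) Y, hys, ← hYf]
      ext v; simp; tauto
    · rintro rfl; exact hx1'.2 hxs'.2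
    · rintro rfl; exact hx2'.2 hxs'.2
    · intro h; rw [h] at e1; exact e1 hys'.2
    · intro h; rw [h] at e2; exact e2 hys'.2

theorem color_all {k : ℕ} {L : V → Finset ℕ} (hk4 : k ≤ 4) (hv : ValidC G c) (hP : PieceC G c X Y) (hM : MatchC G X Y σ)
    (hcl : ∀ s : Finset V, (∀ u ∈ s, ∀ v ∈ s, u ≠ v → G.Adj u v) → s.card ≤ k)
    (hL : ∀ v, (L v).card = k)
    (hk : X.card + Y.card ≤ k + (X.filter (fun x => σ x ≠ x)).card)
    (hm : 1 ≤ (X.filter (fun x => σ x ≠ x)).card)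
    (IH : ∀ w, ∃ col : V → ℕ, (∀ v, v ≠ w → col v ∈ L v) ∧
      ∀ u v, u ≠ w → v ≠ w → (Gp G X Y σ).Adj u v → col u ≠ col v) : ListColorable G L := by
  have IH' : ∀ w, ∃ col : V → ℕ, (∀ v, v ≠ w → col v ∈ L v) ∧
      ∀ u v, u ≠ w → v ≠ w → (Gp G Y X σ).Adj u v → col u ≠ col v := by rwa [Gp_symm]
  by_cases hs0 : (X.filter (fun x => σ x = x)).card = 0
  · apply color_s0 hv hP hM hcl hL IH
    intro x hx h
    rw [Finset.card_eq_zero] at hs0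
    have : x ∈ X.filter (fun x => σ x = x) := by simp [hx, h]
    rw [hs0] at this; simp at this
  by_cases ht0 : (Y.filter (fun x => σ x = x)).card = 0
  · apply color_s0 hv hP.symm hM.symm hcl hL IH'
    intro x hx h
    rw [Finset.card_eq_zero] at ht0
    have : x ∈ Y.filter (fun x => σ x = x) := by simp [hx, h]
    rw [ht0] at this; simp at this
  by_cases hs1 : (X.filter (fun x => σ x = x)).card = 1
  · exact color_s1 hk4 hv hP hM hcl hL hk hm IH hs1 (by omega)
  have hmc := match_card hM
  have h3 := Finset.card_filter_add_card_filter_not (s := X) (fun x => σ x = x)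
  have h4 := Finset.card_filter_add_card_filter_not (s := Y) (fun x => σ x = x)
  simp only [ne_eq] at hk hm hmc
  refine color_s1 hk4 hv hP.symm hM.symm hcl hL ?_ ?_ IH' ?_ ?_
  · simp only [ne_eq]; omega
  · simp only [ne_eq]; omega
  · omega
  · omega
end


theorem exists_sigma {V : Type*} [DecidableEq V] (G : SimpleGraph V) (X Y Y0 : Finset V) (τ : V → V)
    (hd : ∀ v, v ∈ X → v ∈ Y → False) (hY0 : Y0 ⊆ Y) (hτ : ∀ y ∈ Y0, τ y ∈ X ∧ ¬ G.Adj (τ y) y)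
    (hinj : ∀ y ∈ Y0, ∀ y' ∈ Y0, τ y = τ y' → y = y') :
    ∃ σ, MatchC G X Y σ ∧ (X.filter (fun x => σ x ≠ x)).card = Y0.card := by
  classical
  set σ : V → V := fun v => if v ∈ Y0 then τ v else if h : ∃ y ∈ Y0, τ y = v then h.choose else v with hσ
  have s1 : ∀ y ∈ Y0, σ y = τ y := fun y hy => by simp [hσ, hy]
  have nX : ∀ y ∈ Y0, y ∉ X := fun y hy h => hd y h (hY0 hy)
  have s2 : ∀ y ∈ Y0, σ (τ y) = y := by
    intro y hy
    have h1 : τ y ∉ Y0 := fun h => nX _ h (hτ y hy).1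
    have h2 : ∃ y' ∈ Y0, τ y' = τ y := ⟨y, hy, rfl⟩
    have h3 : σ (τ y) = h2.choose := by simp only [hσ, if_neg h1, dif_pos h2]
    rw [h3]
    exact hinj _ h2.choose_spec.1 _ hy h2.choose_spec.2
  have s3 : ∀ v, v ∉ Y0 → (∀ y ∈ Y0, τ y ≠ v) → σ v = v := by
    intro v h1 h2
    have h3 : ¬ ∃ y ∈ Y0, τ y = v := by push Not; exact h2
    simp only [hσ, if_neg h1, dif_neg h3]
  clear_value σ
  have cases3 : ∀ v, v ∈ Y0 ∨ (∃ y ∈ Y0, τ y = v) ∨ σ v = v := by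
    intro v
    by_cases h1 : v ∈ Y0
    · exact Or.inl h1
    by_cases h2 : ∃ y ∈ Y0, τ y = v
    · exact Or.inr (Or.inl h2)
    · push Not at h2; exact Or.inr (Or.inr (s3 v h1 h2))
  refine ⟨σ, ⟨?_, ?_, ?_⟩, ?_⟩
  · intro v
    rcases cases3 v with h | ⟨y, hy, rfl⟩ | h
    · rw [s1 v h, s2 v h]
    · rw [s2 y hy, s1 y hy]
    · rw [h, h]
  · intro x hx hne
    rcases cases3 x with h | ⟨y, hy, rfl⟩ | h
    · exact absurd hx (nX x h)
    · rw [s2 y hy]; exact ⟨hY0 hy, (hτ y hy).2⟩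
    · exact absurd h hne
  · intro x hx hne
    rcases cases3 x with h | ⟨y, hy, rfl⟩ | h
    · rw [s1 x h]; exact ⟨(hτ x h).1, fun h' => (hτ x h).2 h'.symm⟩
    · exact (hd _ (hτ y hy).1 hx).elim
    · exact absurd h hne
  · have : X.filter (fun x => σ x ≠ x) = Y0.image τ := by
      ext v
      simp only [Finset.mem_filter, Finset.mem_image]
      constructor
      · rintro ⟨hv, hne⟩
        rcases cases3 v with h | h | h
        · exact absurd hv (nX v h)
        · exact h
        · exact absurd h hne
      · rintro ⟨y, hy, rfl⟩
        refine ⟨(hτ y hy).1, ?_⟩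
        rw [s2 y hy]
        rintro h
        exact nX y hy (h ▸ (hτ y hy).1)
    rw [this, Finset.card_image_of_injOn]
    intro a ha b hb h
    exact hinj a ha b hb h

theorem exists_match {V : Type*} [DecidableEq V] {G : SimpleGraph V} {c : Sym2 V → Bool} {X Y : Finset V} {k : ℕ}
    (hP : PieceC G c X Y)
    (hcl : ∀ s : Finset V, (∀ u ∈ s, ∀ v ∈ s, u ≠ v → G.Adj u v) → s.card ≤ k) :
    ∃ σ, MatchC G X Y σ ∧ X.card + Y.card ≤ k + (X.filter (fun x => σ x ≠ x)).card ∧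
      1 ≤ (X.filter (fun x => σ x ≠ x)).card := by
  classical
  have hpk : X.card ≤ k := hcl X hP.cX
  set N : V → Finset V := fun y => X.filter (fun x => ¬ G.Adj x y) with hN
  set F : {y // y ∈ Y} → Finset (V ⊕ Fin (k - X.card)) := fun y => (N y.1).disjSum Finset.univ with hF
  obtain ⟨h, hinj, hmem⟩ := (Finset.all_card_le_biUnion_card_iff_exists_injective F).1 (by
    intro S
    rcases S.eq_empty_or_nonempty with rfl | hS
    · simp
    have hsub : (S.biUnion fun y => N y.1).disjSum Finset.univ ⊆ S.biUnion F := by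
      intro z hz
      obtain ⟨y0, hy0⟩ := hS
      rw [Finset.mem_biUnion]
      rcases z with x | i
      · rw [Finset.inl_mem_disjSum, Finset.mem_biUnion] at hz
        obtain ⟨y, hy, hx⟩ := hz
        exact ⟨y, hy, by simp only [hF, Finset.inl_mem_disjSum]; exact hx⟩
      · exact ⟨y0, hy0, by simp [hF]⟩
    have h1 := Finset.card_le_card hsub
    rw [Finset.card_disjSum, Finset.card_univ, Fintype.card_fin] at h1
    set NS := S.biUnion fun y => N y.1 with hNS
    have hNX : NS ⊆ X := by
      intro v hv
      rw [hNS, Finset.mem_biUnion] at hv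
      obtain ⟨y, _, h⟩ := hv
      exact (Finset.mem_filter.1 h).1
    have h2 : ((X \ NS) ∪ S.image Subtype.val).card ≤ k := by
      apply hcl
      have key : ∀ u ∈ X \ NS, ∀ v ∈ S.image Subtype.val, G.Adj u v := by
        intro u hu v hv
        rw [Finset.mem_image] at hv
        obtain ⟨y, hy, rfl⟩ := hv
        by_contra hn
        rw [Finset.mem_sdiff] at hu
        apply hu.2
        rw [hNS, Finset.mem_biUnion]
        exact ⟨y, hy, by simp only [hN, Finset.mem_filter]; exact ⟨hu.1, hn⟩⟩
      intro u hu v hv huv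
      rw [Finset.mem_union] at hu hv
      rcases hu with hu | hu <;> rcases hv with hv | hv
      · exact hP.cX u (Finset.mem_sdiff.1 hu).1 v (Finset.mem_sdiff.1 hv).1 huv
      · exact key u hu v hv
      · exact (key v hv u hu).symm
      · rw [Finset.mem_image] at hu hv
        obtain ⟨a, _, rfl⟩ := hu
        obtain ⟨b, _, rfl⟩ := hv
        exact hP.cY _ a.2 _ b.2 huv
    rw [Finset.card_union_of_disjoint, Finset.card_image_of_injective _ Subtype.val_injective,
      Finset.card_sdiff_of_subset hNX] at h2
    · have := Finset.card_le_card hNX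
      omega
    · rw [Finset.disjoint_left]
      intro v hv hv'
      rw [Finset.mem_image] at hv'
      obtain ⟨a, _, rfl⟩ := hv'
      exact hP.disj _ (Finset.mem_sdiff.1 hv).1 a.2)
  obtain ⟨x1, hx1, y1, hy1, hnon⟩ := hP.non
  set Y0 : Finset V := Y.filter (fun y => ∃ hy : y ∈ Y, ∃ x, h ⟨y, hy⟩ = Sum.inl x) with hY0
  set τ : V → V := fun y => if hy : y ∈ Y then (h ⟨y, hy⟩).elim id (fun _ => y) else y with hτ
  have hτ1 : ∀ y ∈ Y0, ∃ hy : y ∈ Y, h ⟨y, hy⟩ = Sum.inl (τ y) := by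
    intro y hy
    rw [hY0, Finset.mem_filter] at hy
    obtain ⟨_, hy, x, hx⟩ := hy
    refine ⟨hy, ?_⟩
    simp only [hτ, dif_pos hy, hx, Sum.elim_inl, id]
  have hY0c : Y.card ≤ Y0.card + (k - X.card) := by
    have h1 := Finset.card_filter_add_card_filter_not (s := Y) (fun y => ∃ hy : y ∈ Y, ∃ x, h ⟨y, hy⟩ = Sum.inl x)
    have h2 : (Y.filter (fun y => ¬ ∃ hy : y ∈ Y, ∃ x, h ⟨y, hy⟩ = Sum.inl x)).card ≤
        (Finset.univ.image (Sum.inr : Fin (k - X.card) → V ⊕ Fin (k - X.card))).card := by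
      apply Finset.card_le_card_of_injOn (fun y => if hy : y ∈ Y then h ⟨y, hy⟩ else Sum.inl y)
      · intro y hy
        rw [Finset.mem_coe, Finset.mem_filter] at hy
        obtain ⟨hy, hn⟩ := hy
        push Not at hn
        simp only [dif_pos hy, Finset.mem_coe, Finset.mem_image, Finset.mem_univ, true_and]
        rcases hh : h ⟨y, hy⟩ with x | i
        · exact absurd hh (hn hy x)
        · exact ⟨i, rfl⟩
      · intro y hy y' hy' heq
        rw [Finset.mem_coe, Finset.mem_filter] at hy hy'
        simp only [dif_pos hy.1, dif_pos hy'.1] at heq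
        simpa using hinj heq
    have h3 : (Finset.univ.image (Sum.inr : Fin (k - X.card) → V ⊕ Fin (k - X.card))).card ≤ k - X.card := by
      refine Finset.card_image_le.trans ?_
      simp
    have h4 : Y0.card + (Y.filter (fun y => ¬ ∃ hy : y ∈ Y, ∃ x, h ⟨y, hy⟩ = Sum.inl x)).card = Y.card := by
      convert h1
    omega
  by_cases h0 : Y0.card = 0
  · obtain ⟨σ, hσ, hc⟩ := exists_sigma G X Y {y1} (fun _ => x1) hP.disj (by simpa using hy1)
      (by intro y hy; rw [Finset.mem_singleton] at hy; subst hy; exact ⟨hx1, hnon⟩)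
      (by intro y hy y' hy' _; rw [Finset.mem_singleton] at hy hy'; rw [hy, hy'])
    rw [Finset.card_singleton] at hc
    exact ⟨σ, hσ, by omega, by omega⟩
  · obtain ⟨σ, hσ, hc⟩ := exists_sigma G X Y Y0 τ hP.disj (Finset.filter_subset _ _)
      (by
        intro y hy
        obtain ⟨hyY, h1⟩ := hτ1 y hy
        have := hmem ⟨y, hyY⟩
        rw [h1] at this
        simp only [hF, Finset.inl_mem_disjSum, hN, Finset.mem_filter] at this
        exact this)
      (by
        intro y hy y' hy' heq
        obtain ⟨hyY, h1⟩ := hτ1 y hy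
        obtain ⟨hyY', h1'⟩ := hτ1 y' hy'
        rw [heq, ← h1'] at h1
        simpa using hinj h1)
    exact ⟨σ, hσ, by omega, by omega⟩

theorem piece_color {V : Type u} [Fintype V] {G : SimpleGraph V} {c : Sym2 V → Bool} {X Y : Finset V} {k : ℕ}
    (hk4 : k ≤ 4) (hv : ValidC G c) (hP : PieceC G c X Y)
    (hcl : ∀ s : Finset V, (∀ u ∈ s, ∀ v ∈ s, u ≠ v → G.Adj u v) → s.card ≤ k)
    (L : V → Finset ℕ) (hL : ∀ v, (L v).card = k)
    (IH : ∀ (V' : Type u) [Fintype V'] (G' : SimpleGraph V') (c' : Sym2 V' → Bool),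
      Fintype.card V' < Fintype.card V → ValidC G' c' →
      (∀ s : Finset V', (∀ u ∈ s, ∀ v ∈ s, u ≠ v → G'.Adj u v) → s.card ≤ k) →
      ∀ L' : V' → Finset ℕ, (∀ v, (L' v).card = k) → ListColorable G' L') : ListColorable G L := by
  classical
  obtain ⟨σ, hM, hk, hm⟩ := exists_match hP hcl
  refine color_all hk4 hv hP hM hcl hL hk hm ?_
  intro w
  obtain ⟨col, h1, h2⟩ := IH {v // v ≠ w} ((Gp G X Y σ).comap Subtype.val) (fun e => cp c X Y (e.map Subtype.val))
    (Fintype.card_subtype_lt (x := w) (by simp))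
    (by
      intro u v w' h1 h2 hne hn
      exact Gp_valid hv hP hM u.1 v.1 w'.1 h1 h2 (fun h => hne (Subtype.ext h)) hn)
    (by
      intro s hs
      rw [← Finset.card_image_of_injective s Subtype.val_injective]
      apply Gp_clique hv hP hM hcl hk
      intro u hu v hv' huv
      rw [Finset.mem_image] at hu hv'
      obtain ⟨a, ha, rfl⟩ := hu
      obtain ⟨b, hb, rfl⟩ := hv'
      exact hs a ha b hb (fun h => huv (h ▸ rfl)))
    (fun v => L v.1) (fun v => hL v.1)
  refine ⟨fun v => if h : v ≠ w then col ⟨v, h⟩ else 0, ?_, ?_⟩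
  · intro v hvw
    simp only [dif_pos hvw]
    exact h1 ⟨v, hvw⟩
  · intro u v hu hv' h
    simp only [dif_pos hu, dif_pos hv']
    exact h2 (u := ⟨u, hu⟩) (w := ⟨v, hv'⟩) h


/-- abstract two-coloured graph relation facts -/
structure TC {V : Type u} (R B : V → V → Prop) : Prop where
  rs : ∀ {x y}, R x y → R y x
  bs : ∀ {x y}, B x y → B y x
  rb : ∀ {x y}, R x y → B x y → False
  ri : ∀ {x}, R x x → False
  bi : ∀ {x}, B x x → False
  rt : ∀ {x y z}, R x y → R y z → x = z ∨ R x z ∨ B x z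
  bt : ∀ {x y z}, B x y → B y z → x = z ∨ R x z ∨ B x z
  k5 : ∀ {a b c d e}, (R a b ∨ B a b) → (R a c ∨ B a c) → (R a d ∨ B a d) → (R a e ∨ B a e) →
    (R b c ∨ B b c) → (R b d ∨ B b d) → (R b e ∨ B b e) → (R c d ∨ B c d) → (R c e ∨ B c e) →
    (R d e ∨ B d e) → False

section
variable {V : Type u} {R B : V → V → Prop}

theorem caseI (h : TC R B) {u a b v z : V} (ub : B u b) (ab : B a b) (ua : B u a) (bv : B b v)
    (uv : R u v) (av : R a v) (zu : R z u ∨ B z u) (za : z ≠ a) (nR : ¬ R z a) (nB : ¬ B z a) :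
    (∀ x t, (x = v ∨ R v x ∨ x = b ∨ R b x) → (R x t ∨ B x t) → (t = v ∨ R v t ∨ t = b ∨ R b t)) ∧
    R b z ∧ z ≠ v ∧ ¬ R v z := by
  have uz : R z u := by
    rcases zu with zu | zu
    · exact zu
    · have := h.bt zu ua; grind
  have zv' : z ≠ v := by rintro rfl; exact nR (h.rs av)
  have zv : B z v := by
    rcases h.rt uz uv with h1 | h1 | h1
    · exact absurd h1 zv'
    · have := h.rt h1 (h.rs av); grind
    · exact h1
  have bz : R z b := by
    rcases h.bt zv (h.bs bv) with h1 | h1 | h1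
    · subst h1; exact absurd (h.bs ab) nB
    · exact h1
    · have := h.bt h1 (h.bs ab); grind
  have Bb : ∀ t, B t b → t = u ∨ t = a ∨ t = v := by
    intro t tb
    by_contra hc
    have h1 := h.bt tb (h.bs ub)
    have h2 := h.bt tb (h.bs ab)
    have h3 := h.bt tb bv
    have e1 : R t u ∨ B t u := by grind
    have e2 : R t a ∨ B t a := by grind
    have e3 : R t v ∨ B t v := by grind
    exact h.k5 e1 e2 (Or.inr tb) e3 (Or.inr ua) (Or.inr ub) (Or.inl uv) (Or.inr ab) (Or.inl av) (Or.inr bv)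
  have hS : ∀ t, R v t → (t = v ∨ R v t ∨ t = b ∨ R b t) := fun t ht => Or.inr (Or.inl ht)
  have hB : ∀ t, R t b ∨ B t b → (t = v ∨ R v t ∨ t = b ∨ R b t) := by
    intro t ht
    rcases ht with ht | ht
    · exact Or.inr (Or.inr (Or.inr (h.rs ht)))
    · rcases Bb t ht with rfl | rfl | rfl
      · exact hS _ (h.rs uv)
      · exact hS _ (h.rs av)
      · exact Or.inl rfl
  have hB' : ∀ t, (t = b ∨ R t b ∨ B t b) → (t = v ∨ R v t ∨ t = b ∨ R b t) := by
    intro t ht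
    rcases ht with ht | ht
    · exact Or.inr (Or.inr (Or.inl ht))
    · exact hB t ht
  have hA' : ∀ t, (t = v ∨ R t v ∨ B t v) → (t = v ∨ R v t ∨ t = b ∨ R b t) := by
    intro t ht
    rcases ht with ht | ht | ht
    · exact Or.inl ht
    · exact hS t (h.rs ht)
    · exact hB' t (h.bt ht (h.bs bv))
  have hU' : ∀ w, R w v → B w b → ∀ t, (t = w ∨ R t w ∨ B t w) → (t = v ∨ R v t ∨ t = b ∨ R b t) := by
    intro w w1 w2 t ht
    rcases ht with rfl | ht | ht
    · exact hS _ (h.rs w1)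
    · exact hA' t (h.rt ht w1)
    · exact hB' t (h.bt ht w2)
  have hZ' : ∀ t, (t = z ∨ R t z ∨ B t z) → (t = v ∨ R v t ∨ t = b ∨ R b t) := by
    intro t ht
    rcases ht with rfl | ht | ht
    · exact hB _ (Or.inl bz)
    · exact hB' t (h.rt ht bz)
    · exact hA' t (h.bt ht zv)
  refine ⟨?_, h.rs bz, zv', fun h1 => h.rb (h.rs h1) zv⟩
  intro x t hx hxt
  have htx : R t x ∨ B t x := by
    rcases hxt with h1 | h1
    · exact Or.inl (h.rs h1)
    · exact Or.inr (h.bs h1)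
  rcases hx with rfl | hx | rfl | hx
  · exact hA' t (Or.inr htx)
  · -- x red to v
    by_cases xu : x = u
    · subst xu; exact hU' x uv ub t (Or.inr htx)
    by_cases xa : x = a
    · subst xa; exact hU' x av ab t (Or.inr htx)
    have e1 : R x u ∨ B x u := by
      have := h.rt (h.rs hx) (h.rs uv); grind
    have e2 : R x a ∨ B x a := by
      have := h.rt (h.rs hx) (h.rs av); grind
    have xb : ¬ (R x b ∨ B x b) := fun e3 =>
      h.k5 e1 e2 e3 (Or.inl (h.rs hx)) (Or.inr ua) (Or.inr ub) (Or.inl uv) (Or.inr ab) (Or.inl av) (Or.inr bv)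
    have xb' : x ≠ b := by rintro rfl; exact h.rb (h.rs hx) bv
    have xu' : R x u := by
      rcases e1 with e1 | e1
      · exact e1
      · have := h.bt e1 ub; grind
    have xz : B x z := by
      rcases h.rt xu' (h.rs uz) with h1 | h1 | h1
      · subst h1; exact (h.rb (h.rs hx) zv).elim
      · have := h.rt h1 bz; grind
      · exact h1
    rcases htx with h1 | h1
    · exact hA' t (h.rt h1 (h.rs hx))
    · exact hZ' t (h.bt h1 xz)
  · exact hB t htx
  · by_cases xz : x = z
    · subst xz; exact hZ' t (Or.inr htx)
    rcases htx with h1 | h1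
    · exact hB' t (h.rt h1 (h.rs hx))
    have e1 := h.rt (h.rs hx) (h.rs bz)
    rcases e1 with e1 | e1 | e1
    · exact absurd e1 xz
    · have xu : B x u := by
        rcases h.rt e1 uz with h2 | h2 | h2
        · subst h2; exact (h.rb (h.rs hx) ub).elim
        · have xv : R x v ∨ B x v := by
            rcases h.rt h2 uv with h3 | h3
            · subst h3; exact (h.rb hx bv).elim
            · exact h3
          exact (h.k5 (Or.inl h2) (Or.inl e1) (Or.inl (h.rs hx)) xv (Or.inl (h.rs uz)) (Or.inr ub)
            (Or.inl uv) (Or.inl bz) (Or.inr zv) (Or.inr bv)).elim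
        · exact h2
      exact hU' u uv ub t (h.bt h1 xu)
    · exact hZ' t (h.bt h1 e1)
end


structure APiece {V : Type u} (R B : V → V → Prop) (X Y : V → Prop) : Prop where
  disj : ∀ v, X v → Y v → False
  cX : ∀ u v, X u → X v → u ≠ v → R u v ∨ B u v
  cY : ∀ u v, Y u → Y v → u ≠ v → R u v ∨ B u v
  non : ∃ x y, X x ∧ Y y ∧ ¬ (R x y ∨ B x y)
  redX : ∀ x z, X x → ¬ X z → ¬ Y z → (R x z ∨ B x z) → R x z ∧ ∀ x', X x' → R x' z ∨ B x' z
  redY : ∀ x z, Y x → ¬ X z → ¬ Y z → (R x z ∨ B x z) → R x z ∧ ∀ x', Y x' → R x' z ∨ B x' z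

def NoTwin {V : Type u} (R B : V → V → Prop) : Prop :=
  ∀ u v, (R u v ∨ B u v) → ∃ z, z ≠ u ∧ z ≠ v ∧
    (((R z u ∨ B z u) ∧ ¬ (R z v ∨ B z v)) ∨ ((R z v ∨ B z v) ∧ ¬ (R z u ∨ B z u)))

def Wk {V : Type u} (B : V → V → Prop) : ℕ → V → V → Prop
  | 0, x, y => x = y
  | n + 1, x, y => ∃ m, B x m ∧ Wk B n m y

section
variable {V : Type u} {R B : V → V → Prop}

theorem Wk.add {m n : ℕ} {x y z : V} (h1 : Wk B m x y) (h2 : Wk B n y z) : Wk B (m + n) x z := by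
  induction m generalizing x with
  | zero => cases h1; simpa using h2
  | succ m ih =>
    obtain ⟨w, hw, h1⟩ := h1
    have := ih h1
    rw [show m + 1 + n = (m + n) + 1 by omega]
    exact ⟨w, hw, this⟩

theorem Wk.one {x y : V} (h : B x y) : Wk B 1 x y := ⟨y, h, rfl⟩

theorem Wk.symm (hs : ∀ {x y}, B x y → B y x) {m : ℕ} {x y : V} (h1 : Wk B m x y) : Wk B m y x := by
  induction m generalizing x with
  | zero => exact Eq.symm h1
  | succ m ih =>
    obtain ⟨w, hw, h1⟩ := h1
    exact (ih h1).add (Wk.one (hs hw))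

theorem Wk.last (hs : ∀ {x y}, B x y → B y x) {m : ℕ} {x y : V} (h1 : Wk B (m + 1) x y) :
    ∃ w, Wk B m x w ∧ B w y := by
  obtain ⟨w, hw, h2⟩ := h1.symm hs
  exact ⟨w, h2.symm hs, hs hw⟩

theorem noI (h : TC R B) (tw : NoTwin R B) (np : ∀ X Y, ¬ APiece R B X Y)
    {u a b v : V} (ub : B u b) (ab : B a b) (ua : B u a) (bv : B b v)
    (uv : R u v) (av : R a v) : False := by
  have key : ∀ {u a z : V}, B u b → B a b → B u a → R u v → R a v → (R z u ∨ B z u) → z ≠ a →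
      ¬ (R z a ∨ B z a) → False := by
    intro u a z ub ab ua uv av zu za nz
    rw [not_or] at nz
    obtain ⟨h1, bz, zv, vz⟩ := caseI h ub ab ua bv uv av zu za nz.1 nz.2
    refine np (fun x => x = v ∨ R v x) (fun x => (x = b ∨ R b x) ∧ ¬ (x = v ∨ R v x)) ⟨?_, ?_, ?_, ?_, ?_, ?_⟩
    · intro x hx hy; exact hy.2 hx
    · intro x y hx hy hxy
      rcases hx with rfl | hx <;> rcases hy with rfl | hy
      · exact absurd rfl hxy
      · exact Or.inl hy
      · exact Or.inl (h.rs hx)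
      · exact (h.rt (h.rs hx) hy).resolve_left hxy
    · rintro x y ⟨hx, -⟩ ⟨hy, -⟩ hxy
      rcases hx with rfl | hx <;> rcases hy with rfl | hy
      · exact absurd rfl hxy
      · exact Or.inl hy
      · exact Or.inl (h.rs hx)
      · exact (h.rt (h.rs hx) hy).resolve_left hxy
    · refine ⟨a, z, Or.inr (h.rs av), ⟨Or.inr bz, ?_⟩, ?_⟩
      · rintro (h2 | h2)
        · exact zv h2
        · exact vz h2
      · rintro (h2 | h2)
        · exact nz.1 (h.rs h2)
        · exact nz.2 (h.bs h2)
    · intro x t hx ht1 ht2 hxt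
      have := h1 x t (by rcases hx with hx | hx <;> simp [hx]) hxt
      grind
    · intro x t hx ht1 ht2 hxt
      have := h1 x t (by rcases hx.1 with hx | hx <;> simp [hx]) hxt
      grind
  obtain ⟨z, zu, za, ⟨h1, h2⟩ | ⟨h1, h2⟩⟩ := tw u a (Or.inr ua)
  · exact key ub ab ua uv av h1 za h2
  · exact key ab ub (h.bs ua) av uv h1 zu h2

theorem noII (h : TC R B) (tw : NoTwin R B) (np : ∀ X Y, ¬ APiece R B X Y)
    {u a b v : V} (ab : B a b) (bv : B b v) (bu : B b u) (ua : B u a)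
    (uv : B u v) (av : R a v) : False := by
  have key : ∀ {a v z : V}, B a b → B b v → B u a → B u v → R a v → (R z a ∨ B z a) → z ≠ v →
      ¬ (R z v ∨ B z v) → False := by
    intro a v z ab bv ua uv av za zv nz
    have hza : B z a := by
      rcases za with h1 | h1
      · have := h.rt h1 av; grind
      · exact h1
    have zu : z ≠ u := by rintro rfl; exact nz (Or.inr uv)
    have zb : z ≠ b := by rintro rfl; exact nz (Or.inr bv)
    have hzu : R z u := by
      rcases h.bt hza (h.bs ua) with h1 | h1 | h1
      · exact absurd h1 zu
      · exact h1
      · have := h.bt h1 uv; grind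
    have hzb : R z b := by
      rcases h.bt hza ab with h1 | h1 | h1
      · exact absurd h1 zb
      · exact h1
      · have := h.bt h1 bv; grind
    exact noI h tw np ua (h.bs ab) (h.bs bu) (h.bs hza) (h.rs hzu) (h.rs hzb)
  obtain ⟨z, zu, za, ⟨h1, h2⟩ | ⟨h1, h2⟩⟩ := tw a v (Or.inl av)
  · exact key ab bv ua uv av h1 za h2
  · exact key (h.bs bv) (h.bs ab) uv ua (h.rs av) h1 zu h2

theorem triB (h : TC R B) (tw : NoTwin R B) (np : ∀ X Y, ¬ APiece R B X Y)
    {u a b v : V} (ua : B u a) (ub : B u b) (ab : B a b) (bv : B b v) (vu : v ≠ u) (va : v ≠ a) :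
    B u v ∧ B a v := by
  rcases h.bt ub bv with h1 | h1 | h1
  · exact absurd h1.symm vu
  · rcases h.bt ab bv with h2 | h2 | h2
    · exact absurd h2.symm va
    · exact (noI h tw np ub ab ua bv h1 h2).elim
    · exact (noII h tw np ub bv (h.bs ab) (h.bs ua) h2 h1).elim
  · rcases h.bt ab bv with h2 | h2 | h2
    · exact absurd h2.symm va
    · exact (noII h tw np ab bv (h.bs ub) ua h1 h2).elim
    · exact ⟨h1, h2⟩

theorem triComp (h : TC R B) (tw : NoTwin R B) (np : ∀ X Y, ¬ APiece R B X Y)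
    {o p q : V} (op : B o p) (oq : B o q) (pq : B p q) {x : V} (hx : Relation.ReflTransGen B o x) :
    x = o ∨ B o x := by
  induction hx with
  | refl => exact Or.inl rfl
  | @tail x y _ xy ih =>
    by_cases yo : y = o
    · exact Or.inl yo
    right
    rcases ih with rfl | ox
    · exact xy
    have : ∃ r, B o r ∧ B r x := by
      by_cases xp : x = p
      · subst xp; exact ⟨q, oq, h.bs pq⟩
      by_cases xq : x = q
      · subst xq; exact ⟨p, op, pq⟩
      exact ⟨p, op, (triB h tw np pq (h.bs op) (h.bs oq) ox xp xq).1⟩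
    obtain ⟨r, h1, h2⟩ := this
    by_cases yr : y = r
    · subst yr; exact h1
    exact (triB h tw np h1 ox h2 xy yo yr).1

theorem evenWk (h : TC R B) {o : V}
    (nt : ∀ p q r, Relation.ReflTransGen B o p → B p q → B q r → B p r → False) (n : ℕ) :
    ∀ x y, Relation.ReflTransGen B o x → Wk B (2 * n) x y → x = y ∨ R x y := by
  have P1 : ∀ x m y, Relation.ReflTransGen B o x → B x m → B m y → x = y ∨ R x y := by
    intro x m y hx h1 h2
    rcases h.bt h1 h2 with h3 | h3 | h3
    · exact Or.inl h3
    · exact Or.inr h3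
    · exact (nt x m y hx h1 h2 h3).elim
  induction n with
  | zero => intro x y _ h1; exact Or.inl h1
  | succ n ih =>
    intro x0 x' hx0 hw
    obtain ⟨y0, h00, hw⟩ := (hw : Wk B (2 * n + 1 + 1) x0 x')
    have hy0 := hx0.tail h00
    obtain ⟨yn, hw1, hn⟩ := hw.last h.bs
    obtain ⟨x1, h01, hw2⟩ := hw
    have hx1 := hy0.tail h01
    rcases P1 x0 y0 x1 hx0 h00 h01 with rfl | e1
    · exact ih _ _ hx1 hw2
    rcases ih _ _ hx1 hw2 with rfl | e2
    · exact Or.inr e1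
    rcases h.rt e1 e2 with h3 | h3 | h3
    · exact Or.inl h3
    · exact Or.inr h3
    exfalso
    rcases ih _ _ hy0 hw1 with rfl | e3
    · exact nt _ _ _ hx0 h00 hn h3
    have e4 : R y0 x' := by
      rcases P1 _ _ _ hy0 (h.bs h00) h3 with rfl | e
      · exact (h.rb e2 (h.bs h01)).elim
      · exact e
    have hx' := hx0.tail h3
    have hyn := hx'.tail (h.bs hn)
    have e5 : R yn x0 := by
      rcases P1 _ _ _ hyn hn (h.bs h3) with rfl | e
      · exact (h.rb e3 (h.bs h00)).elim
      · exact e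
    have e6 : R x1 yn ∨ B x1 yn := by
      rcases h.rt (h.rs e1) (h.rs e5) with rfl | e
      · exact (h.rb e3 h01).elim
      · exact e
    exact h.k5 (Or.inr h00) (Or.inl e1) (Or.inr h3) (Or.inl (h.rs e5)) (Or.inr h01) (Or.inl e4)
      (Or.inl e3) (Or.inl e2) e6 (Or.inr (h.bs hn))

theorem compClique (h : TC R B) (tw : NoTwin R B) (np : ∀ X Y, ¬ APiece R B X Y)
    {o x : V} (hox : Relation.ReflTransGen B o x) : o = x ∨ R o x ∨ B o x := by
  have sy : ∀ {x y : V}, Relation.ReflTransGen B x y → Relation.ReflTransGen B y x := by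
    intro x y hxy
    induction hxy with
    | refl => exact Relation.ReflTransGen.refl
    | tail _ h2 ih => exact Relation.ReflTransGen.head (h.bs h2) ih
  by_cases nt : ∀ p q r, Relation.ReflTransGen B o p → B p q → B q r → B p r → False
  · by_contra hc
    have toR : ∀ {m : ℕ} {y : V}, Wk B m o y → Relation.ReflTransGen B o y := by
      intro m
      induction m with
      | zero => rintro y rfl; exact Relation.ReflTransGen.refl
      | succ m ih =>
        intro y hy
        obtain ⟨w, h1, h2⟩ := hy.last h.bs
        exact (ih h1).tail h2
    have toW : ∀ {y : V}, Relation.ReflTransGen B o y → ∃ n, Wk B n o y := by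
      intro y hy
      induction hy with
      | refl => exact ⟨0, rfl⟩
      | tail _ h2 ih => obtain ⟨n, hn⟩ := ih; exact ⟨n + 1, hn.add (Wk.one h2)⟩
    have ev := evenWk h nt
    have XX : ∀ {x y : V}, (∃ n, Wk B (2 * n) o x) → (∃ n, Wk B (2 * n) o y) → x = y ∨ R x y := by
      rintro x y ⟨n, hn⟩ ⟨m, hm⟩
      exact ev (n + m) x y (toR hn) (by rw [mul_add]; exact (hn.symm h.bs).add hm)
    have YY : ∀ {x y : V}, (∃ n, Wk B (2 * n + 1) o x) → (∃ n, Wk B (2 * n + 1) o y) → x = y ∨ R x y := by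
      rintro x y ⟨n, hn⟩ ⟨m, hm⟩
      refine ev (n + m + 1) x y (toR hn) ?_
      have := (hn.symm h.bs).add hm
      rwa [show 2 * (n + m + 1) = 2 * n + 1 + (2 * m + 1) by ring]
    refine np (fun x => ∃ n, Wk B (2 * n) o x) (fun x => ∃ n, Wk B (2 * n + 1) o x) ⟨?_, ?_, ?_, ?_, ?_, ?_⟩
    · rintro x ⟨n, hn⟩ ⟨m, hm⟩
      obtain ⟨y, h1, h2⟩ := (hm : Wk B (2 * m + 1) o x)
      have h3 : Wk B (2 * (m + n)) y o := by rw [mul_add]; exact h2.add (hn.symm h.bs)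
      rcases ev _ _ _ (Relation.ReflTransGen.single h1) h3 with rfl | h4
      · exact h.bi h1
      · exact h.rb h4 (h.bs h1)
    · intro x y hx hy hxy; exact Or.inl ((XX hx hy).resolve_left hxy)
    · intro x y hx hy hxy; exact Or.inl ((YY hx hy).resolve_left hxy)
    · refine ⟨o, x, ⟨0, rfl⟩, ?_, fun h1 => hc (Or.inr h1)⟩
      obtain ⟨n, hn⟩ := toW hox
      rcases Nat.even_or_odd' n with ⟨m, rfl | rfl⟩
      · exfalso
        rcases XX ⟨0, rfl⟩ ⟨m, hn⟩ with h1 | h1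
        · exact hc (Or.inl h1)
        · exact hc (Or.inr (Or.inl h1))
      · exact ⟨m, hn⟩
    · rintro y z hy hz1 hz2 hyz
      have hr : R y z := by
        rcases hyz with h1 | h1
        · exact h1
        · obtain ⟨n, hn⟩ := hy
          exact (hz2 ⟨n, hn.add (Wk.one h1)⟩).elim
      refine ⟨hr, fun y' hy' => ?_⟩
      rcases XX hy' hy with rfl | h1
      · exact Or.inl hr
      · rcases h.rt h1 hr with rfl | h2
        · exact (hz1 hy').elim
        · exact h2
    · rintro y z hy hz1 hz2 hyz
      have hr : R y z := by
        rcases hyz with h1 | h1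
        · exact h1
        · obtain ⟨n, hn⟩ := hy
          exact (hz1 ⟨n + 1, hn.add (Wk.one h1)⟩).elim
      refine ⟨hr, fun y' hy' => ?_⟩
      rcases YY hy' hy with rfl | h1
      · exact Or.inl hr
      · rcases h.rt h1 hr with rfl | h2
        · exact (hz2 hy').elim
        · exact h2
  · push Not at nt
    obtain ⟨p, q, r, hp, pq, qr, pr, -⟩ := nt
    have h1 := triComp h tw np pq pr qr (sy hp)
    have h2 := triComp h tw np pq pr qr ((sy hp).trans hox)
    rcases h1 with rfl | h1
    · rcases h2 with rfl | h2
      · exact Or.inl rfl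
      · exact Or.inr (Or.inr h2)
    · rcases h2 with rfl | h2
      · exact Or.inr (Or.inr (h.bs h1))
      · exact h.bt (h.bs h1) h2
end


section
variable {V : Type u}

def twS (G : SimpleGraph V) : Setoid V where
  r u v := ∀ w, (w = u ∨ G.Adj w u) ↔ (w = v ∨ G.Adj w v)
  iseqv := ⟨fun _ _ => Iff.rfl, fun h w => (h w).symm, fun h1 h2 w => (h1 w).trans (h2 w)⟩

def tp (G : SimpleGraph V) (v : V) : Quotient (twS G) := Quotient.mk _ v

noncomputable def tout (G : SimpleGraph V) (p : Quotient (twS G)) : V := Quotient.out p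

theorem tp_to (G : SimpleGraph V) (p : Quotient (twS G)) : tp G (tout G p) = p := Quotient.out_eq p

theorem tp_eq {G : SimpleGraph V} {u v : V} (h : tp G u = tp G v) :
    ∀ w, (w = u ∨ G.Adj w u) ↔ (w = v ∨ G.Adj w v) := Quotient.exact h

theorem tp_of {G : SimpleGraph V} {u v : V} (h : ∀ w, (w = u ∨ G.Adj w u) ↔ (w = v ∨ G.Adj w v)) :
    tp G u = tp G v := Quotient.sound h

theorem tp_adj {G : SimpleGraph V} {u v : V} (h : tp G u = tp G v) (hne : u ≠ v) : G.Adj u v := by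
  have := (tp_eq h u).1 (Or.inl rfl)
  exact this.resolve_left hne

theorem tp_adj1 {G : SimpleGraph V} {u u' v : V} (h : tp G u = tp G u') (hn : tp G u ≠ tp G v)
    (ha : G.Adj u v) : G.Adj u' v := by
  have := (tp_eq h v).1 (Or.inr ha.symm)
  rcases this with rfl | h1
  · exact absurd h hn
  · exact h1.symm

theorem tp_adj2 {G : SimpleGraph V} {u u' v v' : V} (h : tp G u = tp G u') (h' : tp G v = tp G v')
    (hn : tp G u ≠ tp G v) (ha : G.Adj u v) : G.Adj u' v' := by
  have h1 := tp_adj1 h hn ha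
  exact (tp_adj1 h' (fun e => hn (h.trans e.symm)) h1.symm).symm

def RR (G : SimpleGraph V) (c : Sym2 V → Bool) (b : Bool) (p q : Quotient (twS G)) : Prop :=
  p ≠ q ∧ G.Adj (tout G p) (tout G q) ∧ c s(tout G p, tout G q) = b

variable {G : SimpleGraph V} {c : Sym2 V → Bool}

theorem RR_or {b : Bool} {p q : Quotient (twS G)} :
    (RR G c b p q ∨ RR G c (!b) p q) ↔ p ≠ q ∧ G.Adj (tout G p) (tout G q) := by
  unfold RR
  cases b <;> cases c s(tout G p, tout G q) <;> simp

theorem RR_symm {b : Bool} {p q : Quotient (twS G)} (h : RR G c b p q) : RR G c b q p :=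
  ⟨h.1.symm, h.2.1.symm, by rw [Sym2.eq_swap]; exact h.2.2⟩

theorem RR_trans (hv : ValidC G c) {b : Bool} {p q r : Quotient (twS G)} (h : RR G c b p q)
    (h' : RR G c b q r) : p = r ∨ (p ≠ r ∧ G.Adj (tout G p) (tout G r)) := by
  by_contra hc
  rw [not_or, not_and] at hc
  refine hv _ _ _ h.2.1 h'.2.1 ?_ (hc.2 hc.1) (h.2.2.trans h'.2.2.symm)
  intro e
  apply hc.1
  rw [← tp_to G p, e, tp_to]

theorem k5_aux {k : ℕ} (hk : k ≤ 4)
    (hcl : ∀ s : Finset V, (∀ u ∈ s, ∀ v ∈ s, u ≠ v → G.Adj u v) → s.card ≤ k) {a b c d e : V}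
    (h1 : G.Adj a b) (h2 : G.Adj a c) (h3 : G.Adj a d) (h4 : G.Adj a e) (h5 : G.Adj b c)
    (h6 : G.Adj b d) (h7 : G.Adj b e) (h8 : G.Adj c d) (h9 : G.Adj c e) (h10 : G.Adj d e) : False := by
  classical
  have := hcl {a, b, c, d, e} (by
    intro u hu v hv hne
    simp only [Finset.mem_insert, Finset.mem_singleton] at hu hv
    rcases hu with rfl | rfl | rfl | rfl | rfl <;> rcases hv with rfl | rfl | rfl | rfl | rfl <;>
      first | exact absurd rfl hne | assumption | (apply SimpleGraph.Adj.symm; assumption))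
  have h : ({a, b, c, d, e} : Finset V).card = 5 := by
    simp [h1.ne, h2.ne, h3.ne, h4.ne, h5.ne, h6.ne, h7.ne, h8.ne, h9.ne, h10.ne]
  omega

theorem TC_RR (hv : ValidC G c) {k : ℕ} (hk : k ≤ 4)
    (hcl : ∀ s : Finset V, (∀ u ∈ s, ∀ v ∈ s, u ≠ v → G.Adj u v) → s.card ≤ k) (b : Bool) :
    TC (RR G c b) (RR G c (!b)) where
  rs := RR_symm
  bs := RR_symm
  rb h1 h2 := by have := h1.2.2.symm.trans h2.2.2; cases b <;> simp at this
  ri h := h.1 rfl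
  bi h := h.1 rfl
  rt h1 h2 := by rw [RR_or]; exact RR_trans hv h1 h2
  bt h1 h2 := by rw [RR_or]; exact RR_trans hv h1 h2
  k5 h1 h2 h3 h4 h5 h6 h7 h8 h9 h10 := by
    rw [RR_or] at *
    exact k5_aux hk hcl h1.2 h2.2 h3.2 h4.2 h5.2 h6.2 h7.2 h8.2 h9.2 h10.2

theorem NoTwin_RR (b : Bool) : NoTwin (RR G c b) (RR G c (!b)) := by
  intro p q h
  simp only [RR_or] at h ⊢
  have key : ∀ {p q : Quotient (twS G)} {w : V}, p ≠ q → G.Adj (tout G p) (tout G q) →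
      (w = tout G p ∨ G.Adj w (tout G p)) → ¬ (w = tout G q ∨ G.Adj w (tout G q)) →
      tp G w ≠ p ∧ tp G w ≠ q ∧ (tp G w ≠ p ∧ G.Adj (tout G (tp G w)) (tout G p)) ∧
        ¬ (tp G w ≠ q ∧ G.Adj (tout G (tp G w)) (tout G q)) := by
    intro p q w hpq ha h1 h2
    rw [not_or] at h2
    have h3 : G.Adj w (tout G p) := by
      rcases h1 with rfl | h1
      · exact absurd ha h2.2
      · exact h1
    have hp : tp G w ≠ p := by
      intro e
      refine h2.2 (tp_adj1 (u := tout G p) ?_ ?_ ha)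
      · rw [tp_to, e]
      · rw [tp_to, tp_to]; exact hpq
    have hq : tp G w ≠ q := by
      intro e
      exact h2.2 (tp_adj (by rw [tp_to, e]) h2.1)
    refine ⟨hp, hq, ⟨hp, ?_⟩, fun h4 => h2.2 ?_⟩
    · exact tp_adj1 (tp_to G _).symm (by rwa [tp_to]) h3
    · exact tp_adj1 (tp_to G _) (by rwa [tp_to, tp_to]) h4.2
  by_contra hc
  push Not at hc
  apply h.1
  rw [← tp_to G p, ← tp_to G q]
  apply tp_of
  intro w
  by_contra hw
  by_cases h1 : w = tout G p ∨ G.Adj w (tout G p)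
  · have h2 : ¬ (w = tout G q ∨ G.Adj w (tout G q)) := fun h2 => hw ⟨fun _ => h2, fun _ => h1⟩
    obtain ⟨a1, a2, a3, a4⟩ := key h.1 h.2 h1 h2
    exact a4 ((hc _ a1 a2).1 a3)
  · have h2 : (w = tout G q ∨ G.Adj w (tout G q)) := by
      by_contra h2; exact hw ⟨fun h => absurd h h1, fun h => absurd h h2⟩
    obtain ⟨a1, a2, a3, a4⟩ := key h.1.symm h.2.symm h2 h1
    exact a4 ((hc _ a2 a1).2 a3)

noncomputable def cq (G : SimpleGraph V) (c : Sym2 V → Bool) (b : Bool) (e : Sym2 V) : Bool :=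
  c (e.map (fun v => tout G (tp G v))) == b

theorem cq_valid (hv : ValidC G c) (b : Bool) : ValidC G (cq G c b) := by
  intro u v w huv hvw hne hn
  have h1 : tp G u ≠ tp G w := fun e => hn (tp_adj e hne)
  have h2 : tp G u ≠ tp G v := fun e => hn (tp_adj1 e.symm (fun e' => h1 (e.trans e')) hvw)
  have h3 : tp G v ≠ tp G w := fun e => hn (tp_adj1 e (fun e' => h2 e'.symm) huv.symm).symm
  have := hv (tout G (tp G u)) (tout G (tp G v)) (tout G (tp G w))
    (tp_adj2 (tp_to G _).symm (tp_to G _).symm h2 huv) (tp_adj2 (tp_to G _).symm (tp_to G _).symm h3 hvw)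
    (fun e => h1 (by rw [← tp_to G (tp G u), e, tp_to]))
    (fun e => hn (tp_adj2 (tp_to G _) (tp_to G _) (by rwa [tp_to, tp_to]) e))
  simp only [cq, Sym2.map_mk]
  intro e
  apply this
  generalize c s(tout G (tp G u), tout G (tp G v)) = x at *
  generalize c s(tout G (tp G v), tout G (tp G w)) = y at *
  cases x <;> cases y <;> cases b <;> simp_all

open Classical in
theorem lift_piece [Fintype V] {b : Bool} {X Y : Quotient (twS G) → Prop} (h : APiece (RR G c b) (RR G c (!b)) X Y) :
    PieceC G (cq G c b) (Finset.univ.filter fun v => X (tp G v)) (Finset.univ.filter fun v => Y (tp G v)) := by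
  have A : ∀ {u v : V}, (RR G c b (tp G u) (tp G v) ∨ RR G c (!b) (tp G u) (tp G v)) → G.Adj u v := by
    intro u v h
    rw [RR_or] at h
    exact tp_adj2 (tp_to G _) (tp_to G _) (by rw [tp_to, tp_to]; exact h.1) h.2
  have A' : ∀ {u v : V}, tp G u ≠ tp G v → G.Adj u v → (RR G c b (tp G u) (tp G v) ∨ RR G c (!b) (tp G u) (tp G v)) := by
    intro u v h h'
    rw [RR_or]
    exact ⟨h, tp_adj2 (tp_to G _).symm (tp_to G _).symm h h'⟩
  have cC : ∀ {Z : Quotient (twS G) → Prop}, (∀ u v, Z u → Z v → u ≠ v → RR G c b u v ∨ RR G c (!b) u v) →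
      ∀ u v : V, Z (tp G u) → Z (tp G v) → u ≠ v → G.Adj u v := by
    intro Z hZ u v hu hv hne
    by_cases e : tp G u = tp G v
    · exact tp_adj e hne
    · exact A (hZ _ _ hu hv e)
  refine ⟨?_, ?_, ?_, ?_, ?_, ?_⟩
  · intro v h1 h2
    simp only [Finset.mem_filter, Finset.mem_univ, true_and] at h1 h2
    exact h.disj _ h1 h2
  · intro u hu v hv
    simp only [Finset.mem_filter, Finset.mem_univ, true_and] at hu hv
    exact cC h.cX u v hu hv
  · intro u hu v hv
    simp only [Finset.mem_filter, Finset.mem_univ, true_and] at hu hv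
    exact cC h.cY u v hu hv
  · obtain ⟨x, y, hx, hy, hn⟩ := h.non
    refine ⟨tout G x, by simpa [tp_to] using hx, tout G y, by simpa [tp_to] using hy, fun h1 => hn ?_⟩
    rw [RR_or]
    exact ⟨fun e => h.disj y (e ▸ hx) hy, h1⟩
  · intro x hx z hz1 hz2 hxz
    simp only [Finset.mem_filter, Finset.mem_univ, true_and] at hx hz1 hz2
    obtain ⟨h1, h2⟩ := h.redX _ _ hx hz1 hz2 (A' (fun e => hz1 (e ▸ hx)) hxz)
    refine ⟨by simp [cq, h1.2.2], fun x' hx' => A (h2 _ ?_)⟩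
    simpa using hx'
  · intro x hx z hz1 hz2 hxz
    simp only [Finset.mem_filter, Finset.mem_univ, true_and] at hx hz1 hz2
    obtain ⟨h1, h2⟩ := h.redY _ _ hx hz1 hz2 (A' (fun e => hz2 (e ▸ hx)) hxz)
    refine ⟨by simp [cq, h1.2.2], fun x' hx' => A (h2 _ ?_)⟩
    simpa using hx'

def compS (G : SimpleGraph V) (c : Sym2 V → Bool) (b : Bool) : Setoid (Quotient (twS G)) where
  r := Relation.ReflTransGen (RR G c b)
  iseqv := ⟨fun _ => Relation.ReflTransGen.refl, fun {x y} hxy => by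
    induction hxy with
    | refl => exact Relation.ReflTransGen.refl
    | tail _ h2 ih => exact Relation.ReflTransGen.head (RR_symm h2) ih, fun h1 h2 => h1.trans h2⟩

open Classical in
theorem no_piece_color [Fintype V] {k : ℕ} (hk : k ≤ 4) (hv : ValidC G c)
    (hcl : ∀ s : Finset V, (∀ u ∈ s, ∀ v ∈ s, u ≠ v → G.Adj u v) → s.card ≤ k)
    (np : ∀ b X Y, ¬ APiece (RR G c b) (RR G c (!b)) X Y)
    (L : V → Finset ℕ) (hL : ∀ v, (L v).card = k) : ListColorable G L := by
  have fib : ∀ (b : Bool) (s : Quotient (compS G c b)),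
      Nat.card {v : V // (Quotient.mk (compS G c b) (tp G v)) = s} ≤ k := by
    intro b s
    rw [Nat.card_eq_fintype_card, Fintype.card_subtype]
    apply hcl
    intro u hu v hv' hne
    simp only [Finset.mem_filter, Finset.mem_univ, true_and] at hu hv'
    have h1 : Relation.ReflTransGen (RR G c b) (tp G u) (tp G v) := Quotient.exact (hu.trans hv'.symm)
    have h2 : tp G u = tp G v ∨ RR G c (!b) (tp G u) (tp G v) ∨ RR G c b (tp G u) (tp G v) := by
      have t1 := TC_RR hv hk hcl (!b)
      have t2 := NoTwin_RR (G := G) (c := c) (!b)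
      have t3 := np (!b)
      rw [Bool.not_not] at t1 t2 t3
      exact compClique t1 t2 t3 h1
    rcases h2 with h2 | h2
    · exact tp_adj h2 hne
    · have h3 := RR_or.1 h2.symm
      exact tp_adj2 (tp_to G _) (tp_to G _) (by rw [tp_to, tp_to]; exact h3.1) h3.2
  obtain ⟨col, h1, h2⟩ := galvin k (fun v => Quotient.mk (compS G c true) (tp G v))
    (fun v => Quotient.mk (compS G c false) (tp G v)) (fib true) (fib false) L hL
  refine ⟨col, h1, fun u v huv => h2 u v huv.ne ?_⟩
  by_cases e : tp G u = tp G v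
  · left; simp only [e]
  · have : RR G c true (tp G u) (tp G v) ∨ RR G c (!true) (tp G u) (tp G v) :=
      RR_or.2 ⟨e, tp_adj2 (tp_to G _).symm (tp_to G _).symm e huv⟩
    rcases this with h3 | h3
    · left; exact Quotient.sound (Relation.ReflTransGen.single h3)
    · right; exact Quotient.sound (Relation.ReflTransGen.single h3)
end

theorem main_color {k : ℕ} (hk : k ≤ 4) (n : ℕ) : ∀ (V : Type u) [Fintype V] (G : SimpleGraph V) (c : Sym2 V → Bool),
    Fintype.card V = n → ValidC G c →
    (∀ s : Finset V, (∀ u ∈ s, ∀ v ∈ s, u ≠ v → G.Adj u v) → s.card ≤ k) →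
    ∀ L : V → Finset ℕ, (∀ v, (L v).card = k) → ListColorable G L := by
  induction n using Nat.strong_induction_on with
  | _ n ih =>
    intro V _ G c hn hv hcl L hL
    by_cases np : ∀ b X Y, ¬ APiece (RR G c b) (RR G c (!b)) X Y
    · exact no_piece_color hk hv hcl np L hL
    · push Not at np
      obtain ⟨b, X, Y, hP⟩ := np
      refine piece_color hk (cq_valid hv b) (lift_piece hP) hcl L hL ?_
      intro V' _ G' c' hlt hv' hcl' L' hL'
      exact ih _ (hn ▸ hlt) V' G' c' rfl hv' hcl' L' hL'

/-- Every elementary graph `G` with `ω(G) ≤ 4` satisfies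
`ch(G) = χ(G)`. -/
theorem elementary_choice_eq_chromatic
    {V : Type*} [Fintype V] (G : SimpleGraph V)
    (helem : IsElementary G) (homega : cliqueNumber G ≤ 4) :
    (choiceNumber G : ℕ∞) = G.chromaticNumber := by
  obtain ⟨c, hc⟩ := helem
  have bdd : BddAbove {n | ∃ s : Finset V, G.IsNClique n s} := by
    refine ⟨Fintype.card V, ?_⟩
    rintro n ⟨s, hs⟩
    rw [← hs.card_eq]
    exact Finset.card_le_univ s
  have hcl : ∀ s : Finset V, (∀ u ∈ s, ∀ v ∈ s, u ≠ v → G.Adj u v) → s.card ≤ cliqueNumber G := by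
    intro s hs
    exact le_csSup bdd ⟨s, ⟨fun u hu v hv hne => hs u hu v hv hne, rfl⟩⟩
  have hch : Choosable G (cliqueNumber G) := fun L hL =>
    main_color homega _ V G c rfl hc hcl L hL
  have h1 : choiceNumber G ≤ cliqueNumber G := Nat.sInf_le hch
  have h2 : Choosable G (choiceNumber G) := Nat.sInf_mem (s := {k | Choosable G k}) ⟨_, hch⟩
  apply le_antisymm
  · have h3 : cliqueNumber G ∈ {n | ∃ s : Finset V, G.IsNClique n s} :=
      Nat.sSup_mem ⟨0, ∅, by simp⟩ bdd
    obtain ⟨s, hs⟩ := h3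
    have h4 := hs.isClique.card_le_chromaticNumber
    rw [hs.card_eq] at h4
    exact le_trans (by exact_mod_cast h1) h4
  · obtain ⟨col, hm, hp⟩ := h2 (fun _ => Finset.range (choiceNumber G)) (fun _ => Finset.card_range _)
    apply SimpleGraph.Colorable.chromaticNumber_le
    refine ⟨SimpleGraph.Coloring.mk (fun v => (⟨col v, Finset.mem_range.1 (hm v)⟩ : Fin (choiceNumber G))) ?_⟩
    intro u v huv e
    exact hp huv (congrArg Fin.val e)
end
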